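/- Let M be a connected manifold of finite type of odd dimension d. Then for every k ≥ 0 there is an isomorphism of graded ℚ-vector spaces H_*(C_k(M); ℚ) ≅ Sym^k(H_*(M; ℚ)), where Sym^k denotes the degree-k component (spanned by monomials of length k) of the free graded-commutative algebra on the graded vector space H_*(M; ℚ) (polynomial on even-degree generators, exterior on odd-degree generators). -/

import Mathlib

open CategoryTheory

/-- The singular chain complex functor with coefficients in a commutative ring `R`:
the levelwise free `R`-module on the singular simplicial set of a space, turned into
a chain complex via the alternating face map complex. -/
noncomputable def singularChainComplexFunctor (R : Type) [CommRing R] :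
    TopCat.{0} ⥤ ChainComplex (ModuleCat.{0} R) ℕ :=
  TopCat.toSSet ⋙ ((SimplicialObject.whiskering _ _).obj (ModuleCat.free R)) ⋙
    AlgebraicTopology.alternatingFaceMapComplex _

/-- The `n`-th singular homology of a topological space, with coefficients in `R`. -/
noncomputable def SingularHomology (R : Type) [CommRing R] (n : ℕ) (X : Type)
    [TopologicalSpace X] : ModuleCat.{0} R :=
  (singularChainComplexFunctor R ⋙ HomologicalComplex.homologyFunctor _ _ n).obj (TopCat.of X)

/-- The setoid on the ordered configuration space (the space of injective tuples
`Fin k → M`) identifying tuples that differ by a permutation of the coordinates. -/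
def configSetoid (M : Type) (k : ℕ) : Setoid {f : Fin k → M // Function.Injective f} where
  r f g := ∃ σ : Equiv.Perm (Fin k), (f : Fin k → M) ∘ σ = g
  iseqv := by
    constructor
    · exact fun f => ⟨Equiv.refl _, rfl⟩
    · rintro f g ⟨σ, h⟩
      exact ⟨σ.symm, by rw [← h]; ext x; simp⟩
    · rintro f g h ⟨σ, hσ⟩ ⟨τ, hτ⟩
      exact ⟨τ.trans σ, by rw [← hτ, ← hσ]; rfl⟩

/-- The unordered configuration space `C_k(M)` of `k` points in `M`: the quotient of
the space of injective tuples `Fin k → M` (with the subspace topology from the product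
topology) by the permutation action of the symmetric group, with the quotient topology. -/
def UnordConfigSpace (M : Type) (k : ℕ) : Type := Quotient (configSetoid M k)

instance (M : Type) [TopologicalSpace M] (k : ℕ) : TopologicalSpace (UnordConfigSpace M k) :=
  instTopologicalSpaceQuotient

open scoped DirectSum

/-- The graded-commutativity relations on the tensor algebra of the direct sum of the
components of a graded vector space `V`: homogeneous elements of degrees `i` and `j`
commute up to the sign `(-1)^(i*j)`. -/
inductive GradedCommRel (V : ℕ → Type) [∀ i, AddCommGroup (V i)] [∀ i, Module ℚ (V i)] :
    TensorAlgebra ℚ (⨁ i, V i) → TensorAlgebra ℚ (⨁ i, V i) → Prop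
  | comm (i j : ℕ) (a : V i) (b : V j) :
      GradedCommRel V
        (TensorAlgebra.ι ℚ (DirectSum.of V i a) * TensorAlgebra.ι ℚ (DirectSum.of V j b))
        ((-1 : ℚ) ^ (i * j) •
          (TensorAlgebra.ι ℚ (DirectSum.of V j b) * TensorAlgebra.ι ℚ (DirectSum.of V i a)))

/-- The free graded-commutative algebra `Sym(V)` on a graded vector space `V`
(polynomial on the even-degree part, exterior on the odd-degree part), realized as the
quotient of the tensor algebra on `⨁ i, V i` by the graded-commutativity relations. -/
def FreeGCAlg (V : ℕ → Type) [∀ i, AddCommGroup (V i)] [∀ i, Module ℚ (V i)] : Type :=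
  RingQuot (GradedCommRel V)

noncomputable instance (V : ℕ → Type) [∀ i, AddCommGroup (V i)] [∀ i, Module ℚ (V i)] :
    Ring (FreeGCAlg V) := inferInstanceAs (Ring (RingQuot (GradedCommRel V)))

noncomputable instance (V : ℕ → Type) [∀ i, AddCommGroup (V i)] [∀ i, Module ℚ (V i)] :
    Algebra ℚ (FreeGCAlg V) := inferInstanceAs (Algebra ℚ (RingQuot (GradedCommRel V)))

/-- The generator of the free graded-commutative algebra corresponding to a homogeneous
element of the graded vector space `V`. -/
noncomputable def FreeGCAlg.gen (V : ℕ → Type) [∀ i, AddCommGroup (V i)] [∀ i, Module ℚ (V i)]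
    (p : Σ j, V j) : FreeGCAlg V :=
  RingQuot.mkAlgHom ℚ (GradedCommRel V) (TensorAlgebra.ι ℚ (DirectSum.of V p.1 p.2))

/-- The internal-degree-`i` component of `Sym^k(V)`: the subspace of the free
graded-commutative algebra on `V` spanned by products of `k` homogeneous elements of `V`
whose degrees sum to `i` (monomials of length `k` and total degree `i`). -/
noncomputable def SymComponent (V : ℕ → Type) [∀ i, AddCommGroup (V i)] [∀ i, Module ℚ (V i)]
    (k i : ℕ) : Submodule ℚ (FreeGCAlg V) :=
  Submodule.span ℚ { x | ∃ l : List (Σ j, V j), l.length = k ∧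
    (l.map Sigma.fst).sum = i ∧ x = (l.map (FreeGCAlg.gen V)).prod }


open CategoryTheory
open scoped DirectSum

namespace CS

/-- A simplicial rational vector space, in elementary form. -/
structure SMod where
  X : ℕ → Type
  [acg : ∀ n, AddCommGroup (X n)]
  [mod : ∀ n, Module ℚ (X n)]
  map : ∀ {m n : ℕ}, (Fin (m + 1) →o Fin (n + 1)) → X n →ₗ[ℚ] X m
  map_id : ∀ (n : ℕ) (x : X n), map (OrderHom.id : Fin (n + 1) →o Fin (n + 1)) x = x
  map_comp : ∀ {l m n : ℕ} (f : Fin (l + 1) →o Fin (m + 1)) (g : Fin (m + 1) →o Fin (n + 1))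
    (x : X n), map (g.comp f) x = map f (map g x)

attribute [instance] SMod.acg SMod.mod

/-- Face inclusion. -/
def δ {n : ℕ} (i : Fin (n + 2)) : Fin (n + 1) →o Fin (n + 2) := (Fin.succAboveOrderEmb i).toOrderHom

/-- Degeneracy. -/
def σ {n : ℕ} (i : Fin (n + 1)) : Fin (n + 2) →o Fin (n + 1) := ⟨i.predAbove, Fin.predAbove_right_monotone i⟩

@[simp] lemma δ_apply {n : ℕ} (i : Fin (n + 2)) (j : Fin (n + 1)) : δ i j = i.succAbove j := rfl
@[simp] lemma σ_apply {n : ℕ} (i : Fin (n + 1)) (j : Fin (n + 2)) : σ i j = i.predAbove j := rfl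

namespace SMod

variable (A : SMod)

/-- The associated simplicial object in Mathlib's sense. -/
def toSimp : SimplicialObject (ModuleCat.{0} ℚ) where
  obj n := ModuleCat.of ℚ (A.X n.unop.len)
  map f := ModuleCat.ofHom (A.map f.unop.toOrderHom)
  map_id n := by
    ext x
    exact A.map_id _ x
  map_comp f g := by
    ext x
    exact A.map_comp _ _ x

/-- The differential. -/
noncomputable def d (n : ℕ) : A.X (n + 1) →ₗ[ℚ] A.X n := ∑ i : Fin (n + 2), ((-1 : ℚ) ^ (i : ℕ)) • A.map (δ i)

lemma d_apply (n : ℕ) (x : A.X (n + 1)) :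
    A.d n x = ∑ i : Fin (n + 2), ((-1 : ℚ) ^ (i : ℕ)) • A.map (δ i) x := by
  simp [d]

lemma toSimp_objD (n : ℕ) :
    AlgebraicTopology.AlternatingFaceMapComplex.objD A.toSimp n = ModuleCat.ofHom (A.d n) := by
  ext x
  simp only [AlgebraicTopology.AlternatingFaceMapComplex.objD]
  erw [ModuleCat.hom_sum]
  erw [LinearMap.sum_apply]
  refine (Finset.sum_congr rfl ?_).trans (A.d_apply n x).symm
  intro i _
  rcases Nat.even_or_odd (i : ℕ) with h | h
  · simp only [h.neg_one_pow, one_smul]; rfl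
  · simp only [h.neg_one_pow, neg_smul, one_smul, ModuleCat.hom_neg]; rfl

lemma d_d (n : ℕ) (x : A.X (n + 2)) : A.d n (A.d (n + 1) x) = 0 := by
  have h := AlgebraicTopology.AlternatingFaceMapComplex.d_squared A.toSimp n
  rw [toSimp_objD, toSimp_objD] at h
  have := congrArg (fun f => f.hom x) h
  exact this

/-- The differential, extended by zero. -/
noncomputable def dd : (n : ℕ) → A.X n →ₗ[ℚ] A.X (n - 1)
  | 0 => 0
  | n + 1 => A.d n

@[simp] lemma dd_succ (n : ℕ) : A.dd (n + 1) = A.d n := rfl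
@[simp] lemma dd_zero : A.dd 0 = 0 := rfl
lemma dd_zero_apply (x : A.X 0) : A.dd 0 x = 0 := by rw [dd_zero]; rfl

lemma dd_d (n : ℕ) (x : A.X (n + 1)) : A.dd n (A.d n x) = 0 := by
  cases n with
  | zero => simp
  | succ n => exact A.d_d n x

noncomputable def Z (n : ℕ) : Submodule ℚ (A.X n) := LinearMap.ker (A.dd n)

noncomputable def B (n : ℕ) : Submodule ℚ (A.X n) := LinearMap.range (A.d n)

lemma B_le_Z (n : ℕ) : A.B n ≤ A.Z n := by
  rintro _ ⟨y, rfl⟩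
  exact A.dd_d n y

/-- Homology. -/
abbrev H (n : ℕ) : Type := A.Z n ⧸ (A.B n).comap (A.Z n).subtype

noncomputable def cls {n : ℕ} (x : A.X n) (hx : A.dd n x = 0) : A.H n := Submodule.Quotient.mk ⟨x, hx⟩

lemma cls_surj {n : ℕ} (h : A.H n) : ∃ (x : A.X n) (hx : A.dd n x = 0), A.cls x hx = h := by
  obtain ⟨⟨x, hx⟩, rfl⟩ := Submodule.Quotient.mk_surjective _ h
  exact ⟨x, hx, rfl⟩

lemma cls_eq_zero {n : ℕ} {x : A.X n} {hx : A.dd n x = 0} : A.cls x hx = 0 ↔ ∃ y, A.d n y = x := by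
  simp only [cls, Submodule.Quotient.mk_eq_zero]
  rfl

lemma cls_eq {n : ℕ} {x x' : A.X n} {hx : A.dd n x = 0} {hx' : A.dd n x' = 0} :
    A.cls x hx = A.cls x' hx' ↔ ∃ y, A.d n y = x - x' := by
  simp only [cls, Submodule.Quotient.eq]
  rfl

/-- Vanishing of homology. -/
def Acyc (n : ℕ) : Prop := ∀ x : A.X n, A.dd n x = 0 → ∃ y, A.d n y = x

/-- Morphisms. -/
structure Hom (A B : SMod) where
  app : ∀ n, A.X n →ₗ[ℚ] B.X n
  comm : ∀ {m n : ℕ} (f : Fin (m + 1) →o Fin (n + 1)) (x : A.X n),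
    app m (A.map f x) = B.map f (app n x)

variable {A} {B C : SMod}

lemma Hom.d (f : Hom A B) (n : ℕ) (x : A.X (n + 1)) : f.app n (A.d n x) = B.d n (f.app (n + 1) x) := by
  simp [d_apply, map_sum, f.comm]

lemma Hom.dd (f : Hom A B) (n : ℕ) (x : A.X n) : f.app (n - 1) (A.dd n x) = B.dd n (f.app n x) := by
  cases n with
  | zero => simp
  | succ n => exact f.d n x

@[simps] def Hom.id (A : SMod) : Hom A A := ⟨fun _ => LinearMap.id, fun _ _ => rfl⟩

@[simps] def Hom.comp (g : Hom B C) (f : Hom A B) : Hom A C :=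
  ⟨fun n => (g.app n).comp (f.app n), fun h x => by simp [f.comm, g.comm]⟩

/-- Map induced on homology. -/
noncomputable def Hom.H (f : Hom A B) (n : ℕ) : A.H n →ₗ[ℚ] B.H n :=
  Submodule.mapQ _ _ ((f.app n).restrict (p := A.Z n) (q := B.Z n) (by
    intro x hx
    change B.dd n (f.app n x) = 0
    rw [← f.dd, show A.dd n x = 0 from hx, map_zero])) (by
    rintro ⟨x, hx⟩ ⟨y, hy⟩
    exact ⟨f.app _ y, by rw [← f.d]; exact congrArg (f.app n) hy⟩)

lemma Hom.dd_app (f : Hom A B) {n : ℕ} {x : A.X n} (hx : A.dd n x = 0) : B.dd n (f.app n x) = 0 := by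
  rw [← f.dd, hx, map_zero]

@[simp] lemma Hom.H_cls (f : Hom A B) {n : ℕ} (x : A.X n) (hx : A.dd n x = 0) :
    f.H n (A.cls x hx) = B.cls (f.app n x) (f.dd_app hx) := rfl

lemma Hom.H_comp (g : Hom B C) (f : Hom A B) (n : ℕ) (x : A.H n) :
    (g.comp f).H n x = g.H n (f.H n x) := by
  obtain ⟨x, hx, rfl⟩ := A.cls_surj x
  rfl

lemma Hom.H_id (n : ℕ) (x : A.H n) : (Hom.id A).H n x = x := by
  obtain ⟨x, hx, rfl⟩ := A.cls_surj x
  rfl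

lemma cls_add {n : ℕ} {x y : A.X n} (hx : A.dd n x = 0) (hy : A.dd n y = 0) :
    A.cls (x + y) (by rw [map_add, hx, hy, add_zero]) = A.cls x hx + A.cls y hy := rfl

lemma cls_sub {n : ℕ} {x y : A.X n} (hx : A.dd n x = 0) (hy : A.dd n y = 0) :
    A.cls (x - y) (by rw [map_sub, hx, hy, sub_zero]) = A.cls x hx - A.cls y hy := rfl

lemma cls_smul {n : ℕ} {x : A.X n} (c : ℚ) (hx : A.dd n x = 0) :
    A.cls (c • x) (by rw [map_smul, hx, smul_zero]) = c • A.cls x hx := rfl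

/-- Short exact sequences. -/
structure SES (i : Hom A B) (p : Hom B C) : Prop where
  inj : ∀ n, Function.Injective (i.app n)
  surj : ∀ n, Function.Surjective (p.app n)
  zero : ∀ n x, p.app n (i.app n x) = 0
  exact : ∀ n y, p.app n y = 0 → ∃ x, i.app n x = y

namespace SES
variable {i : Hom A B} {p : Hom B C}

/-- Lifting a cycle. -/
lemma lift_cycle (h : SES i p) {n : ℕ} (z : C.X (n + 1)) (hz : C.d n z = 0) :
    ∃ y x, p.app _ y = z ∧ i.app _ x = B.d n y ∧ A.dd n x = 0 := by
  obtain ⟨y, rfl⟩ := h.surj _ z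
  obtain ⟨x, hx⟩ := h.exact n (B.d n y) (by rw [p.d, hz])
  refine ⟨y, x, rfl, hx, ?_⟩
  apply h.inj
  rw [i.dd, hx, B.dd_d, map_zero]

lemma acyc_right (h : SES i p) {n : ℕ} (hB : B.Acyc (n + 1)) (hA : A.Acyc n) : C.Acyc (n + 1) := by
  intro z hz
  obtain ⟨y, x, rfl, hx, hx0⟩ := h.lift_cycle z hz
  obtain ⟨w, rfl⟩ := hA x hx0
  obtain ⟨v, hv⟩ := hB (y - i.app _ w) (by simp [← i.d, hx])
  exact ⟨p.app _ v, by rw [← p.d, hv, map_sub, h.zero, sub_zero]⟩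

lemma acyc_right_zero (h : SES i p) (hB : B.Acyc 0) : C.Acyc 0 := by
  intro z _
  obtain ⟨y, rfl⟩ := h.surj _ z
  obtain ⟨v, rfl⟩ := hB y rfl
  exact ⟨p.app _ v, (p.d _ _).symm⟩

lemma acyc_left (h : SES i p) {n : ℕ} (hC : C.Acyc (n + 1)) (hB : B.Acyc n) : A.Acyc n := by
  intro x hx
  obtain ⟨y, hy⟩ := hB (i.app _ x) (i.dd_app hx)
  obtain ⟨w, hw⟩ := hC (p.app _ y) (by rw [dd_succ, ← p.d, hy, h.zero])
  obtain ⟨v, rfl⟩ := h.surj _ w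
  obtain ⟨u, hu⟩ := h.exact _ (y - B.d _ v) (by rw [map_sub, p.d, hw, sub_self])
  refine ⟨u, h.inj _ ?_⟩
  rw [i.d, hu, map_sub, B.d_d, hy, sub_zero]

/-- If the quotient is acyclic, the inclusion is a homology isomorphism. -/
lemma bij_of_acyc (h : SES i p) (hC : ∀ n, C.Acyc n) (n : ℕ) : Function.Bijective (i.H n) := by
  constructor
  · rw [injective_iff_map_eq_zero]
    intro x hx
    obtain ⟨x, hx0, rfl⟩ := A.cls_surj x
    rw [Hom.H_cls, cls_eq_zero] at hx
    obtain ⟨y, hy⟩ := hx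
    obtain ⟨w, hw⟩ := hC _ (p.app _ y) (by rw [dd_succ, ← p.d, hy, h.zero])
    obtain ⟨v, rfl⟩ := h.surj _ w
    obtain ⟨u, hu⟩ := h.exact _ (y - B.d _ v) (by rw [map_sub, p.d, hw, sub_self])
    rw [cls_eq_zero]
    refine ⟨u, h.inj _ ?_⟩
    rw [i.d, hu, map_sub, B.d_d, hy, sub_zero]
  · intro y
    obtain ⟨y, hy0, rfl⟩ := B.cls_surj y
    obtain ⟨w, hw⟩ := hC n (p.app _ y) (p.dd_app hy0)
    obtain ⟨v, rfl⟩ := h.surj _ w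
    obtain ⟨u, hu⟩ := h.exact _ (y - B.d _ v) (by rw [map_sub, p.d, hw, sub_self])
    have hu0 : A.dd n u = 0 := by
      apply h.inj
      rw [i.dd, hu, map_sub, B.dd_d, hy0, sub_zero, map_zero]
    refine ⟨A.cls u hu0, ?_⟩
    rw [Hom.H_cls, cls_eq]
    exact ⟨- v, by rw [hu, map_neg]; abel⟩

/-- If the kernel is acyclic, the projection is a homology isomorphism. -/
lemma bij_of_acyc_left (h : SES i p) (hA : ∀ n, A.Acyc n) (n : ℕ) : Function.Bijective (p.H n) := by
  constructor
  · rw [injective_iff_map_eq_zero]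
    intro x hx
    obtain ⟨x, hx0, rfl⟩ := B.cls_surj x
    rw [Hom.H_cls, cls_eq_zero] at hx
    obtain ⟨y, hy⟩ := hx
    obtain ⟨y, rfl⟩ := h.surj _ y
    obtain ⟨u, hu⟩ := h.exact _ (x - B.d _ y) (by rw [map_sub, p.d, hy, sub_self])
    have hu0 : A.dd n u = 0 := by
      apply h.inj
      rw [i.dd, hu, map_sub, B.dd_d, hx0, sub_zero, map_zero]
    obtain ⟨v, rfl⟩ := hA _ u hu0
    rw [cls_eq_zero]
    exact ⟨i.app _ v + y, by rw [map_add, ← i.d, hu]; abel⟩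
  · intro z
    obtain ⟨z, hz0, rfl⟩ := C.cls_surj z
    cases n with
    | zero =>
      obtain ⟨y, rfl⟩ := h.surj _ z
      exact ⟨B.cls y (B.dd_zero_apply y), rfl⟩
    | succ n =>
      obtain ⟨y, x, rfl, hx, hx0⟩ := h.lift_cycle z hz0
      obtain ⟨w, rfl⟩ := hA _ x hx0
      have hy : B.dd (n + 1) (y - i.app _ w) = 0 := by simp [← i.d, hx]
      refine ⟨B.cls _ hy, ?_⟩
      simp only [Hom.H_cls, map_sub, h.zero, sub_zero]

lemma acyc_of_bij (h : SES i p) (hi : ∀ n, Function.Bijective (i.H n)) (n : ℕ) : C.Acyc n := by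
  intro z hz
  cases n with
  | zero =>
    obtain ⟨y, rfl⟩ := h.surj _ z
    obtain ⟨x, hx⟩ := (hi 0).2 (B.cls y (B.dd_zero_apply y))
    obtain ⟨x, hx0, rfl⟩ := A.cls_surj x
    rw [Hom.H_cls, cls_eq] at hx
    obtain ⟨w, hw⟩ := hx
    exact ⟨p.app _ (-w), by rw [← p.d, map_neg, hw, neg_sub, map_sub, h.zero, sub_zero]⟩
  | succ n =>
    obtain ⟨y, x, rfl, hx, hx0⟩ := h.lift_cycle z hz
    have : A.cls x hx0 = 0 := by
      apply (hi n).1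
      rw [Hom.H_cls, map_zero, cls_eq_zero]
      exact ⟨y, hx.symm⟩
    obtain ⟨w, rfl⟩ := A.cls_eq_zero.1 this
    have hy : B.dd (n + 1) (y - i.app _ w) = 0 := by simp [← i.d, hx]
    obtain ⟨u, hu⟩ := (hi (n + 1)).2 (B.cls _ hy)
    obtain ⟨u, hu0, rfl⟩ := A.cls_surj u
    rw [Hom.H_cls, cls_eq] at hu
    obtain ⟨v, hv⟩ := hu
    refine ⟨p.app _ (-v), ?_⟩
    rw [← p.d, map_neg, hv]
    simp [h.zero]

end SES

end SMod
end CS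

open CategoryTheory
open scoped DirectSum

namespace CS

/-- Face inclusion, with natural number index. -/
def df {m : ℕ} (i : ℕ) : Fin (m + 1) →o Fin (m + 2) where
  toFun j := if (j : ℕ) < i then j.castSucc else j.succ
  monotone' a b h := by
    have : (a : ℕ) ≤ b := h
    simp only [Fin.le_def]
    split_ifs <;> simp <;> omega

/-- Degeneracy, with natural number index. -/
def sg {m : ℕ} (t : ℕ) : Fin (m + 2) →o Fin (m + 1) where
  toFun j := ⟨if (j : ℕ) ≤ t then min j m else j - 1, by split_ifs <;> omega⟩
  monotone' a b h := by
    have : (a : ℕ) ≤ b := h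
    simp only [Fin.le_def]
    split_ifs <;> omega

/-- Threshold map. -/
def ps {m : ℕ} (t : ℕ) : Fin (m + 1) →o Bool where
  toFun j := decide (t ≤ j)
  monotone' a b h := by
    have : (a : ℕ) ≤ b := h
    intro h'
    simp only [decide_eq_true_eq] at h' ⊢
    omega

lemma df_val {m : ℕ} (i : ℕ) (j : Fin (m + 1)) : (df i j : ℕ) = if (j : ℕ) < i then (j : ℕ) else j + 1 := by
  simp only [df]
  change ((if (j : ℕ) < i then j.castSucc else j.succ : Fin (m + 2)) : ℕ) = _
  split_ifs <;> simp

lemma sg_val {m : ℕ} (i : ℕ) (j : Fin (m + 2)) :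
    (sg i j : ℕ) = if (j : ℕ) ≤ i then min (j : ℕ) m else j - 1 := rfl

lemma ps_val {m : ℕ} (i : ℕ) (j : Fin (m + 1)) : ps i j = decide (i ≤ (j : ℕ)) := rfl

lemma δ_eq_df {m : ℕ} (i : Fin (m + 2)) : (δ i : Fin (m + 1) →o Fin (m + 2)) = df i := by
  ext j
  rw [df_val, δ_apply, Fin.succAbove]
  simp only [Fin.lt_def]
  split_ifs <;> simp_all

lemma SMod.d_apply' (A : SMod) (n : ℕ) (x : A.X (n + 1)) :
    A.d n x = ∑ i ∈ Finset.range (n + 2), ((-1 : ℚ) ^ i) • A.map (df i) x := by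
  rw [A.d_apply, ← Fin.sum_univ_eq_sum_range (fun i => ((-1 : ℚ) ^ i) • A.map (df i) x)]
  simp only [δ_eq_df]

/-- Combinatorial core of the prism identity. -/
lemma prism_sum {B : Type} [AddCommGroup B] [Module ℚ B] (F G : ℕ → ℕ → B) (E : ℕ → B) (n : ℕ)
    (h1 : ∀ i t, i ≤ t → t < n → F i (t + 1) = G i t)
    (h2 : ∀ i t, t < i → i ≤ n → F (i + 1) t = G i t)
    (h3 : ∀ t, t ≤ n → F t t = E t) (h4 : ∀ t, t ≤ n → F (t + 1) t = E (t + 1)) :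
    ∑ t ∈ Finset.range (n + 1), ∑ i ∈ Finset.range (n + 2), ((-1 : ℚ) ^ (i + t)) • F i t +
      ∑ t ∈ Finset.range n, ∑ i ∈ Finset.range (n + 1), ((-1 : ℚ) ^ (i + t)) • G i t
      = E 0 - E (n + 1) := by
  induction n with
  | zero =>
    simp [Finset.sum_range_succ, h3 0 le_rfl, h4 0 le_rfl]
    abel
  | succ n ih =>
    have ih := ih (fun i t h h' => h1 i t h (by omega)) (fun i t h h' => h2 i t h (by omega))
      (fun t h => h3 t (by omega)) (fun t h => h4 t (by omega))
    have e1 : ∑ t ∈ Finset.range (n + 1 + 1), ∑ i ∈ Finset.range (n + 1 + 2), ((-1 : ℚ) ^ (i + t)) • F i t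
        = ∑ t ∈ Finset.range (n + 1), ∑ i ∈ Finset.range (n + 2), ((-1 : ℚ) ^ (i + t)) • F i t
        + (∑ t ∈ Finset.range (n + 1), ((-1 : ℚ) ^ (n + 2 + t)) • G (n + 1) t)
        + (∑ i ∈ Finset.range (n + 1), ((-1 : ℚ) ^ (i + (n + 1))) • G i n)
        + (E (n + 1) - E (n + 2)) := by
      rw [Finset.sum_range_succ (n := n + 1)]
      have : ∀ t ∈ Finset.range (n + 1), ∑ i ∈ Finset.range (n + 1 + 2), ((-1 : ℚ) ^ (i + t)) • F i t
        = ∑ i ∈ Finset.range (n + 2), ((-1 : ℚ) ^ (i + t)) • F i t + ((-1 : ℚ) ^ (n + 2 + t)) • G (n + 1) t := by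
        intro t ht
        rw [Finset.sum_range_succ, h2 (n + 1) t (by simpa using ht) le_rfl]
      rw [Finset.sum_congr rfl this, Finset.sum_add_distrib]
      rw [Finset.sum_range_succ _ (n + 2), Finset.sum_range_succ _ (n + 1),
        h3 (n + 1) le_rfl, h4 (n + 1) le_rfl]
      have : ∀ i ∈ Finset.range (n + 1), ((-1 : ℚ) ^ (i + (n + 1))) • F i (n + 1)
          = ((-1 : ℚ) ^ (i + (n + 1))) • G i n := by
        intro i hi
        rw [h1 i n (by simp at hi; omega) (by omega)]
      rw [Finset.sum_congr rfl this]
      have a1 : (-1 : ℚ) ^ (n + 1 + (n + 1)) = 1 := Even.neg_one_pow ⟨n + 1, rfl⟩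
      have a2 : (-1 : ℚ) ^ (n + 2 + (n + 1)) = -1 := Odd.neg_one_pow ⟨n + 1, by ring⟩
      rw [a1, a2, one_smul, neg_one_smul]
      abel
    have e2 : ∑ t ∈ Finset.range (n + 1), ∑ i ∈ Finset.range (n + 1 + 1), ((-1 : ℚ) ^ (i + t)) • G i t
        = ∑ t ∈ Finset.range n, ∑ i ∈ Finset.range (n + 1), ((-1 : ℚ) ^ (i + t)) • G i t
        - (∑ t ∈ Finset.range (n + 1), ((-1 : ℚ) ^ (n + 2 + t)) • G (n + 1) t)
        - (∑ i ∈ Finset.range (n + 1), ((-1 : ℚ) ^ (i + (n + 1))) • G i n) := by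
      have : ∀ t, ∑ i ∈ Finset.range (n + 1 + 1), ((-1 : ℚ) ^ (i + t)) • G i t
        = ∑ i ∈ Finset.range (n + 1), ((-1 : ℚ) ^ (i + t)) • G i t - ((-1 : ℚ) ^ (n + 2 + t)) • G (n + 1) t := by
        intro t
        rw [Finset.sum_range_succ, sub_eq_add_neg, ← neg_smul]
        congr 3
        rw [pow_add, pow_add, pow_add, pow_succ]; ring
      simp only [this, Finset.sum_sub_distrib]
      rw [Finset.sum_range_succ (n := n)]
      have : ∀ i, ((-1 : ℚ) ^ (i + (n + 1))) • G i n = - (((-1 : ℚ) ^ (i + n)) • G i n) := by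
        intro i
        rw [← neg_smul]; congr 1; rw [← add_assoc, pow_succ]; ring
      simp only [this, Finset.sum_neg_distrib]
      abel
    rw [e1, e2]
    have : E 0 - E (n + 1 + 1) = (E 0 - E (n + 1)) + (E (n + 1) - E (n + 2)) := by abel
    rw [this, ← ih]
    abel

namespace SMod
variable {A B : SMod}

/-- A natural family of maps indexed by monotone maps to `{0,1}`. -/
structure Prism (A B : SMod) where
  K : ∀ m, (Fin (m + 1) →o Bool) → A.X m →ₗ[ℚ] B.X m
  nat : ∀ {m n : ℕ} (f : Fin (m + 1) →o Fin (n + 1)) (χ : Fin (n + 1) →o Bool) (x : A.X n),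
    B.map f (K n χ x) = K m (χ.comp f) (A.map f x)

namespace Prism
variable (P : Prism A B)

/-- Prism operator. -/
noncomputable def h (m : ℕ) : A.X m →ₗ[ℚ] B.X (m + 1) :=
  ∑ t ∈ Finset.range (m + 1), ((-1 : ℚ) ^ t) • (P.K (m + 1) (ps (t + 1))).comp (A.map (sg t))

lemma h_apply (m : ℕ) (x : A.X m) :
    P.h m x = ∑ t ∈ Finset.range (m + 1), ((-1 : ℚ) ^ t) • P.K (m + 1) (ps (t + 1)) (A.map (sg t) x) := by
  simp [h]

lemma K_congr {m : ℕ} {n : ℕ} {χ χ' : Fin (m + 1) →o Bool} {f f' : Fin (m + 1) →o Fin (n + 1)}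
    (h1 : ∀ j, χ j = χ' j) (h2 : ∀ j, (f j : ℕ) = f' j) (x : A.X n) :
    P.K m χ (A.map f x) = P.K m χ' (A.map f' x) := by
  have : χ = χ' := OrderHom.ext _ _ (funext h1)
  have : f = f' := OrderHom.ext _ _ (funext fun j => Fin.ext (h2 j))
  subst_vars
  rfl

lemma ident (m : ℕ) (x : A.X m) :
    B.d m (P.h m x) + (match m, x with
      | 0, _ => 0
      | m + 1, x => P.h m (A.d m x)) = P.K m (ps 0) x - P.K m (ps (m + 1)) x := by
  let F : ℕ → ℕ → B.X m := fun i t =>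
    P.K m ((ps (t + 1)).comp (df i)) (A.map ((sg t).comp (df i)) x)
  let E : ℕ → B.X m := fun t => P.K m (ps t) x
  have hF : B.d m (P.h m x) = ∑ t ∈ Finset.range (m + 1), ∑ i ∈ Finset.range (m + 2), ((-1 : ℚ) ^ (i + t)) • F i t := by
    rw [P.h_apply, map_sum]
    refine Finset.sum_congr rfl fun t _ => ?_
    rw [map_smul, B.d_apply', Finset.smul_sum]
    refine Finset.sum_congr rfl fun i _ => ?_
    rw [P.nat, smul_smul, ← A.map_comp, pow_add, mul_comm]
  have h3 : ∀ t, t ≤ m → F t t = E t := by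
    intro t ht
    change _ = P.K m (ps t) x
    rw [← A.map_id _ x]
    apply P.K_congr
    · intro j
      simp only [OrderHom.comp_coe, Function.comp_apply, ps_val, df_val, decide_eq_decide]
      split_ifs <;> omega
    · intro j
      simp only [OrderHom.comp_coe, Function.comp_apply, sg_val, df_val, OrderHom.id_coe, id]
      split_ifs <;> omega
  have h4 : ∀ t, t ≤ m → F (t + 1) t = E (t + 1) := by
    intro t ht
    change _ = P.K m (ps (t + 1)) x
    rw [← A.map_id _ x]
    apply P.K_congr
    · intro j
      simp only [OrderHom.comp_coe, Function.comp_apply, ps_val, df_val, decide_eq_decide]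
      split_ifs <;> omega
    · intro j
      simp only [OrderHom.comp_coe, Function.comp_apply, sg_val, df_val, OrderHom.id_coe, id]
      split_ifs <;> omega
  cases m with
  | zero =>
    have := prism_sum F (fun _ _ => 0) E 0 (by intros; omega) (by intros; omega) h3 h4
    rw [hF]
    simpa using this
  | succ m =>
    let G : ℕ → ℕ → B.X (m + 1) := fun i t =>
      P.K (m + 1) (ps (t + 1)) (A.map ((df i).comp (sg t)) x)
    have hG : P.h m (A.d m x) = ∑ t ∈ Finset.range (m + 1), ∑ i ∈ Finset.range (m + 2), ((-1 : ℚ) ^ (i + t)) • G i t := by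
      rw [P.h_apply]
      refine Finset.sum_congr rfl fun t _ => ?_
      rw [A.d_apply', map_sum, map_sum, Finset.smul_sum]
      refine Finset.sum_congr rfl fun i _ => ?_
      rw [map_smul, map_smul, smul_smul, ← A.map_comp, pow_add, mul_comm]
    change _ + P.h m (A.d m x) = _
    rw [hF, hG]
    refine prism_sum F G E (m + 1) ?_ ?_ h3 h4
    · intro i t hi ht
      apply P.K_congr
      · intro j
        simp only [OrderHom.comp_coe, Function.comp_apply, ps_val, df_val, decide_eq_decide]
        split_ifs <;> omega
      · intro j
        have := j.2
        simp only [OrderHom.comp_coe, Function.comp_apply, sg_val, df_val]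
        split_ifs <;> omega
    · intro i t hi ht
      apply P.K_congr
      · intro j
        simp only [OrderHom.comp_coe, Function.comp_apply, ps_val, df_val, decide_eq_decide]
        split_ifs <;> omega
      · intro j
        have := j.2
        simp only [OrderHom.comp_coe, Function.comp_apply, sg_val, df_val]
        split_ifs <;> omega

lemma ident_succ (m : ℕ) (x : A.X (m + 1)) :
    B.d (m + 1) (P.h (m + 1) x) + P.h m (A.d m x) = P.K _ (ps 0) x - P.K _ (ps (m + 2)) x :=
  P.ident (m + 1) x

lemma ident_cycle {m : ℕ} {x : A.X m} (hx : A.dd m x = 0) :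
    B.d m (P.h m x) = P.K _ (ps 0) x - P.K _ (ps (m + 1)) x := by
  cases m with
  | zero => simpa using P.ident 0 x
  | succ m =>
    have := P.ident_succ m x
    rw [show A.d m x = 0 from hx, map_zero, add_zero] at this
    exact this

end Prism
end SMod
end CS

open CategoryTheory
open scoped DirectSum

namespace CS

/-- Topological simplex. -/
abbrev Δ (n : ℕ) : Type := stdSimplex ℝ (Fin (n + 1))

/-- Induced map of topological simplices. -/
noncomputable def smap {m n : ℕ} (f : Fin (m + 1) →o Fin (n + 1)) : C(Δ m, Δ n) :=
  ⟨stdSimplex.map f, stdSimplex.continuous_map f⟩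

lemma smap_id (n : ℕ) : smap (OrderHom.id : Fin (n + 1) →o Fin (n + 1)) = ContinuousMap.id _ := by
  ext1 x
  exact stdSimplex.map_id_apply x

lemma smap_comp {l m n : ℕ} (f : Fin (l + 1) →o Fin (m + 1)) (g : Fin (m + 1) →o Fin (n + 1)) :
    smap (g.comp f) = (smap g).comp (smap f) := by
  ext1 x
  exact (stdSimplex.map_comp_apply f g x).symm

/-- Singular chains. -/
noncomputable def Sing (X : Type) [TopologicalSpace X] : SMod where
  X n := C(Δ n, X) →₀ ℚ
  map f := Finsupp.lmapDomain ℚ ℚ (fun s => s.comp (smap f))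
  map_id n x := by
    simp only [smap_id, ContinuousMap.comp_id]
    exact Finsupp.mapDomain_id
  map_comp f g x := by
    simp only [smap_comp, Finsupp.lmapDomain_apply]
    rw [← Finsupp.mapDomain_comp]
    rfl

variable {X Y : Type} [TopologicalSpace X] [TopologicalSpace Y]

/-- Basis simplices. -/
noncomputable def sim {n : ℕ} (s : C(Δ n, X)) : (Sing X).X n := Finsupp.single s 1

lemma Sing_map_sim {m n : ℕ} (f : Fin (m + 1) →o Fin (n + 1)) (s : C(Δ n, X)) :
    (Sing X).map f (sim s) = sim (s.comp (smap f)) := by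
  exact Finsupp.mapDomain_single

lemma Sing_hom_ext {n : ℕ} {V : Type} [AddCommGroup V] [Module ℚ V] {f g : (Sing X).X n →ₗ[ℚ] V}
    (h : ∀ s, f (sim s) = g (sim s)) : f = g := by
  refine Finsupp.lhom_ext' fun s => LinearMap.ext_ring ?_
  exact h s

/-- Linear extension. -/
noncomputable def lin {n : ℕ} {V : Type} [AddCommGroup V] [Module ℚ V] (f : C(Δ n, X) → V) :
    (Sing X).X n →ₗ[ℚ] V := Finsupp.linearCombination ℚ f

@[simp] lemma lin_sim {n : ℕ} {V : Type} [AddCommGroup V] [Module ℚ V] (f : C(Δ n, X) → V) (s : C(Δ n, X)) :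
    lin f (sim s) = f s := by
  exact (Finsupp.linearCombination_single ℚ 1 s).trans (one_smul _ _)

lemma Sing_induction {n : ℕ} {P : (Sing X).X n → Prop} (x : (Sing X).X n) (h0 : P 0)
    (ha : ∀ x y, P x → P y → P (x + y)) (hs : ∀ (c : ℚ) s, P (c • sim s)) : P x := by
  refine Finsupp.induction_linear x h0 ha fun s c => ?_
  have : (Finsupp.single s c : C(Δ n, X) →₀ ℚ) = c • sim s := by
    exact ((Finsupp.smul_single c s (1 : ℚ)).trans (by rw [smul_eq_mul, mul_one])).symm
  rw [this]
  exact hs c s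

/-- Induced map on singular chains. -/
noncomputable def push (f : C(X, Y)) : SMod.Hom (Sing X) (Sing Y) where
  app n := lin fun s => sim (f.comp s)
  comm g x := by
    refine LinearMap.congr_fun (f := (lin fun s => sim (f.comp s)) ∘ₗ (Sing X).map g)
      (g := (Sing Y).map g ∘ₗ (lin fun s => sim (f.comp s))) (Sing_hom_ext fun s => ?_) x
    simp [Sing_map_sim, ContinuousMap.comp_assoc]

@[simp] lemma push_sim (f : C(X, Y)) {n : ℕ} (s : C(Δ n, X)) : (push f).app n (sim s) = sim (f.comp s) := by
  simp [push]

lemma push_id {n : ℕ} (x : (Sing X).X n) : (push (ContinuousMap.id X)).app n x = x := by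
  refine LinearMap.congr_fun (g := LinearMap.id) (Sing_hom_ext fun s => ?_) x
  simp

lemma push_comp {Z : Type} [TopologicalSpace Z] (g : C(Y, Z)) (f : C(X, Y)) {n : ℕ} (x : (Sing X).X n) :
    (push (g.comp f)).app n x = (push g).app n ((push f).app n x) := by
  refine LinearMap.congr_fun (g := (push g).app n ∘ₗ (push f).app n) (Sing_hom_ext fun s => ?_) x
  simp [ContinuousMap.comp_assoc]

/-- Coordinate function on a simplex attached to a two-colouring of the vertices. -/
noncomputable def uc {m : ℕ} (χ : Fin (m + 1) →o Bool) : C(Δ m, unitInterval) where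
  toFun p := ⟨∑ i, if χ i then p i else 0, by
    constructor
    · refine Finset.sum_nonneg fun i _ => ?_
      split_ifs
      · exact stdSimplex.zero_le p i
      · exact le_rfl
    · rw [← stdSimplex.sum_eq_one p]
      refine Finset.sum_le_sum fun i _ => ?_
      split_ifs
      · exact le_rfl
      · exact stdSimplex.zero_le p i⟩
  continuous_toFun := by
    refine Continuous.subtype_mk (continuous_finsetSum _ fun i _ => ?_) _
    split_ifs
    · exact (continuous_apply i).comp continuous_subtype_val
    · exact continuous_const

lemma uc_smap {m n : ℕ} (f : Fin (m + 1) →o Fin (n + 1)) (χ : Fin (n + 1) →o Bool) (p : Δ m) :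
    uc χ (smap f p) = uc (χ.comp f) p := by
  apply Subtype.ext
  change (∑ i, if χ i then (stdSimplex.map f p) i else 0) = ∑ i, if χ (f i) then p i else 0
  classical
  rw [← Finset.sum_fiberwise Finset.univ f]
  refine Finset.sum_congr rfl fun i _ => ?_
  rw [stdSimplex.map_coe, FunOnFinite.linearMap_apply_apply]
  split_ifs with h
  · refine Finset.sum_congr rfl fun j hj => ?_
    simp only [Finset.mem_filter] at hj
    rw [hj.2, if_pos h]
  · symm
    refine Finset.sum_eq_zero fun j hj => ?_
    simp only [Finset.mem_filter] at hj
    rw [hj.2, if_neg h]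

lemma uc_zero {m : ℕ} (p : Δ m) : uc (ps (m + 1)) p = 0 := by
  apply Subtype.ext
  change (∑ i, if ps (m + 1) i then p i else 0) = 0
  refine Finset.sum_eq_zero fun i _ => ?_
  rw [if_neg]
  have := i.2
  simp only [ps_val, decide_eq_true_eq]
  omega

lemma uc_one {m : ℕ} (p : Δ m) : uc (ps 0) p = 1 := by
  apply Subtype.ext
  change (∑ i, if ps 0 i then p i else 0) = 1
  rw [← stdSimplex.sum_eq_one p]
  refine Finset.sum_congr rfl fun i _ => ?_
  rw [if_pos]
  simp [ps_val]

/-- One simplex of the prism. -/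
noncomputable def hsim (F : C(X × unitInterval, Y)) {m : ℕ} (χ : Fin (m + 1) →o Bool) (s : C(Δ m, X)) : C(Δ m, Y) :=
  F.comp (s.prodMk (uc χ))

/-- Prism of a homotopy. -/
noncomputable def hprism (F : C(X × unitInterval, Y)) : SMod.Prism (Sing X) (Sing Y) where
  K m χ := lin fun s => sim (hsim F χ s)
  nat f χ x := by
    refine LinearMap.congr_fun (f := (Sing Y).map f ∘ₗ (lin fun s => sim (hsim F χ s)))
      (g := (lin fun s => sim (hsim F (χ.comp f) s)) ∘ₗ (Sing X).map f) (Sing_hom_ext fun s => ?_) x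
    simp only [LinearMap.comp_apply, lin_sim, Sing_map_sim]
    congr 1
    ext1 p
    change F (s (smap f p), uc χ (smap f p)) = F (s (smap f p), uc (χ.comp f) p)
    rw [uc_smap]

lemma hprism_K (F : C(X × unitInterval, Y)) {m : ℕ} (χ : Fin (m + 1) →o Bool) (s : C(Δ m, X)) :
    (hprism F).K m χ (sim s) = sim (hsim F χ s) := lin_sim _ _

lemma hprism_zero (F : C(X × unitInterval, Y)) (f : C(X, Y)) (hf : ∀ x, F (x, 0) = f x) {m : ℕ} (x : (Sing X).X m) :
    (hprism F).K m (ps (m + 1)) x = (push f).app m x := by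
  refine LinearMap.congr_fun (Sing_hom_ext fun s => ?_) x
  rw [hprism_K, push_sim]
  congr 1
  ext1 p
  change F (s p, uc _ p) = f (s p)
  rw [uc_zero, hf]

lemma hprism_one (F : C(X × unitInterval, Y)) (f : C(X, Y)) (hf : ∀ x, F (x, 1) = f x) {m : ℕ} (x : (Sing X).X m) :
    (hprism F).K m (ps 0) x = (push f).app m x := by
  refine LinearMap.congr_fun (Sing_hom_ext fun s => ?_) x
  rw [hprism_K, push_sim]
  congr 1
  ext1 p
  change F (s p, uc _ p) = f (s p)
  rw [uc_one, hf]

/-! ### Comparison with Mathlib's homology -/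

lemma homology_equiv_aux {A : SMod} (n : ℕ) (S : ShortComplex (ModuleCat.{0} ℚ)) (e : S.X₂ ≃ₗ[ℚ] A.X n)
    (hg : ∀ x, S.g x = 0 ↔ A.dd n (e x) = 0)
    (hf : ∀ x, (∃ y, S.f y = x) ↔ ∃ y, A.d n y = e x) : Nonempty (S.homology ≃ₗ[ℚ] A.H n) := by
  have e0 := S.moduleCatHomologyIso.toLinearEquiv
  let ez : LinearMap.ker S.g.hom ≃ₗ[ℚ] A.Z n := e.submoduleMap (LinearMap.ker S.g.hom) ≪≫ₗ LinearEquiv.ofEq _ _ (by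
    ext z
    constructor
    · rintro ⟨x, hx, rfl⟩
      exact (hg x).1 hx
    · intro hz
      refine ⟨e.symm z, (hg _).2 ?_, by simp⟩
      rw [e.apply_symm_apply]
      exact hz)
  have hez : ∀ x, (ez x : A.X n) = e x := fun x => rfl
  refine ⟨e0 ≪≫ₗ Submodule.Quotient.equiv _ _ ez ?_⟩
  ext z
  constructor
  · rintro ⟨_, ⟨y, rfl⟩, rfl⟩
    obtain ⟨w, hw⟩ := (hf (S.f y)).1 ⟨y, rfl⟩
    exact ⟨w, hw⟩
  · rintro ⟨w, hw⟩
    obtain ⟨y, hy⟩ := (hf (e.symm z)).2 ⟨w, by rw [e.apply_symm_apply]; exact hw⟩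
    refine ⟨ez.symm z, ⟨y, ?_⟩, by simp⟩
    apply ez.injective
    apply Subtype.ext
    rw [hez, ez.apply_symm_apply]
    rw [LinearEquiv.eq_symm_apply] at hy
    exact hy

lemma homology_equiv (A : SMod) (n : ℕ) :
    Nonempty (((AlgebraicTopology.alternatingFaceMapComplex (ModuleCat.{0} ℚ)).obj A.toSimp).homology n ≃ₗ[ℚ] A.H n) := by
  set K := (AlgebraicTopology.alternatingFaceMapComplex (ModuleCat.{0} ℚ)).obj A.toSimp with hK
  have hd : ∀ n, K.d (n + 1) n = ModuleCat.ofHom (A.d n) := by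
    intro n
    rw [← A.toSimp_objD]
    exact AlgebraicTopology.alternatingFaceMapComplex_obj_d _ _
  cases n with
  | zero =>
    obtain ⟨e⟩ := homology_equiv_aux (A := A) 0 (K.sc' 1 0 0) (LinearEquiv.refl ℚ (A.X 0)) (by
      intro x
      have : K.d 0 0 = 0 := K.shape _ _ (by simp)
      change (K.d 0 0) x = 0 ↔ _
      rw [this]
      exact iff_of_true rfl rfl) (by
      intro x
      have := hd 0
      change (∃ y, (K.d 1 0) y = x) ↔ _
      change K.d 1 0 = _ at this
      rw [this]
      rfl)
    exact ⟨((ShortComplex.homologyMapIso (K.isoSc' 1 0 0 (by simp) (by simp))).toLinearEquiv) ≪≫ₗ e⟩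
  | succ n =>
    obtain ⟨e⟩ := homology_equiv_aux (A := A) (n + 1) (K.sc' (n + 2) (n + 1) n) (LinearEquiv.refl ℚ (A.X (n + 1))) (by
      intro x
      change (K.d (n + 1) n) x = 0 ↔ _
      rw [hd]
      rfl) (by
      intro x
      change (∃ y, (K.d (n + 2) (n + 1)) y = x) ↔ _
      rw [hd]
      rfl)
    exact ⟨((ShortComplex.homologyMapIso (K.isoSc' (n + 2) (n + 1) n (by simp) (by simp))).toLinearEquiv) ≪≫ₗ e⟩

lemma bridge_iso (X : Type) [TopologicalSpace X] : Nonempty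
    (((SimplicialObject.whiskering _ _).obj (ModuleCat.free ℚ)).obj (TopCat.toSSet.obj (TopCat.of X)) ≅ (Sing X).toSimp) := by
  refine ⟨NatIso.ofComponents (fun n => (Finsupp.domLCongr (R := ℚ) (M := ℚ)
    (TopCat.toSSetObjEquiv (TopCat.of X) n)).toModuleIso) ?_⟩
  intro m n f
  apply ModuleCat.free_hom_ext
  intro s
  have h1 : (TopCat.toSSetObjEquiv (TopCat.of X) n) ((TopCat.toSSet.obj (TopCat.of X)).map f s) =
      ((TopCat.toSSetObjEquiv (TopCat.of X) m) s).comp (smap f.unop.toOrderHom) := rfl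
  change (Finsupp.domLCongr (R := ℚ) (M := ℚ) (TopCat.toSSetObjEquiv (TopCat.of X) n))
      ((ModuleCat.free ℚ).map ((TopCat.toSSet.obj (TopCat.of X)).map f) (ModuleCat.freeMk s)) =
    (Sing X).map f.unop.toOrderHom ((Finsupp.domLCongr (R := ℚ) (M := ℚ) (TopCat.toSSetObjEquiv (TopCat.of X) m))
      (Finsupp.single s 1))
  rw [ModuleCat.free_map_apply]
  refine (Finsupp.domLCongr_single _ _ _).trans ?_
  refine Eq.trans ?_ (congrArg ((Sing X).map f.unop.toOrderHom) (Finsupp.domLCongr_single _ _ _).symm)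
  erw [h1]
  exact (Sing_map_sim _ _).symm

/-- The bridge. -/
lemma bridge (X : Type) [TopologicalSpace X] (n : ℕ) :
    Nonempty (SingularHomology ℚ n X ≃ₗ[ℚ] (Sing X).H n) := by
  obtain ⟨e⟩ := bridge_iso X
  obtain ⟨e'⟩ := homology_equiv (Sing X) n
  exact ⟨(((AlgebraicTopology.alternatingFaceMapComplex (ModuleCat.{0} ℚ)) ⋙
    HomologicalComplex.homologyFunctor _ _ n).mapIso e).toLinearEquiv ≪≫ₗ e'⟩

end CS

open CategoryTheory
open scoped DirectSum TensorProduct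

namespace CS
namespace SMod

/-- Loop sequences. -/
structure LS (W P A V : SMod) where
  i : Hom W P
  p : Hom P A
  q : Hom A V
  s : Hom V A
  K : Prism P P
  i_inj : ∀ m, Function.Injective (i.app m)
  ip : ∀ m, Function.Exact (i.app m) (p.app m)
  pq : ∀ m, Function.Exact (p.app m) (q.app m)
  qs : ∀ m x, q.app m (s.app m x) = x
  K1 : ∀ m x, K.K m (ps 0) x = x
  K0 : ∀ m x, K.K m (ps (m + 1)) x = 0

namespace LS
variable {W P A V : SMod} (S : LS W P A V)

lemma pi {m : ℕ} (x : W.X m) : S.p.app m (S.i.app m x) = 0 := (S.ip m _).2 ⟨x, rfl⟩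
lemma qp {m : ℕ} (x : P.X m) : S.q.app m (S.p.app m x) = 0 := (S.pq m _).2 ⟨x, rfl⟩

lemma acyc {m : ℕ} {x : P.X m} (hx : P.dd m x = 0) : P.d m (S.K.h m x) = x := by
  rw [S.K.ident_cycle hx, S.K1, S.K0, sub_zero]

/-- The suspension operator. -/
noncomputable def e (m : ℕ) : W.X m →ₗ[ℚ] A.X (m + 1) := S.p.app (m + 1) ∘ₗ S.K.h m ∘ₗ S.i.app m

lemma e_apply {m : ℕ} (x : W.X m) : S.e m x = S.p.app (m + 1) (S.K.h m (S.i.app m x)) := rfl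

lemma d_e {m : ℕ} (x : W.X (m + 1)) : A.d (m + 1) (S.e (m + 1) x) = - S.e m (W.d m x) := by
  have h := S.K.ident_succ m (S.i.app (m + 1) x)
  rw [S.K1, S.K0, sub_zero] at h
  rw [e_apply, ← S.p.d, eq_sub_of_add_eq h, map_sub, S.pi, zero_sub, e_apply, S.i.d]

lemma d_e_cycle {m : ℕ} {x : W.X m} (hx : W.dd m x = 0) : A.d m (S.e m x) = 0 := by
  cases m with
  | zero =>
    rw [e_apply, ← S.p.d, S.acyc (P.dd_zero_apply _), S.pi]
  | succ m =>
    rw [d_e, show W.d m x = 0 from hx, map_zero, neg_zero]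

lemma q_e {m : ℕ} (x : W.X m) : S.q.app (m + 1) (S.e m x) = 0 := S.qp _

lemma surj0 {x : A.X 0} (hq : S.q.app 0 x = 0) : ∃ y, A.d 0 y = x := by
  obtain ⟨w, rfl⟩ := (S.pq 0 _).1 hq
  exact ⟨S.p.app 1 (S.K.h 0 w), by rw [← S.p.d, S.acyc (P.dd_zero_apply _)]⟩

lemma surj {m : ℕ} {x : A.X (m + 1)} (hx : A.d m x = 0) (hq : S.q.app (m + 1) x = 0) :
    ∃ u, W.dd m u = 0 ∧ ∃ y, A.d (m + 1) y = x - S.e m u := by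
  obtain ⟨w, rfl⟩ := (S.pq (m + 1) _).1 hq
  rw [← S.p.d] at hx
  obtain ⟨u, hu⟩ := (S.ip m _).1 hx
  have hu0 : W.dd m u = 0 := by
    apply S.i_inj
    rw [S.i.dd, hu, P.dd_d, map_zero]
  refine ⟨u, hu0, ?_⟩
  have h1 : P.dd (m + 1) (w - S.K.h m (S.i.app m u)) = 0 := by
    rw [dd_succ, map_sub, S.acyc (S.i.dd_app hu0), hu, sub_self]
  refine ⟨S.p.app _ (S.K.h _ (w - S.K.h m (S.i.app m u))), ?_⟩
  rw [← S.p.d, S.acyc h1, map_sub, e_apply]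

lemma inj {m : ℕ} {u : W.X m} (hu : W.dd m u = 0) {v : A.X (m + 2)} (hv : A.d (m + 1) v = S.e m u) :
    ∃ r, W.d m r = u := by
  have hv' : A.d (m + 1) (v - S.s.app _ (S.q.app _ v)) = S.e m u := by
    rw [map_sub, ← S.s.d, ← S.q.d, hv, S.q_e, map_zero, sub_zero]
  obtain ⟨w, hw⟩ := (S.pq (m + 2) (v - S.s.app _ (S.q.app _ v))).1 (by rw [map_sub, S.qs, sub_self])
  obtain ⟨r, hr⟩ := (S.ip (m + 1) (S.K.h m (S.i.app m u) - P.d (m + 1) w)).1 (by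
    rw [map_sub, S.p.d, hw, hv', e_apply, sub_self])
  refine ⟨r, S.i_inj _ ?_⟩
  rw [S.i.d, hr, map_sub, P.d_d, S.acyc (S.i.dd_app hu), sub_zero]

end LS

/-- Tensor product. -/
noncomputable def tens (A B : SMod) : SMod where
  X n := A.X n ⊗[ℚ] B.X n
  map f := TensorProduct.map (A.map f) (B.map f)
  map_id n x := by
    have h1 : A.map (OrderHom.id : Fin (n + 1) →o Fin (n + 1)) = LinearMap.id := LinearMap.ext (A.map_id n)
    have h2 : B.map (OrderHom.id : Fin (n + 1) →o Fin (n + 1)) = LinearMap.id := LinearMap.ext (B.map_id n)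
    rw [h1, h2, TensorProduct.map_id]; rfl
  map_comp f g x := by
    have h1 : A.map (g.comp f) = A.map f ∘ₗ A.map g := LinearMap.ext (A.map_comp f g)
    have h2 : B.map (g.comp f) = B.map f ∘ₗ B.map g := LinearMap.ext (B.map_comp f g)
    rw [h1, h2, TensorProduct.map_comp]; rfl

/-- Pure tensors. -/
noncomputable def tm {A B : SMod} {n : ℕ} (a : A.X n) (b : B.X n) : (A.tens B).X n := a ⊗ₜ[ℚ] b

/-- Bilinear form of `tm`. -/
noncomputable def tmL (A B : SMod) (n : ℕ) : A.X n →ₗ[ℚ] B.X n →ₗ[ℚ] (A.tens B).X n := TensorProduct.mk ℚ _ _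

lemma tmL_apply {A B : SMod} {n : ℕ} (a : A.X n) (b : B.X n) : tmL A B n a b = tm a b := rfl

lemma tens_map {A B : SMod} {m n : ℕ} (f : Fin (m + 1) →o Fin (n + 1)) (a : A.X n) (b : B.X n) :
    (A.tens B).map f (tm a b) = tm (A.map f a) (B.map f b) := rfl

lemma tens_ext {A B : SMod} {n : ℕ} {V : Type} [AddCommGroup V] [Module ℚ V] {f g : (A.tens B).X n →ₗ[ℚ] V}
    (h : ∀ a b, f (tm a b) = g (tm a b)) : f = g := TensorProduct.ext' h

/-- Tensor product of morphisms. -/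
noncomputable def tmap {A A' B B' : SMod} (f : Hom A A') (g : Hom B B') : Hom (A.tens B) (A'.tens B') where
  app n := TensorProduct.map (f.app n) (g.app n)
  comm {m n} φ x := by
    refine LinearMap.congr_fun (f := (TensorProduct.map (f.app m) (g.app m) : (A.tens B).X m →ₗ[ℚ] (A'.tens B').X m)
      ∘ₗ (A.tens B).map φ) (g := (A'.tens B').map φ ∘ₗ
      (TensorProduct.map (f.app n) (g.app n) : (A.tens B).X n →ₗ[ℚ] (A'.tens B').X n)) (tens_ext fun a b => ?_) x
    change tm (f.app m (A.map φ a)) (g.app m (B.map φ b)) = tm (A'.map φ (f.app n a)) (B'.map φ (g.app n b))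
    rw [f.comm, g.comm]

lemma tmap_tm {A A' B B' : SMod} (f : Hom A A') (g : Hom B B') {n : ℕ} (a : A.X n) (b : B.X n) :
    (tmap f g).app n (tm a b) = tm (f.app n a) (g.app n b) := rfl

/-- Tensoring a prism. -/
noncomputable def Prism.tens {A A' : SMod} (P : Prism A A') (B : SMod) : Prism (A.tens B) (A'.tens B) where
  K m χ := TensorProduct.map (P.K m χ) LinearMap.id
  nat {m n} f χ x := by
    refine LinearMap.congr_fun (f := (A'.tens B).map f ∘ₗ
        (TensorProduct.map (P.K n χ) LinearMap.id : (A.tens B).X n →ₗ[ℚ] (A'.tens B).X n))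
      (g := (TensorProduct.map (P.K m (χ.comp f)) LinearMap.id : (A.tens B).X m →ₗ[ℚ] (A'.tens B).X m) ∘ₗ
        (A.tens B).map f) (tens_ext fun a b => ?_) x
    change tm (A'.map f (P.K n χ a)) (B.map f b) = tm (P.K m (χ.comp f) (A.map f a)) (B.map f b)
    rw [P.nat]

lemma Prism.tens_K {A A' : SMod} (P : Prism A A') (B : SMod) {m : ℕ} (χ : Fin (m + 1) →o Bool) (a : A.X m) (b : B.X m) :
    (P.tens B).K m χ (tm a b) = tm (P.K m χ a) b := rfl

/-- Tensoring a loop sequence. -/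
noncomputable def LS.tens {W P A V : SMod} (S : LS W P A V) (B : SMod) :
    LS (W.tens B) (P.tens B) (A.tens B) (V.tens B) where
  i := tmap S.i (Hom.id B)
  p := tmap S.p (Hom.id B)
  q := tmap S.q (Hom.id B)
  s := tmap S.s (Hom.id B)
  K := S.K.tens B
  i_inj m := Module.Flat.rTensor_preserves_injective_linearMap (M := B.X m) (S.i.app m) (S.i_inj m)
  ip m := Module.Flat.rTensor_exact (B.X m) (S.ip m)
  pq m := Module.Flat.rTensor_exact (B.X m) (S.pq m)
  qs m x := by
    refine LinearMap.congr_fun (f := (tmap S.q (Hom.id B)).app m ∘ₗ (tmap S.s (Hom.id B)).app m)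
      (g := LinearMap.id) (tens_ext fun a b => ?_) x
    change tm (S.q.app m (S.s.app m a)) b = tm a b
    rw [S.qs]
  K1 m x := by
    refine LinearMap.congr_fun (f := (S.K.tens B).K m (ps 0))
      (g := LinearMap.id) (tens_ext fun a b => ?_) x
    change tm (S.K.K m _ a) b = tm a b
    rw [S.K1]
  K0 m x := by
    refine LinearMap.congr_fun (f := (S.K.tens B).K m (ps (m + 1)))
      (g := 0) (tens_ext fun a b => ?_) x
    rw [Prism.tens_K, S.K0]
    exact TensorProduct.zero_tmul _ _

/-- Constant map. -/
def cst {m n : ℕ} (i : Fin (n + 1)) : Fin (m + 1) →o Fin (n + 1) := ⟨fun _ => i, fun _ _ _ => le_rfl⟩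

/-- Shifted map fixing the new initial vertex. -/
def up {m n : ℕ} (f : Fin (m + 1) →o Fin (n + 1)) : Fin (m + 2) →o Fin (n + 2) where
  toFun := Fin.cases 0 (fun i => (f i).succ)
  monotone' := by
    intro a b
    refine Fin.cases ?_ (fun a => ?_) a <;> refine Fin.cases ?_ (fun b => ?_) b <;> simp
    exact fun h => f.monotone h

/-- Contraction towards the initial vertex. -/
def ctr {m : ℕ} (χ : Fin (m + 1) →o Bool) : Fin (m + 2) →o Fin (m + 2) where
  toFun := Fin.cases 0 (fun i => if χ i then i.succ else 0)
  monotone' := by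
    intro a b
    refine Fin.cases ?_ (fun a => ?_) a <;> refine Fin.cases ?_ (fun b => ?_) b <;> simp
    intro h
    have := χ.monotone h
    split_ifs with h1 h2
    · simpa using h
    · rw [h1, Bool.eq_false_iff.2 h2] at this
      exact absurd this (by decide)
    · simp
    · simp

@[simp] lemma up_zero {m n : ℕ} (f : Fin (m + 1) →o Fin (n + 1)) : up f 0 = 0 := rfl
@[simp] lemma up_succ {m n : ℕ} (f : Fin (m + 1) →o Fin (n + 1)) (i : Fin (m + 1)) : up f i.succ = (f i).succ := rfl
@[simp] lemma ctr_zero {m : ℕ} (χ : Fin (m + 1) →o Bool) : ctr χ 0 = 0 := rfl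
@[simp] lemma ctr_succ {m : ℕ} (χ : Fin (m + 1) →o Bool) (i : Fin (m + 1)) : ctr χ i.succ = if χ i then i.succ else 0 := rfl
@[simp] lemma cst_apply {m n : ℕ} (i : Fin (n + 1)) (j : Fin (m + 1)) : (cst i : Fin (m + 1) →o Fin (n + 1)) j = i := rfl
@[simp] lemma df_zero_apply {m : ℕ} (j : Fin (m + 1)) : df 0 j = j.succ := by
  ext; rw [df_val]; simp

lemma up_id (m : ℕ) : up (OrderHom.id : Fin (m + 1) →o Fin (m + 1)) = OrderHom.id := by
  refine OrderHom.ext _ _ (funext fun i => ?_)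
  refine Fin.cases ?_ (fun i => ?_) i <;> rfl

lemma up_comp {l m n : ℕ} (f : Fin (l + 1) →o Fin (m + 1)) (g : Fin (m + 1) →o Fin (n + 1)) :
    up (g.comp f) = (up g).comp (up f) := by
  refine OrderHom.ext _ _ (funext fun i => ?_)
  refine Fin.cases ?_ (fun i => ?_) i <;> rfl

/-- Two maps with equal values induce the same map. -/
lemma map_congr (A : SMod) {m n : ℕ} {f g : Fin (m + 1) →o Fin (n + 1)} (h : ∀ i, f i = g i) (x : A.X n) :
    A.map f x = A.map g x := by
  have : f = g := OrderHom.ext _ _ (funext h)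
  rw [this]

lemma map_map (A : SMod) {l m n : ℕ} (f : Fin (l + 1) →o Fin (m + 1)) (g : Fin (m + 1) →o Fin (n + 1))
    (x : A.X n) : A.map f (A.map g x) = A.map (g.comp f) x := (A.map_comp f g x).symm

variable (A : SMod)

/-- Paths. -/
def PM (m : ℕ) : Submodule ℚ (A.X (m + 1)) := LinearMap.ker (A.map (cst 0 : Fin (0 + 1) →o Fin (m + 1 + 1)))

/-- Loops. -/
def WM (m : ℕ) : Submodule ℚ (A.X (m + 1)) := A.PM m ⊓ LinearMap.ker (A.map (df 0))

lemma mem_PM {m : ℕ} {x : A.X (m + 1)} : x ∈ A.PM m ↔ A.map (cst 0 : Fin (0 + 1) →o Fin (m + 1 + 1)) x = 0 := Iff.rfl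

lemma up_mem_PM {m n : ℕ} (f : Fin (m + 1) →o Fin (n + 1)) {x : A.X (n + 1)} (hx : x ∈ A.PM n) :
    A.map (up f) x ∈ A.PM m := by
  rw [mem_PM] at hx ⊢
  rw [map_map, ← hx]
  exact A.map_congr (fun i => rfl) x

lemma up_mem_WM {m n : ℕ} (f : Fin (m + 1) →o Fin (n + 1)) {x : A.X (n + 1)} (hx : x ∈ A.WM n) :
    A.map (up f) x ∈ A.WM m := by
  refine ⟨A.up_mem_PM f hx.1, ?_⟩
  have h2 : A.map (df 0) x = 0 := hx.2
  change A.map (df 0) (A.map (up f) x) = 0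
  rw [map_map, A.map_congr (g := (df 0).comp f) (fun i => by simp), ← map_map, h2, map_zero]

/-- Path object. -/
def PS : SMod where
  X m := A.PM m
  map {m n} f := (A.map (up f)).restrict (fun _ hx => A.up_mem_PM f hx)
  map_id n x := Subtype.ext (by
    change A.map _ x.1 = x.1
    rw [up_id, A.map_id])
  map_comp f g x := Subtype.ext (by
    change A.map _ x.1 = A.map _ (A.map _ x.1)
    rw [up_comp, A.map_comp])

/-- Loop object. -/
def WS : SMod where
  X m := A.WM m
  map {m n} f := (A.map (up f)).restrict (fun _ hx => A.up_mem_WM f hx)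
  map_id n x := Subtype.ext (by
    change A.map _ x.1 = x.1
    rw [up_id, A.map_id])
  map_comp f g x := Subtype.ext (by
    change A.map _ x.1 = A.map _ (A.map _ x.1)
    rw [up_comp, A.map_comp])

/-- Constant simplicial vector space. -/
def cS (V : Type) [AddCommGroup V] [Module ℚ V] : SMod where
  X _ := V
  map _ := LinearMap.id
  map_id _ _ := rfl
  map_comp _ _ _ := rfl

/-- Splitting data for the zeroth homology. -/
structure Split (V : Type) [AddCommGroup V] [Module ℚ V] where
  κ : A.X 0 →ₗ[ℚ] V
  ς : V →ₗ[ℚ] A.X 0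
  κς : ∀ v, κ (ς v) = v
  exact : ∀ x, κ x = 0 ↔ ∃ y, A.d 0 y = x

variable {A}
variable {V : Type} [AddCommGroup V] [Module ℚ V]

lemma d_zero_apply (y : A.X 1) : A.d 0 y = A.map (df 0) y - A.map (df 1) y := by
  rw [A.d_apply']
  simp [Finset.sum_range_succ, sub_eq_add_neg]

/-- All vertices of a simplex have the same class. -/
lemma Split.vertex (S : A.Split V) {n : ℕ} (x : A.X n) (i j : Fin (n + 1)) (hij : i ≤ j) :
    S.κ (A.map (cst i : Fin (0 + 1) →o _) x) = S.κ (A.map (cst j : Fin (0 + 1) →o _) x) := by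
  let f : Fin (1 + 1) →o Fin (n + 1) := ⟨fun a => if a = 0 then i else j, by
    intro a b h
    by_cases ha : a = 0
    · by_cases hb : b = 0 <;> simp [ha, hb, hij]
    · have : b ≠ 0 := by
        rintro rfl
        exact ha (le_antisymm h (Fin.zero_le _))
      simp [ha, this]⟩
  have hf0 : f 0 = i := rfl
  have hf1 : ∀ a : Fin 1, f a.succ = j := fun a => rfl
  have h : S.κ (A.d 0 (A.map f x)) = 0 := (S.exact _).2 ⟨_, rfl⟩
  rw [d_zero_apply, map_map, map_map, map_sub, sub_eq_zero] at h
  rw [A.map_congr (f := f.comp (df 0)) (g := cst j) (fun a => (congrArg f (df_zero_apply a)).trans (hf1 a)),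
    A.map_congr (f := f.comp (df 1)) (g := cst i)] at h
  · exact h.symm
  · intro a
    have : df 1 a = 0 := by
      apply Fin.ext
      rw [df_val]
      have := a.2
      simp
    exact (congrArg f this).trans hf0

/-- The loop sequence. -/
noncomputable def Split.LS (S : A.Split V) : LS A.WS A.PS A (cS V) where
  i := ⟨fun m => Submodule.inclusion inf_le_left, fun f x => rfl⟩
  p := ⟨fun m => (A.map (df 0)).domRestrict _, fun {m n} f x => by
    change A.map (df 0) (A.map (up f) x.1) = A.map f (A.map (df 0) x.1)
    rw [map_map, map_map]
    exact A.map_congr (fun i => by simp) _⟩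
  q := ⟨fun m => S.κ ∘ₗ A.map (cst 0), fun {m n} f x => by
    change S.κ (A.map (cst 0) (A.map f x)) = S.κ (A.map (cst 0) x)
    rw [map_map, S.vertex x 0 (f 0) (Fin.zero_le _)]
    rfl⟩
  s := ⟨fun m => A.map (cst 0) ∘ₗ S.ς, fun {m n} f x => by
    change A.map (cst 0) (S.ς x) = A.map f (A.map (cst 0) (S.ς x))
    rw [map_map]
    exact A.map_congr (fun i => rfl) _⟩
  K :=
    { K := fun m χ => (A.map (ctr χ)).restrict (fun x (hx : A.map _ x = 0) => by
        change A.map _ (A.map _ x) = 0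
        rw [map_map, ← hx]
        exact A.map_congr (fun i => rfl) _)
      nat := fun {m n} f χ x => by
        apply Subtype.ext
        change A.map (up f) (A.map (ctr χ) x.1) = A.map (ctr (χ.comp f)) (A.map (up f) x.1)
        rw [map_map, map_map]
        refine A.map_congr (fun i => ?_) _
        refine Fin.cases ?_ (fun i => ?_) i
        · rfl
        · simp only [OrderHom.comp_coe, Function.comp_apply, up_succ, ctr_succ]
          split_ifs <;> simp }
  i_inj m := Submodule.inclusion_injective inf_le_left
  ip m := by
    intro x
    constructor
    · intro h
      exact ⟨⟨x.1, x.2, h⟩, rfl⟩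
    · rintro ⟨y, rfl⟩
      exact y.2.2
  pq m := by
    intro x
    constructor
    · intro h
      obtain ⟨y, hy⟩ := (S.exact _).1 h
      rw [d_zero_apply] at hy
      let f : Fin (m + 1 + 1) →o Fin (1 + 1) := ⟨fun a => if a = 0 then 0 else 1, by
        intro a b h
        by_cases ha : a = 0
        · by_cases hb : b = 0 <;> simp [ha, hb]
        · have : b ≠ 0 := by
            rintro rfl
            exact ha (le_antisymm h (Fin.zero_le _))
          simp [ha, this]⟩
      have hf0 : f 0 = 0 := rfl
      have hf1 : ∀ a : Fin (m + 1), f a.succ = 1 := fun a => rfl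
      -- x lifts to s_0 x - f^* (s_0 d_0 y) + f^* y  up to sign
      have hc0 : ∀ (a : Fin (0 + 1)), df 1 a = (0 : Fin (0 + 2)) := by
        intro a
        apply Fin.ext
        rw [df_val]
        simp
      have hc1 : ∀ (a : Fin (0 + 1)), df 0 a = (1 : Fin (0 + 2)) := by
        intro a
        apply Fin.ext
        rw [df_val]
        simp
      let g : Fin (m + 1 + 1) →o Fin (m + 1) := sg 0
      have hg : ∀ i : Fin (m + 1), g i.succ = i := by
        intro i
        apply Fin.ext
        simp [g, sg_val]
      refine ⟨⟨A.map g x + A.map f y - A.map (cst 0) (A.map (df 0) y), ?_⟩, ?_⟩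
      · rw [mem_PM, map_sub, map_add, map_map, map_map, map_map, map_map]
        rw [A.map_congr (f := g.comp (cst 0)) (g := cst 0) (fun i => by
            apply Fin.ext
            simp [g, sg_val]) x, ← hy, A.map_congr (f := f.comp (cst 0)) (g := df 1) (fun i => by rw [hc0]; exact hf0) y]
        rw [A.map_congr (f := (df 0).comp ((cst 0).comp (cst 0))) (g := df 0) (fun i => by rw [hc1]; simp) y]
        abel
      · change A.map (df 0) (A.map g x + A.map f y - A.map (cst 0) (A.map (df 0) y)) = x
        rw [map_sub, map_add, map_map, map_map, map_map, map_map]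
        rw [A.map_congr (f := g.comp (df 0)) (g := OrderHom.id) (fun i => by simp [hg]) x, A.map_id]
        rw [A.map_congr (f := f.comp (df 0)) (g := (df 0).comp ((cst 0).comp (df 0))) (fun i => by simp only [OrderHom.comp_coe, Function.comp_apply, df_zero_apply, hf1, cst_apply]; rfl) y]
        abel
    · rintro ⟨y, rfl⟩
      have hy : A.map (cst 0 : Fin (0 + 1) →o _) y.1 = 0 := y.2
      change S.κ (A.map (cst 0) (A.map (df 0) y.1)) = 0
      rw [map_map]
      rw [A.map_congr (g := (cst 1 : Fin (0 + 1) →o _)) (fun i => by simp), ← S.vertex y.1 0 1 (Fin.zero_le _), hy, map_zero]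
  qs m x := by
    change S.κ (A.map (cst 0) (A.map (cst 0) (S.ς x))) = x
    rw [map_map, A.map_congr (g := OrderHom.id), A.map_id]
    · exact S.κς x
    intro i
    exact (Subsingleton.elim (α := Fin 1) _ _)
  K1 m x := by
    apply Subtype.ext
    change A.map (ctr (ps 0)) x.1 = x.1
    rw [A.map_congr (g := OrderHom.id), A.map_id]
    intro i
    refine Fin.cases ?_ (fun i => ?_) i
    · rfl
    · simp [ps_val]
  K0 m x := by
    have hx : A.map (cst 0 : Fin (0 + 1) →o _) x.1 = 0 := x.2
    apply Subtype.ext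
    change A.map (ctr (ps (m + 1))) x.1 = 0
    rw [A.map_congr (g := (cst 0 : Fin (0 + 1) →o _).comp (cst 0)), ← map_map, hx, map_zero]
    intro i
    refine Fin.cases ?_ (fun i => ?_) i
    · rfl
    · have : ¬ (m + 1 ≤ (i : ℕ)) := by have := i.2; omega
      simp [ps_val]
      omega

end SMod
end CS

open CategoryTheory
open scoped DirectSum TensorProduct

namespace CS
namespace SMod

/-- Collapse an initial segment. -/
def rho {n : ℕ} (t : ℕ) : Fin (n + 1) →o Fin (n + 1) where
  toFun j := if t + 1 ≤ (j : ℕ) then j else 0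
  monotone' a b h := by
    have : (a : ℕ) ≤ b := h
    simp only [Fin.le_def]
    split_ifs <;> simp <;> omega

lemma rho_val {n : ℕ} (t : ℕ) (j : Fin (n + 1)) : (rho t j : ℕ) = if t + 1 ≤ (j : ℕ) then (j : ℕ) else 0 := by
  change ((if t + 1 ≤ (j : ℕ) then j else 0 : Fin (n + 1)) : ℕ) = _
  split_ifs <;> simp

lemma up_val {m n : ℕ} (f : Fin (m + 1) →o Fin (n + 1)) (j : Fin (m + 2)) :
    (up f j : ℕ) = if h : (j : ℕ) = 0 then 0 else (f ⟨j - 1, by omega⟩ : ℕ) + 1 := by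
  refine Fin.cases ?_ (fun j => ?_) j
  · simp
  · simp

lemma map_congr' (A : SMod) {m n : ℕ} {f g : Fin (m + 1) →o Fin (n + 1)} (h : ∀ i, (f i : ℕ) = g i) (x : A.X n) :
    A.map f x = A.map g x := A.map_congr (fun i => Fin.ext (h i)) x

/-- Terms of the suspension map. -/
noncomputable def eTt (A B : SMod) (m t : ℕ) : ((WS A).tens B).X m →ₗ[ℚ] (A.tens B).X (m + 1) :=
  (TensorProduct.map ((A.map (rho t)).domRestrict (A.WM m)) (B.map (sg t)) :
      (A.WM m ⊗[ℚ] B.X m) →ₗ[ℚ] (A.X (m + 1) ⊗[ℚ] B.X (m + 1)))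

lemma eTt_tm {A B : SMod} {m t : ℕ} (w : (WS A).X m) (b : B.X m) :
    eTt A B m t (tm w b) = tm (A.map (rho t) w.1) (B.map (sg t) b) := rfl

/-- The suspension map. -/
noncomputable def eT (A B : SMod) (m : ℕ) : ((WS A).tens B).X m →ₗ[ℚ] (A.tens B).X (m + 1) :=
  ∑ t ∈ Finset.range (m + 1), ((-1 : ℚ) ^ t) • eTt A B m t

lemma eT_apply {A B : SMod} {m : ℕ} (x : ((WS A).tens B).X m) :
    eT A B m x = ∑ t ∈ Finset.range (m + 1), ((-1 : ℚ) ^ t) • eTt A B m t x := by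
  unfold eT
  rw [LinearMap.sum_apply]
  rfl

lemma eT_tm {A B : SMod} {m : ℕ} (w : (WS A).X m) (b : B.X m) :
    eT A B m (tm w b) = ∑ t ∈ Finset.range (m + 1), ((-1 : ℚ) ^ t) •
      (tm (A.map (rho t) w.1) (B.map (sg t) b) : (A.tens B).X (m + 1)) := eT_apply _

variable {V : Type} [AddCommGroup V] [Module ℚ V]

lemma Split.e_tens {A : SMod} (S : A.Split V) (B : SMod) (m : ℕ) (x : ((WS A).tens B).X m) :
    (S.LS.tens B).e m x = eT A B m x := by
  refine LinearMap.congr_fun (tens_ext fun w b => ?_) x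
  rw [LS.e_apply, Prism.h_apply, map_sum, eT_tm]
  refine Finset.sum_congr rfl fun t ht => ?_
  rw [map_smul]
  congr 1
  change tm (A.map (df 0) (A.map (ctr (ps (t + 1))) (A.map (up (sg t)) w.1))) (B.map (sg t) b) = _
  rw [map_map, map_map]
  congr 1
  refine A.map_congr' (fun i => ?_) _
  simp only [OrderHom.comp_coe, Function.comp_apply, df_zero_apply, ctr_succ, rho_val, ps_val]
  by_cases h : t + 1 ≤ (i : ℕ)
  · simp only [h, decide_true, if_true, up_succ, Fin.val_succ, sg_val]
    split_ifs <;> omega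
  · simp [h]

/-- Exchange lemma for double sums. -/
lemma exch_sum {B : Type} [AddCommGroup B] [Module ℚ B] (F G : ℕ → ℕ → B) (n : ℕ)
    (h1 : ∀ t s, t ≤ s → s < n → F t (s + 1) = G s t)
    (h2 : ∀ t s, s ≤ t → t < n → F t s = G s (t + 1)) :
    ∑ t ∈ Finset.range n, ∑ s ∈ Finset.range (n + 1), ((-1 : ℚ) ^ (t + s)) • F t s =
      - ∑ s ∈ Finset.range n, ∑ t ∈ Finset.range (n + 1), ((-1 : ℚ) ^ (s + t)) • G s t := by
  induction n with
  | zero => simp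
  | succ n ih =>
    have ih := ih (fun t s h h' => h1 t s h (by omega)) (fun t s h h' => h2 t s h (by omega))
    have key : ∀ (F : ℕ → ℕ → B), ∑ t ∈ Finset.range (n + 1), ∑ s ∈ Finset.range (n + 1 + 1), ((-1 : ℚ) ^ (t + s)) • F t s
       = ∑ t ∈ Finset.range n, ∑ s ∈ Finset.range (n + 1), ((-1 : ℚ) ^ (t + s)) • F t s
        + ∑ t ∈ Finset.range (n + 1), ((-1 : ℚ) ^ (t + (n + 1))) • F t (n + 1)
        + ∑ s ∈ Finset.range (n + 1), ((-1 : ℚ) ^ (n + s)) • F n s := by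
      intro F
      simp only [Finset.sum_range_succ _ (n + 1), Finset.sum_add_distrib]
      rw [Finset.sum_range_succ]
      abel
    have e1 : ∑ t ∈ Finset.range (n + 1), ((-1 : ℚ) ^ (t + (n + 1))) • F t (n + 1)
       = - ∑ s ∈ Finset.range (n + 1), ((-1 : ℚ) ^ (n + s)) • G n s := by
      rw [← Finset.sum_neg_distrib]
      refine Finset.sum_congr rfl fun t ht => ?_
      rw [h1 t n (by simp at ht; omega) (by omega), ← neg_smul]
      congr 1
      ring
    have e2 : ∑ s ∈ Finset.range (n + 1), ((-1 : ℚ) ^ (n + s)) • F n s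
       = - ∑ t ∈ Finset.range (n + 1), ((-1 : ℚ) ^ (t + (n + 1))) • G t (n + 1) := by
      rw [← Finset.sum_neg_distrib]
      refine Finset.sum_congr rfl fun s hs => ?_
      rw [h2 n s (by simp at hs; omega) (by omega), ← neg_smul]
      congr 1
      ring
    rw [key F, key G, ih, e1, e2]
    abel

/-- Commuting two tensor factors. -/
noncomputable def lc (A A' B : SMod) : Hom (A.tens (A'.tens B)) (A'.tens (A.tens B)) where
  app n := (TensorProduct.leftComm ℚ (A.X n) (A'.X n) (B.X n)).toLinearMap
  comm {m n} φ x := by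
    refine LinearMap.congr_fun (f := ((TensorProduct.leftComm ℚ (A.X m) (A'.X m) (B.X m)).toLinearMap :
        (A.tens (A'.tens B)).X m →ₗ[ℚ] (A'.tens (A.tens B)).X m) ∘ₗ (A.tens (A'.tens B)).map φ)
      (g := (A'.tens (A.tens B)).map φ ∘ₗ ((TensorProduct.leftComm ℚ (A.X n) (A'.X n) (B.X n)).toLinearMap :
        (A.tens (A'.tens B)).X n →ₗ[ℚ] (A'.tens (A.tens B)).X n)) ?_ x
    exact TensorProduct.ext_threefold' (fun a b c => rfl)

lemma lc_tm {A A' B : SMod} {n : ℕ} (a : A.X n) (a' : A'.X n) (b : B.X n) :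
    (lc A A' B).app n (tm a (tm a' b)) = tm a' (tm a b) := rfl

lemma tens_ext3 {A A' B : SMod} {n : ℕ} {V : Type} [AddCommGroup V] [Module ℚ V]
    {f g : (A.tens (A'.tens B)).X n →ₗ[ℚ] V}
    (h : ∀ a a' b, f (tm a (tm a' b)) = g (tm a (tm a' b))) : f = g := by
  refine tens_ext fun a x => ?_
  refine LinearMap.congr_fun (f := f ∘ₗ tmL A (A'.tens B) n a) (g := g ∘ₗ tmL A (A'.tens B) n a) (tens_ext fun a' b => ?_) x
  exact h a a' b

/-- Terms of the suspension in the second factor. -/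
noncomputable def eRt (A' A B : SMod) (m t : ℕ) : (A'.tens ((WS A).tens B)).X m →ₗ[ℚ] (A'.tens (A.tens B)).X (m + 1) :=
  (TensorProduct.map (A'.map (sg t)) (eTt A B m t) :
    (A'.X m ⊗[ℚ] ((WS A).tens B).X m) →ₗ[ℚ] (A'.X (m + 1) ⊗[ℚ] (A.tens B).X (m + 1)))

lemma eRt_tm {A' A B : SMod} {m t : ℕ} (a : A'.X m) (x : ((WS A).tens B).X m) :
    eRt A' A B m t (tm a x) = tm (A'.map (sg t) a) (eTt A B m t x) := rfl

/-- Suspension in the second factor. -/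
noncomputable def eR (A' A B : SMod) (m : ℕ) : (A'.tens ((WS A).tens B)).X m →ₗ[ℚ] (A'.tens (A.tens B)).X (m + 1) :=
  ∑ t ∈ Finset.range (m + 1), ((-1 : ℚ) ^ t) • eRt A' A B m t

lemma eR_apply {A' A B : SMod} {m : ℕ} (x : (A'.tens ((WS A).tens B)).X m) :
    eR A' A B m x = ∑ t ∈ Finset.range (m + 1), ((-1 : ℚ) ^ t) • eRt A' A B m t x := by
  unfold eR
  rw [LinearMap.sum_apply]
  rfl

lemma lc_eT {A A' B : SMod} {m : ℕ} (u : ((WS A).tens (A'.tens B)).X m) :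
    (lc A A' B).app (m + 1) (eT A (A'.tens B) m u) = eR A' A B m ((lc (WS A) A' B).app m u) := by
  refine LinearMap.congr_fun (f := (lc A A' B).app (m + 1) ∘ₗ eT A (A'.tens B) m)
    (g := eR A' A B m ∘ₗ (lc (WS A) A' B).app m) (tens_ext3 fun a a' b => ?_) u
  rw [LinearMap.comp_apply, LinearMap.comp_apply, eT_apply, eR_apply, map_sum]
  refine Finset.sum_congr rfl fun t _ => ?_
  rw [map_smul]
  rfl

lemma eR_eT {A A' B : SMod} {m : ℕ} (u : ((WS A').tens ((WS A).tens B)).X m) :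
    eR A' A B (m + 1) (eT A' ((WS A).tens B) m u) = - eT A' (A.tens B) (m + 1) (eR (WS A') A B m u) := by
  refine LinearMap.congr_fun (f := eR A' A B (m + 1) ∘ₗ eT A' ((WS A).tens B) m)
    (g := - (eT A' (A.tens B) (m + 1) ∘ₗ eR (WS A') A B m)) (tens_ext3 fun w a b => ?_) u
  rw [LinearMap.neg_apply, LinearMap.comp_apply, LinearMap.comp_apply]
  let F : ℕ → ℕ → (A'.tens (A.tens B)).X (m + 2) := fun t s =>
    tm (A'.map ((rho t).comp (sg s)) w.1) (tm (A.map ((up (sg t)).comp (rho s)) a.1) (B.map ((sg t).comp (sg s)) b))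
  let G : ℕ → ℕ → (A'.tens (A.tens B)).X (m + 2) := fun s t =>
    tm (A'.map ((up (sg s)).comp (rho t)) w.1) (tm (A.map ((rho s).comp (sg t)) a.1) (B.map ((sg s).comp (sg t)) b))
  have hF : eR A' A B (m + 1) (eT A' ((WS A).tens B) m (tm w (tm a b))) =
      ∑ t ∈ Finset.range (m + 1), ∑ s ∈ Finset.range (m + 1 + 1), ((-1 : ℚ) ^ (t + s)) • F t s := by
    rw [eT_apply, map_sum]
    refine Finset.sum_congr rfl fun t _ => ?_
    rw [map_smul, eR_apply, Finset.smul_sum]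
    refine Finset.sum_congr rfl fun s _ => ?_
    rw [smul_smul, ← pow_add]
    congr 1
    simp only [F, ← map_map]
    rfl
  have hG : eT A' (A.tens B) (m + 1) (eR (WS A') A B m (tm w (tm a b))) =
      ∑ t ∈ Finset.range (m + 1), ∑ s ∈ Finset.range (m + 1 + 1), ((-1 : ℚ) ^ (t + s)) • G t s := by
    rw [eR_apply, map_sum]
    refine Finset.sum_congr rfl fun t _ => ?_
    rw [map_smul, eT_apply, Finset.smul_sum]
    refine Finset.sum_congr rfl fun s _ => ?_
    rw [smul_smul, ← pow_add]
    congr 1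
    simp only [G, ← map_map]
    rfl
  rw [hF, hG]
  have tmc : ∀ {a₁ a₂ : A'.X (m + 2)} {b₁ b₂ : A.X (m + 2)} {c₁ c₂ : B.X (m + 2)}, a₁ = a₂ → b₁ = b₂ → c₁ = c₂ →
      (tm a₁ (tm b₁ c₁) : (A'.tens (A.tens B)).X (m + 2)) = tm a₂ (tm b₂ c₂) := by
    rintro _ _ _ _ _ _ rfl rfl rfl
    rfl
  refine exch_sum F G (m + 1) ?_ ?_
  · intro t s hts hs
    refine tmc (A'.map_congr' (fun i => ?_) _) (A.map_congr' (fun i => ?_) _) (B.map_congr' (fun i => ?_) _) <;>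
    · have := i.2
      simp only [OrderHom.comp_coe, Function.comp_apply, rho_val, sg_val, up_val]
      split_ifs <;> omega
  · intro t s hts hs
    refine tmc (A'.map_congr' (fun i => ?_) _) (A.map_congr' (fun i => ?_) _) (B.map_congr' (fun i => ?_) _) <;>
    · have := i.2
      simp only [OrderHom.comp_coe, Function.comp_apply, rho_val, sg_val, up_val]
      split_ifs <;> omega

/-- Iterated loops. -/
@[reducible] def Wn : ℕ → SMod → SMod
  | 0, A => A
  | n + 1, A => Wn n (WS A)

/-- Suspension of families. -/
noncomputable def fe {A B : SMod} (u : ∀ m, ((WS A).tens B).X m) : ∀ m, (A.tens B).X m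
  | 0 => 0
  | m + 1 => eT A B m (u m)

/-- Suspension of families in the second factor. -/
noncomputable def feR {A' A B : SMod} (u : ∀ m, (A'.tens ((WS A).tens B)).X m) : ∀ m, (A'.tens (A.tens B)).X m
  | 0 => 0
  | m + 1 => eR A' A B m (u m)

/-- Cross product with a homotopy class. -/
noncomputable def cr {B : SMod} : ∀ (n : ℕ) (A : SMod), (Wn n A).X 0 → (∀ m, B.X m) → ∀ m, (A.tens B).X m
  | 0, A, z, y => fun m => tm (A.map (cst 0) (show A.X 0 from z)) (y m)
  | n + 1, A, z, y => fe (cr n (WS A) z y)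

lemma cr_zero {A B : SMod} (z : A.X 0) (y : ∀ m, B.X m) (m : ℕ) :
    cr 0 A z y m = tm (A.map (cst 0) z) (y m) := rfl

lemma cr_succ {A B : SMod} {n : ℕ} (z : (Wn n (WS A)).X 0) (y : ∀ m, B.X m) :
    cr (n + 1) A z y = fe (cr n (WS A) z y) := rfl

lemma cr_smul {A B : SMod} (n : ℕ) (z : (Wn n A).X 0) (y : ∀ m, B.X m) (c : ℚ) (m : ℕ) :
    cr n A z (c • y) m = c • cr n A z y m := by
  induction n generalizing A m with
  | zero => exact ((tmL A B m _).map_smul c (y m))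
  | succ n ih =>
    rw [cr_succ, cr_succ]
    cases m with
    | zero => exact (smul_zero _).symm
    | succ m =>
      change eT A B m (cr n (WS A) z (c • y) m) = c • eT A B m _
      rw [ih, map_smul]

lemma eT_nat {A B B' : SMod} (f : Hom B B') {m : ℕ} (x : ((WS A).tens B).X m) :
    eT A B' m ((tmap (Hom.id _) f).app m x) = (tmap (Hom.id A) f).app (m + 1) (eT A B m x) := by
  refine LinearMap.congr_fun (f := eT A B' m ∘ₗ (tmap (Hom.id _) f).app m)
    (g := (tmap (Hom.id A) f).app (m + 1) ∘ₗ eT A B m) (tens_ext fun w b => ?_) x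
  rw [LinearMap.comp_apply, LinearMap.comp_apply, tmap_tm, eT_tm, eT_tm, map_sum]
  refine Finset.sum_congr rfl fun t _ => ?_
  rw [map_smul, tmap_tm, f.comm]
  rfl

lemma cr_nat {A B B' : SMod} (f : Hom B B') (n : ℕ) (z : (Wn n A).X 0) (y : ∀ m, B.X m) (m : ℕ) :
    cr n A z (fun m => f.app m (y m)) m = (tmap (Hom.id A) f).app m (cr n A z y m) := by
  induction n generalizing A m with
  | zero => rfl
  | succ n ih =>
    rw [cr_succ, cr_succ]
    cases m with
    | zero => exact (map_zero _).symm
    | succ m =>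
      change eT A B' m (cr n (WS A) z _ m) = (tmap (Hom.id A) f).app (m + 1) (eT A B m _)
      rw [ih, eT_nat]

lemma feR_cr {A' A B : SMod} (n : ℕ) (w : (Wn n A').X 0) (v : ∀ m, ((WS A).tens B).X m) (m : ℕ) :
    feR (cr n A' w v) m = ((-1 : ℚ) ^ n) • cr n A' w (fe v) m := by
  induction n generalizing A' m with
  | zero =>
    rw [pow_zero, one_smul]
    cases m with
    | zero => exact ((tmL A' (A.tens B) 0 _).map_zero).symm
    | succ m =>
      change eR A' A B m (tm (A'.map (cst 0) w) (v m)) = tm (A'.map (cst 0) w) (eT A B m (v m))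
      rw [eR_apply, eT_apply, ← tmL_apply (A'.map (cst 0) w) (∑ t ∈ Finset.range (m + 1), _), map_sum]
      refine Finset.sum_congr rfl fun t _ => ?_
      rw [map_smul, eRt_tm, tmL_apply, map_map]
      rfl
  | succ n ih =>
    rw [cr_succ, cr_succ]
    cases m with
    | zero => exact (smul_zero _).symm
    | succ m =>
      change eR A' A B m (fe (cr n (WS A') w v) m) = _ • eT A' (A.tens B) m (cr n (WS A') w (fe v) m)
      have h := ih (A' := WS A') w m
      have h2 : cr n (WS A') w (fe v) m = ((-1 : ℚ) ^ n) • feR (cr n (WS A') w v) m := by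
        rw [h, smul_smul, ← mul_pow]
        norm_num
      rw [h2]
      cases m with
      | zero =>
        change eR A' A B 0 0 = _ • eT A' (A.tens B) 0 (_ • 0)
        simp
      | succ m =>
        change eR A' A B (m + 1) (eT A' ((WS A).tens B) m _) = _ • eT A' (A.tens B) (m + 1) (_ • eR (WS A') A B m _)
        rw [eR_eT, map_smul, smul_smul, ← pow_add, Odd.neg_one_pow ⟨n, by ring⟩, neg_one_smul]

lemma lc_fe {A A' B : SMod} (u : ∀ m, ((WS A).tens (A'.tens B)).X m) (m : ℕ) :
    (lc A A' B).app m (fe u m) = feR (fun m => (lc (WS A) A' B).app m (u m)) m := by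
  cases m with
  | zero => exact map_zero _
  | succ m => exact lc_eT _

lemma feR_smul {A' A B : SMod} (c : ℚ) (u : ∀ m, (A'.tens ((WS A).tens B)).X m) (m : ℕ) :
    feR (c • u) m = c • feR u m := by
  cases m with
  | zero => exact (smul_zero _).symm
  | succ m => exact (eR A' A B m).map_smul c (u m)

/-- Multiplication by a vertex class. -/
noncomputable def vx (A B : SMod) (z : A.X 0) : Hom B (A.tens B) where
  app m := tmL A B m (A.map (cst 0) z)
  comm {m n} f x := by
    rw [tmL_apply, tmL_apply, tens_map, map_map]
    rfl

theorem cr_comm {A A' B : SMod} (n n' : ℕ) (z : (Wn n A).X 0) (w : (Wn n' A').X 0) (y : ∀ m, B.X m) (m : ℕ) :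
    (lc A A' B).app m (cr n A z (cr n' A' w y) m) = ((-1 : ℚ) ^ (n * n')) • cr n' A' w (cr n A z y) m := by
  induction n generalizing A m with
  | zero =>
    rw [zero_mul, pow_zero, one_smul]
    have h := cr_nat (vx A B z) n' w y m
    refine Eq.trans ?_ h.symm
    rw [cr_zero]
    refine LinearMap.congr_fun (f := (lc A A' B).app m ∘ₗ tmL A (A'.tens B) m (A.map (cst 0) z))
      (g := (tmap (Hom.id A') (vx A B z)).app m) (tens_ext fun a b => ?_) _
    rfl
  | succ n ih =>
    rw [cr_succ, cr_succ, lc_fe]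
    have h : (fun m => (lc (WS A) A' B).app m (cr n (WS A) z (cr n' A' w y) m))
        = ((-1 : ℚ) ^ (n * n')) • cr n' A' w (cr n (WS A) z y) := funext fun m => ih z m
    rw [h, feR_smul, feR_cr, smul_smul, ← pow_add]
    congr 2
    ring

end SMod
end CS

open CategoryTheory
open scoped DirectSum TensorProduct

namespace CS
namespace SMod

lemma alt_sum {V : Type} [AddCommGroup V] [Module ℚ V] (x : V) (k : ℕ) :
    ∑ i ∈ Finset.range k, ((-1 : ℚ) ^ i) • x = if Even k then 0 else x := by
  induction k with
  | zero => simp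
  | succ k ih =>
    rw [Finset.sum_range_succ, ih]
    rcases Nat.even_or_odd k with h | h
    · have h' : ¬ Even (k + 1) := by rw [Nat.not_even_iff_odd]; exact h.add_one
      rw [if_pos h, if_neg h', h.neg_one_pow, one_smul, zero_add]
    · rw [if_neg (Nat.not_even_iff_odd.2 h), if_pos h.add_one, h.neg_one_pow, neg_one_smul, add_neg_cancel]

lemma cS_d {V : Type} [AddCommGroup V] [Module ℚ V] (n : ℕ) (x : (cS V).X (n + 1)) :
    (cS V).d n x = if Even n then (0 : V) else (x : V) := by
  rw [(cS V).d_apply']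
  refine (alt_sum (V := V) x (n + 2)).trans ?_
  have : Even (n + 2) ↔ Even n := by simp [Nat.even_add]
  exact if_congr this rfl rfl

lemma cS_acyc {V : Type} [AddCommGroup V] [Module ℚ V] (n : ℕ) (x : (cS V).X (n + 1)) (hx : (cS V).d n x = 0) :
    ∃ y, (cS V).d (n + 1) y = x := by
  by_cases h : Even n
  · refine ⟨x, ?_⟩
    exact (cS_d (n + 1) _).trans (if_neg (by rw [Nat.not_even_iff_odd]; exact h.add_one))
  · have : x = 0 := ((if_neg h).symm.trans (cS_d n x).symm).trans hx
    exact ⟨0, by rw [map_zero, this]⟩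

/-- Bases of all iterated loop classes. -/
structure HB (A : SMod) where
  Λ : ℕ → Type
  sp : ∀ n, (Wn n A).Split (Λ n →₀ ℚ)

lemma exists_split (A : SMod) : ∃ ι : Type, Nonempty (A.Split (ι →₀ ℚ)) := by
  let Q := A.X 0 ⧸ LinearMap.range (A.d 0)
  let b := Module.Basis.ofVectorSpace ℚ Q
  let κ : A.X 0 →ₗ[ℚ] (Module.Basis.ofVectorSpaceIndex ℚ Q →₀ ℚ) := b.repr.toLinearMap ∘ₗ Submodule.mkQ _
  have hs : Function.Surjective κ := b.repr.surjective.comp (Submodule.mkQ_surjective _)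
  obtain ⟨ς, hς⟩ := κ.exists_rightInverse_of_surjective (LinearMap.range_eq_top.2 hs)
  refine ⟨_, ⟨⟨κ, ς, fun v => LinearMap.congr_fun hς v, fun x => ?_⟩⟩⟩
  change b.repr _ = 0 ↔ _
  rw [LinearEquiv.map_eq_zero_iff]
  exact (Submodule.Quotient.mk_eq_zero _).trans Iff.rfl

lemma exists_HB (A : SMod) : Nonempty (HB A) := by
  choose Λ h using fun n => exists_split (Wn n A)
  exact ⟨⟨Λ, fun n => (h n).some⟩⟩

namespace HB
variable {A : SMod} (hb : HB A)

/-- Shifted basis. -/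
def sh : HB (WS A) := ⟨fun n => hb.Λ (n + 1), fun n => hb.sp (n + 1)⟩

/-- Classes. -/
noncomputable def z (n : ℕ) (l : hb.Λ n) : (Wn n A).X 0 := (hb.sp n).ς (Finsupp.single l 1)

/-- Letters. -/
abbrev Lt : Type := Σ n, hb.Λ n

/-- The loop sequence. -/
noncomputable def ls : LS (WS A) (PS A) A (cS (hb.Λ 0 →₀ ℚ)) := Split.LS (A := A) (hb.sp 0)

lemma homology (n : ℕ) : Nonempty (A.H n ≃ₗ[ℚ] (hb.Λ n →₀ ℚ)) := by
  induction n generalizing A with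
  | zero =>
    let f : A.Z 0 →ₗ[ℚ] (hb.Λ 0 →₀ ℚ) := (hb.sp 0).κ ∘ₗ (A.Z 0).subtype
    have hf : Function.Surjective f := fun v => ⟨⟨(hb.sp 0).ς v, A.dd_zero_apply _⟩, (hb.sp 0).κς v⟩
    have hk : LinearMap.ker f = (A.B 0).comap (A.Z 0).subtype := by
      ext x
      exact (hb.sp 0).exact x.1
    exact ⟨(Submodule.quotEquivOfEq _ _ hk.symm).trans (f.quotKerEquivOfSurjective hf)⟩
  | succ n ih =>
    obtain ⟨e⟩ := ih hb.sh
    let S := hb.ls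
    let f : (WS A).Z n →ₗ[ℚ] A.H (n + 1) := Submodule.mkQ _ ∘ₗ (S.e n).restrict (p := (WS A).Z n) (q := A.Z (n + 1))
      (fun x hx => S.d_e_cycle hx)
    have hk : ∀ x, f x = 0 ↔ ∃ y, A.d (n + 1) y = S.e n x.1 := by
      intro x
      exact A.cls_eq_zero (x := S.e n x.1) (hx := S.d_e_cycle x.2)
    have hk : LinearMap.ker f = ((WS A).B n).comap ((WS A).Z n).subtype := by
      ext x
      rw [LinearMap.mem_ker, hk]
      constructor
      · rintro ⟨y, hy⟩
        exact S.inj x.2 hy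
      · rintro ⟨y, hy⟩
        refine ⟨- S.e (n + 1) y, ?_⟩
        rw [map_neg, S.d_e, neg_neg]
        exact congrArg _ hy
    have hf : Function.Surjective f := by
      intro v
      obtain ⟨x, hx, rfl⟩ := A.cls_surj v
      have hx' : A.d n x = 0 := hx
      obtain ⟨y, hy⟩ := cS_acyc n (S.q.app (n + 1) x) (by rw [← S.q.d, hx', map_zero])
      obtain ⟨u, hu, r, hr⟩ := S.surj (x := x - S.s.app (n + 1) (S.q.app (n + 1) x))
        (by rw [map_sub, hx', ← S.s.d, ← S.q.d, hx', map_zero, map_zero, sub_zero]) (by rw [map_sub, S.qs, sub_self])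
      refine ⟨⟨u, hu⟩, ?_⟩
      refine (A.cls_eq (x := S.e n u) (hx := S.d_e_cycle hu)).2 ?_
      refine ⟨- r - S.s.app _ y, ?_⟩
      rw [map_sub, map_neg, hr, ← S.s.d, hy]
      abel
    exact ⟨((f.quotKerEquivOfSurjective hf).symm.trans (Submodule.quotEquivOfEq _ _ hk)).trans e⟩

end HB

/-- Graded bases of homology by families. -/
structure GB (C : SMod) (ι : Type) where
  deg : ι → ℕ
  g : ι → ∀ m, C.X m
  cyc : ∀ b m, C.dd m (g b m) = 0
  conc : ∀ b m, m ≠ deg b → g b m = 0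
  span : ∀ m x, C.dd m x = 0 → ∃ (c : ι →₀ ℚ) (y : _), C.d m y = x - Finsupp.linearCombination ℚ (fun b => g b m) c
  ind : ∀ m (c : ι →₀ ℚ) y, C.d m y = Finsupp.linearCombination ℚ (fun b => g b m) c → ∀ b, deg b = m → c b = 0

lemma lc_unit (c : Unit →₀ ℚ) : Finsupp.linearCombination ℚ (fun _ : Unit => (1 : ℚ)) c = c () := by
  have : c = Finsupp.single () (c ()) := by
    ext
    simp
  rw [this, Finsupp.linearCombination_single]
  simp

/-- The point. -/
noncomputable def GBpt : GB (cS ℚ) Unit where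
  deg _ := 0
  g _ m := if m = 0 then (1 : ℚ) else (0 : ℚ)
  cyc b m := by
    cases m with
    | zero => exact dd_zero_apply _ _
    | succ m => exact map_zero _
  conc b m hm := if_neg hm
  span m x hx := by
    cases m with
    | zero =>
      refine ⟨Finsupp.single () x, 0, ?_⟩
      rw [map_zero]
      have key : ∀ x : ℚ, 0 = x - Finsupp.linearCombination ℚ (fun _ : Unit => (1 : ℚ)) (Finsupp.single () x) := by
        intro x
        rw [lc_unit, Finsupp.single_eq_same, sub_self]
      exact key x
    | succ m =>
      obtain ⟨y, hy⟩ := cS_acyc m x hx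
      refine ⟨0, y, ?_⟩
      rw [map_zero, sub_zero, hy]
  ind m c y h b hb := by
    subst hb
    have h1 : (cS ℚ).d 0 y = (0 : ℚ) := (cS_d 0 y).trans (if_pos (by decide))
    exact (lc_unit c).symm.trans (h.symm.trans h1)

/-- Projection to a coefficient. -/
noncomputable def prC (Λ : Type) (B : SMod) (l : Λ) : Hom ((cS (Λ →₀ ℚ)).tens B) B where
  app m := (TensorProduct.lift ((LinearMap.lsmul ℚ (B.X m) : ℚ →ₗ[ℚ] B.X m →ₗ[ℚ] B.X m) ∘ₗ Finsupp.lapply l) :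
    ((Λ →₀ ℚ) ⊗[ℚ] B.X m) →ₗ[ℚ] B.X m)
  comm {m n} f x := by
    refine LinearMap.congr_fun (f := (TensorProduct.lift ((LinearMap.lsmul ℚ (B.X m) : ℚ →ₗ[ℚ] B.X m →ₗ[ℚ] B.X m) ∘ₗ Finsupp.lapply l) :
      ((cS (Λ →₀ ℚ)).tens B).X m →ₗ[ℚ] B.X m) ∘ₗ ((cS (Λ →₀ ℚ)).tens B).map f)
      (g := B.map f ∘ₗ (TensorProduct.lift ((LinearMap.lsmul ℚ (B.X n) : ℚ →ₗ[ℚ] B.X n →ₗ[ℚ] B.X n) ∘ₗ Finsupp.lapply l) :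
      ((cS (Λ →₀ ℚ)).tens B).X n →ₗ[ℚ] B.X n)) (tens_ext fun a b => ?_) x
    exact ((B.map f).map_smul _ b).symm

/-- The basis vector family. -/
noncomputable def bv {Λ : Type} (B : SMod) (m : ℕ) (l : Λ) : B.X m →ₗ[ℚ] ((cS (Λ →₀ ℚ)).tens B).X m :=
  tmL (cS (Λ →₀ ℚ)) B m (Finsupp.single l (1 : ℚ))

lemma prC_bv {Λ : Type} [DecidableEq Λ] {B : SMod} {m : ℕ} (l l' : Λ) (b : B.X m) :
    (prC Λ B l).app m (bv B m l' b) = if l' = l then b else 0 := by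
  have : (prC Λ B l).app m (bv B m l' b) = ((Finsupp.single l' (1 : ℚ) : Λ →₀ ℚ) l) • b := rfl
  rw [this, Finsupp.single_apply]
  split_ifs <;> simp

lemma bv_surj {Λ : Type} {B : SMod} {m : ℕ} (x : ((cS (Λ →₀ ℚ)).tens B).X m) :
    ∃ f : Λ →₀ B.X m, x = f.sum (fun l b => bv B m l b) := by
  classical
  have : ∀ y : (Λ →₀ ℚ) ⊗[ℚ] B.X m, ∃ f : Λ →₀ B.X m, y = Finsupp.lsum ℚ (fun l => bv B m l) f := by
    intro y
    refine TensorProduct.induction_on y ?_ ?_ ?_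
    · exact ⟨0, (map_zero _).symm⟩
    · intro v b
      induction v using Finsupp.induction_linear with
      | zero => exact ⟨0, (TensorProduct.zero_tmul _ _).trans (map_zero _).symm⟩
      | add v w hv hw =>
        obtain ⟨f, hf⟩ := hv
        obtain ⟨g, hg⟩ := hw
        refine ⟨f + g, ?_⟩
        rw [map_add, ← hf, ← hg]
        exact TensorProduct.add_tmul _ _ _
      | single l a =>
        refine ⟨Finsupp.single l (a • b), ?_⟩
        rw [Finsupp.lsum_single]
        have h1 : (Finsupp.single l a : Λ →₀ ℚ) = a • Finsupp.single l 1 := by simp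
        rw [h1]
        exact TensorProduct.smul_tmul _ _ _
    · rintro x y ⟨f, hf⟩ ⟨g, hg⟩
      refine ⟨f + g, ?_⟩
      rw [map_add, ← hf, ← hg]
      rfl
  exact this x

section Kun
variable {A B : SMod} {ι : Type} (G : GB B ι)

/-- Combination in the constant part. -/
noncomputable def c0 {Λ : Type} (G : GB B ι) (m : ℕ) (c : Λ × ι →₀ ℚ) : ((cS (Λ →₀ ℚ)).tens B).X m :=
  Finsupp.linearCombination ℚ (fun p => bv B m p.1 (G.g p.2 m)) c

lemma c0_ind {Λ : Type} {m : ℕ} (c : Λ × ι →₀ ℚ) (y) (hy : ((cS (Λ →₀ ℚ)).tens B).d m y = c0 G m c)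
    (p : Λ × ι) (hp : G.deg p.2 = m) : c p = 0 := by
  classical
  obtain ⟨l, b⟩ := p
  let r : (Λ × ι →₀ ℚ) →ₗ[ℚ] (ι →₀ ℚ) := Finsupp.lcomapDomain (fun b => (l, b)) (Prod.mk_right_injective l)
  have hr : ∀ c b, r c b = c (l, b) := fun c b => rfl
  have key : (prC Λ B l).app m (c0 G m c) = Finsupp.linearCombination ℚ (fun b => G.g b m) (r c) := by
    have : (prC Λ B l).app m ∘ₗ Finsupp.linearCombination ℚ (fun p : Λ × ι => bv B m p.1 (G.g p.2 m)) =
        Finsupp.linearCombination ℚ (fun b => G.g b m) ∘ₗ r := by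
      refine Finsupp.lhom_ext fun p a => ?_
      obtain ⟨l', b'⟩ := p
      rw [LinearMap.comp_apply, LinearMap.comp_apply, Finsupp.linearCombination_single, map_smul, prC_bv]
      by_cases h : l' = l
      · subst h
        have h2 : r (Finsupp.single (l', b') a) = Finsupp.single b' a := by
          ext b
          rw [hr, Finsupp.single_apply, Finsupp.single_apply]
          simp
        rw [h2, Finsupp.linearCombination_single, if_pos rfl]
      · have h2 : r (Finsupp.single (l', b') a) = 0 := by
          ext b
          rw [hr, Finsupp.single_apply]
          simp [h]
        rw [h2, map_zero, if_neg h, smul_zero]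
    exact LinearMap.congr_fun this c
  exact G.ind m (r c) ((prC Λ B l).app _ y) (by rw [← (prC Λ B l).d, hy, key]) b hp

lemma c0_span {Λ : Type} {m : ℕ} (x : ((cS (Λ →₀ ℚ)).tens B).X m) (hx : ((cS (Λ →₀ ℚ)).tens B).dd m x = 0) :
    ∃ (c : Λ × ι →₀ ℚ) (y : _), ((cS (Λ →₀ ℚ)).tens B).d m y = x - c0 G m c := by
  classical
  obtain ⟨f, rfl⟩ := bv_surj x
  have hf : ∀ l, B.dd m (f l) = 0 := by
    intro l
    have h1 := (prC Λ B l).dd_app hx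
    have h2 : (prC Λ B l).app m (f.sum (fun l b => bv B m l b)) = f l := by
      rw [map_finsuppSum]
      simp only [prC_bv]
      rw [Finsupp.sum_ite_eq']
      simp
      exact fun h => h.symm
    rwa [h2] at h1
  choose c y hy using fun l => G.span m (f l) (hf l)
  have bvd : ∀ l (z : B.X (m + 1)), ((cS (Λ →₀ ℚ)).tens B).d m (bv B (m + 1) l z) = bv B m l (B.d m z) := by
    intro l z
    rw [d_apply, d_apply, map_sum]
    refine Finset.sum_congr rfl fun i _ => ?_
    rw [map_smul]
    rfl
  refine ⟨∑ l ∈ f.support, (c l).mapDomain (fun b => (l, b)), ∑ l ∈ f.support, bv B (m + 1) l (y l), ?_⟩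
  unfold c0
  rw [map_sum, map_sum, Finsupp.sum, ← Finset.sum_sub_distrib]
  refine Finset.sum_congr rfl fun l _ => ?_
  rw [bvd, hy, map_sub, Finsupp.linearCombination_mapDomain]
  congr 1
  rw [Finsupp.apply_linearCombination]
  rfl

lemma cr_cyc (n : ℕ) (z : (Wn n A).X 0) (y : ∀ m, B.X m) (hy : ∀ m, B.dd m (y m) = 0) (m : ℕ) :
    (A.tens B).dd m (cr n A z y m) = 0 := by
  induction n generalizing A m with
  | zero => exact (vx A B z).dd_app (hy m)
  | succ n ih =>
    rw [cr_succ]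
    cases m with
    | zero => exact dd_zero_apply _ _
    | succ m =>
      obtain ⟨ι, ⟨S⟩⟩ := exists_split A
      have h := (S.LS.tens B).d_e_cycle (ih z m)
      rw [S.e_tens] at h
      exact h

lemma cr_conc (n N : ℕ) (z : (Wn n A).X 0) (y : ∀ m, B.X m) (hy : ∀ m, m ≠ N → y m = 0) (m : ℕ) (hm : m ≠ n + N) :
    cr n A z y m = 0 := by
  induction n generalizing A m with
  | zero => rw [cr_zero, hy m (by omega)]; exact TensorProduct.tmul_zero _ _
  | succ n ih =>
    rw [cr_succ]
    cases m with
    | zero => rfl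
    | succ m =>
      change eT A B m (cr n (WS A) z y m) = 0
      rw [ih z m (by omega), map_zero]

/-- The combination map. -/
noncomputable def Phi (hb : HB A) (G : GB B ι) (m : ℕ) : (hb.Lt × ι →₀ ℚ) →ₗ[ℚ] (A.tens B).X m :=
  Finsupp.linearCombination ℚ (fun p => cr p.1.1 A (hb.z _ p.1.2) (G.g p.2) m)

lemma Phi_single (hb : HB A) (G : GB B ι) (m : ℕ) (p) (a : ℚ) :
    Phi hb G m (Finsupp.single p a) = a • cr p.1.1 A (hb.z _ p.1.2) (G.g p.2) m :=
  Finsupp.linearCombination_single ..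

lemma Phi_cyc (hb : HB A) (G : GB B ι) (m : ℕ) (c) : (A.tens B).dd m (Phi hb G m c) = 0 := by
  refine LinearMap.congr_fun (f := (A.tens B).dd m ∘ₗ Phi hb G m) (g := 0) (Finsupp.lhom_ext fun p a => ?_) c
  rw [LinearMap.comp_apply, Phi_single, map_smul, cr_cyc _ _ _ (G.cyc _), smul_zero]
  rfl

/-- Degree zero letters. -/
def j0 (hb : HB A) (p : hb.Λ 0 × ι) : hb.Lt × ι := (⟨0, p.1⟩, p.2)

/-- Positive degree letters. -/
def jp (hb : HB A) (p : hb.sh.Lt × ι) : hb.Lt × ι := (⟨p.1.1 + 1, p.1.2⟩, p.2)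

lemma j0_inj (hb : HB A) : Function.Injective (j0 (ι := ι) hb) := by
  rintro ⟨a, b⟩ ⟨a', b'⟩ h
  simp only [j0, Prod.mk.injEq, Sigma.mk.injEq, heq_eq_eq, true_and] at h
  rw [h.1, h.2]

lemma jp_inj (hb : HB A) : Function.Injective (jp (ι := ι) hb) := by
  rintro ⟨⟨n, a⟩, b⟩ ⟨⟨n', a'⟩, b'⟩ h
  simp only [jp, Prod.mk.injEq] at h
  obtain ⟨⟨rfl, h2⟩, rfl⟩ := h
  rfl

lemma Phi_j0 (hb : HB A) (G : GB B ι) (m : ℕ) (c : hb.Λ 0 × ι →₀ ℚ) :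
    Phi hb G m (Finsupp.lmapDomain ℚ ℚ (j0 hb) c) = (hb.ls.tens B).s.app m (c0 G m c) := by
  refine LinearMap.congr_fun (f := Phi hb G m ∘ₗ Finsupp.lmapDomain ℚ ℚ (j0 hb))
    (g := (hb.ls.tens B).s.app m ∘ₗ Finsupp.linearCombination ℚ (fun p => bv B m p.1 (G.g p.2 m)))
    (Finsupp.lhom_ext fun p a => ?_) c
  rw [LinearMap.comp_apply, LinearMap.comp_apply, Finsupp.lmapDomain_apply, Finsupp.mapDomain_single, Phi_single,
    Finsupp.linearCombination_single, map_smul]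
  rfl

lemma Phi_jp (hb : HB A) (G : GB B ι) (m : ℕ) (c : hb.sh.Lt × ι →₀ ℚ) :
    Phi hb G (m + 1) (Finsupp.lmapDomain ℚ ℚ (jp hb) c) = (hb.ls.tens B).e m (Phi hb.sh G m c) := by
  refine LinearMap.congr_fun (f := Phi hb G (m + 1) ∘ₗ Finsupp.lmapDomain ℚ ℚ (jp hb))
    (g := (hb.ls.tens B).e m ∘ₗ Phi hb.sh G m)
    (Finsupp.lhom_ext fun p a => ?_) c
  rw [LinearMap.comp_apply, LinearMap.comp_apply, Finsupp.lmapDomain_apply, Finsupp.mapDomain_single, Phi_single,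
    Phi_single, map_smul]
  exact congrArg (a • ·) (Split.e_tens (hb.sp 0) B m _).symm

lemma Phi_jp0 (hb : HB A) (G : GB B ι) (c : hb.sh.Lt × ι →₀ ℚ) :
    Phi hb G 0 (Finsupp.lmapDomain ℚ ℚ (jp hb) c) = 0 := by
  refine LinearMap.congr_fun (f := Phi hb G 0 ∘ₗ Finsupp.lmapDomain ℚ ℚ (jp hb))
    (g := 0) (Finsupp.lhom_ext fun p a => ?_) c
  rw [LinearMap.comp_apply, Finsupp.lmapDomain_apply, Finsupp.mapDomain_single, Phi_single]
  exact smul_zero _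

lemma split_c (hb : HB A) (c : hb.Lt × ι →₀ ℚ) :
    c = Finsupp.lmapDomain ℚ ℚ (j0 hb) (Finsupp.lcomapDomain (R := ℚ) (M := ℚ) (j0 hb) (j0_inj hb) c) +
      Finsupp.lmapDomain ℚ ℚ (jp hb) (Finsupp.lcomapDomain (R := ℚ) (M := ℚ) (jp hb) (jp_inj hb) c) := by
  ext p
  rw [Finsupp.add_apply, Finsupp.lmapDomain_apply, Finsupp.lmapDomain_apply]
  obtain ⟨⟨n, l⟩, b⟩ := p
  cases n with
  | zero =>
    have h1 : ((⟨0, l⟩, b) : hb.Lt × ι) = j0 hb (l, b) := rfl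
    rw [Finsupp.mapDomain_of_notMem_range (f := jp hb), add_zero, h1, Finsupp.mapDomain_apply (j0_inj hb)]
    · rfl
    · rintro ⟨q, hq⟩
      have := congrArg (fun t => t.1.1) hq
      exact Nat.succ_ne_zero _ this
  | succ n =>
    have h1 : ((⟨n + 1, l⟩, b) : hb.Lt × ι) = jp hb (⟨n, l⟩, b) := rfl
    rw [Finsupp.mapDomain_of_notMem_range (f := j0 hb), zero_add, h1, Finsupp.mapDomain_apply (jp_inj hb)]
    · rfl
    · rintro ⟨q, hq⟩
      have := congrArg (fun t => t.1.1) hq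
      exact Nat.succ_ne_zero _ this.symm

lemma kun_span (hb : HB A) (G : GB B ι) (m : ℕ) (x) (hx : (A.tens B).dd m x = 0) :
    ∃ c y, (A.tens B).d m y = x - Phi hb G m c := by
  induction m generalizing A with
  | zero =>
    let S := hb.ls.tens B
    obtain ⟨c, y0, hy0⟩ := c0_span G (S.q.app 0 x) (S.q.dd_app hx)
    obtain ⟨y, hy⟩ := S.surj0 (x := x - S.s.app 0 (S.q.app 0 x)) (by rw [map_sub, S.qs, sub_self])
    refine ⟨Finsupp.lmapDomain ℚ ℚ (j0 hb) c, y + S.s.app 1 y0, ?_⟩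
    rw [map_add, hy, ← S.s.d, hy0, Phi_j0, map_sub]
    abel
  | succ m ih =>
    let S := hb.ls.tens B
    obtain ⟨c, y0, hy0⟩ := c0_span G (S.q.app (m + 1) x) (S.q.dd_app hx)
    have hx' : (A.tens B).d m x = 0 := hx
    obtain ⟨u, hu, y, hy⟩ := S.surj (x := x - S.s.app _ (S.q.app _ x))
      (by rw [map_sub, ← S.s.d, ← S.q.d, hx', map_zero, map_zero, sub_zero]) (by rw [map_sub, S.qs, sub_self])
    obtain ⟨c', r, hr⟩ := ih hb.sh u hu
    refine ⟨Finsupp.lmapDomain ℚ ℚ (j0 hb) c + Finsupp.lmapDomain ℚ ℚ (jp hb) c',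
      y + S.s.app _ y0 - S.e _ r, ?_⟩
    rw [map_sub, map_add, hy, ← S.s.d, hy0, S.d_e, hr, map_add, Phi_j0, Phi_jp, map_sub, map_sub]
    abel

lemma kun_ind (hb : HB A) (G : GB B ι) (m : ℕ) (c) (y) (hy : (A.tens B).d m y = Phi hb G m c)
    (p : hb.Lt × ι) (hp : p.1.1 + G.deg p.2 = m) : c p = 0 := by
  induction m generalizing A with
  | zero =>
    let S := hb.ls.tens B
    rw [split_c hb c, map_add, Phi_j0, Phi_jp0, add_zero] at hy
    obtain ⟨⟨n, l⟩, b⟩ := p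
    obtain rfl : n = 0 := by simp at hp; exact hp.1
    refine c0_ind G (Finsupp.lcomapDomain (R := ℚ) (M := ℚ) (j0 hb) (j0_inj hb) c) (S.q.app _ y) ?_ (l, b) (by simp at hp; exact hp)
    rw [← S.q.d, hy, S.qs]
  | succ m ih =>
    let S := hb.ls.tens B
    rw [split_c hb c, map_add, Phi_j0, Phi_jp] at hy
    have h0 : ∀ p : hb.Λ 0 × ι, G.deg p.2 = m + 1 → (Finsupp.lcomapDomain (R := ℚ) (M := ℚ) (j0 hb) (j0_inj hb) c) p = 0 := by
      intro p hp
      refine c0_ind G (Finsupp.lcomapDomain (R := ℚ) (M := ℚ) (j0 hb) (j0_inj hb) c) (S.q.app _ y) ?_ p hp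
      rw [← S.q.d, hy, map_add, S.qs, S.q_e, add_zero]
    have h1 : c0 G (m + 1) (Finsupp.lcomapDomain (R := ℚ) (M := ℚ) (j0 hb) (j0_inj hb) c) = 0 := by
      unfold c0
      rw [Finsupp.linearCombination_apply]
      refine Finset.sum_eq_zero fun p _ => ?_
      dsimp only
      by_cases h : G.deg p.2 = m + 1
      · rw [h0 p h, zero_smul]
      · rw [G.conc p.2 (m + 1) (Ne.symm h), map_zero, smul_zero]
    obtain ⟨⟨n, l⟩, b⟩ := p
    cases n with
    | zero => exact h0 (l, b) (by simpa using hp)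
    | succ n =>
      rw [h1, map_zero, zero_add] at hy
      obtain ⟨r, hr⟩ := S.inj (Phi_cyc _ _ _ _) hy
      refine ih hb.sh _ r hr (⟨n, l⟩, b) ?_
      simp only at hp ⊢
      omega

/-- The Kuenneth basis. -/
noncomputable def GB.tens (hb : HB A) (G : GB B ι) : GB (A.tens B) (hb.Lt × ι) where
  deg p := p.1.1 + G.deg p.2
  g p := cr p.1.1 A (hb.z _ p.1.2) (G.g p.2)
  cyc p m := cr_cyc _ _ _ (G.cyc _) m
  conc p m hm := cr_conc _ (G.deg p.2) _ _ (G.conc _) m hm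
  span m x hx := kun_span hb G m x hx
  ind m c y h p hp := kun_ind hb G m c y h p hp

end Kun

/-- Tensor powers. -/
@[reducible] noncomputable def Tk (A : SMod) : ℕ → SMod
  | 0 => cS ℚ
  | k + 1 => A.tens (Tk A k)

/-- Words. -/
@[reducible] def Wd (Λ : Type) : ℕ → Type
  | 0 => Unit
  | k + 1 => Λ × Wd Λ k

/-- Underlying list. -/
def Wd.toList {Λ : Type} : ∀ {k : ℕ}, Wd Λ k → List Λ
  | 0, _ => []
  | _ + 1, w => w.1 :: Wd.toList w.2

/-- Swapping letters. -/
def Wd.sw {Λ : Type} : ∀ (l k : ℕ), Wd Λ k → Wd Λ k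
  | 0, _ + 2, w => (w.2.1, w.1, w.2.2)
  | 0, 1, w => w
  | 0, 0, w => w
  | l + 1, k + 1, w => (w.1, Wd.sw l k w.2)
  | _ + 1, 0, w => w

/-- Sign of a swap. -/
def Wd.sgn {Λ : ℕ → Type} : ∀ (l k : ℕ), Wd (Σ n, Λ n) k → ℚ
  | 0, _ + 2, w => (-1) ^ (w.1.1 * w.2.1.1)
  | 0, 1, _ => 1
  | 0, 0, _ => 1
  | l + 1, k + 1, w => Wd.sgn l k w.2
  | _ + 1, 0, _ => 1

/-- Swap of tensor factors. -/
noncomputable def swp (A : SMod) : ∀ l k : ℕ, Hom (Tk A k) (Tk A k)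
  | 0, k + 2 => lc A A (Tk A k)
  | 0, 1 => Hom.id _
  | 0, 0 => Hom.id _
  | l + 1, k + 1 => tmap (Hom.id A) (swp A l k)
  | _ + 1, 0 => Hom.id _

/-- The basis of the tensor power. -/
noncomputable def GBk {A : SMod} (hb : HB A) : ∀ k, GB (Tk A k) (Wd hb.Lt k)
  | 0 => GBpt
  | k + 1 => GB.tens hb (GBk hb k)

lemma GBk_deg {A : SMod} (hb : HB A) (k : ℕ) (w : Wd hb.Lt k) :
    (GBk hb k).deg w = ((Wd.toList w).map Sigma.fst).sum := by
  induction k with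
  | zero => rfl
  | succ k ih =>
    change w.1.1 + (GBk hb k).deg w.2 = _
    rw [ih]
    rfl

lemma swp_g {A : SMod} (hb : HB A) : ∀ (l k : ℕ) (w : Wd hb.Lt k) (m : ℕ),
    (swp A l k).app m ((GBk hb k).g w m) = Wd.sgn l k w • (GBk hb k).g (Wd.sw l k w) m
  | 0, k + 2, w, m => cr_comm w.1.1 w.2.1.1 (hb.z _ w.1.2) (hb.z _ w.2.1.2) ((GBk hb k).g w.2.2) m
  | 0, 1, w, m => (one_smul _ _).symm
  | 0, 0, w, m => (one_smul _ _).symm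
  | l + 1, k + 1, w, m => by
    refine (cr_nat (swp A l k) w.1.1 (hb.z _ w.1.2) ((GBk hb k).g w.2) m).symm.trans ?_
    have : (fun m => (swp A l k).app m ((GBk hb k).g w.2 m)) =
        Wd.sgn l k w.2 • (GBk hb k).g (Wd.sw l k w.2) := by
      funext m
      exact swp_g hb l k w.2 m
    rw [this]
    exact cr_smul _ _ _ _ _
  | l + 1, 0, w, m => (one_smul _ _).symm

end SMod
end CS

open CategoryTheory
open scoped DirectSum TensorProduct

namespace CS
namespace SMod

section hequiv
variable {C : SMod} {ι : Type} (G : GB C ι)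

/-- Homology from a basis. -/
noncomputable def GB.toH (i : ℕ) : ({b // G.deg b = i} →₀ ℚ) →ₗ[ℚ] C.H i :=
  Finsupp.linearCombination ℚ (fun b => C.cls (G.g b.1 i) (G.cyc _ _))

lemma GB.toH_single (i : ℕ) (b) (a : ℚ) : G.toH i (Finsupp.single b a) = a • C.cls (G.g b.1 i) (G.cyc _ _) :=
  Finsupp.linearCombination_single ..

lemma GB.comb_cyc (i : ℕ) (c : ι →₀ ℚ) : C.dd i (Finsupp.linearCombination ℚ (fun b => G.g b i) c) = 0 := by
  refine LinearMap.congr_fun (f := C.dd i ∘ₗ Finsupp.linearCombination ℚ (fun b => G.g b i)) (g := 0)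
    (Finsupp.lhom_ext fun p a => ?_) c
  rw [LinearMap.comp_apply, Finsupp.linearCombination_single, map_smul, G.cyc, smul_zero]
  rfl

lemma GB.toH_eq (i : ℕ) (c : ι →₀ ℚ) : C.cls _ (G.comb_cyc i c) =
    G.toH i (Finsupp.lcomapDomain (R := ℚ) (M := ℚ) Subtype.val Subtype.val_injective c) := by
  classical
  refine LinearMap.congr_fun (f := (Submodule.mkQ _ ∘ₗ LinearMap.codRestrict (C.Z i)
      (Finsupp.linearCombination ℚ (fun b => G.g b i)) (G.comb_cyc i) : (ι →₀ ℚ) →ₗ[ℚ] C.H i))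
    (g := G.toH i ∘ₗ Finsupp.lcomapDomain (R := ℚ) (M := ℚ) Subtype.val Subtype.val_injective)
    (Finsupp.lhom_ext fun p a => ?_) c
  have h0 : (Submodule.mkQ _ ∘ₗ LinearMap.codRestrict (C.Z i)
      (Finsupp.linearCombination ℚ (fun b => G.g b i)) (G.comb_cyc i) : (ι →₀ ℚ) →ₗ[ℚ] C.H i) (Finsupp.single p a) =
      C.cls (a • G.g p i) (by rw [map_smul, G.cyc, smul_zero]) := by
    refine (C.cls_eq (hx := G.comb_cyc i _)).2 ⟨0, ?_⟩
    rw [map_zero, Finsupp.linearCombination_single, sub_self]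
  rw [h0, LinearMap.comp_apply]
  by_cases h : G.deg p = i
  · have h2 : Finsupp.lcomapDomain (R := ℚ) (M := ℚ) Subtype.val Subtype.val_injective (Finsupp.single p a) =
        Finsupp.single (⟨p, h⟩ : {b // G.deg b = i}) a := by
      ext b
      change (Finsupp.single p a) b.1 = _
      rw [Finsupp.single_apply, Finsupp.single_apply]
      simp [Subtype.ext_iff]
    rw [h2, G.toH_single, ← cls_smul]
  · have h2 : Finsupp.lcomapDomain (R := ℚ) (M := ℚ) Subtype.val Subtype.val_injective (Finsupp.single p a) =
        (0 : {b // G.deg b = i} →₀ ℚ) := by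
      ext b
      change (Finsupp.single p a) b.1 = _
      rw [Finsupp.single_apply, if_neg]
      · rfl
      · rintro rfl
        exact h b.2
    rw [h2, map_zero]
    refine C.cls_eq_zero.2 ⟨0, ?_⟩
    rw [map_zero, G.conc p i (Ne.symm h), smul_zero]

lemma GB.toH_bij (i : ℕ) : Function.Bijective (G.toH i) := by
  classical
  constructor
  · rw [injective_iff_map_eq_zero]
    intro c hc
    have h2 : Finsupp.lcomapDomain (R := ℚ) (M := ℚ) Subtype.val Subtype.val_injective
        (Finsupp.lmapDomain ℚ ℚ Subtype.val c) = c := by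
      ext b
      change (Finsupp.mapDomain Subtype.val c) b.1 = _
      exact Finsupp.mapDomain_apply Subtype.val_injective _ _
    rw [← h2, ← G.toH_eq] at hc
    obtain ⟨y, hy⟩ := C.cls_eq_zero.1 hc
    ext b
    have := G.ind i _ y hy b.1 b.2
    rw [Finsupp.lmapDomain_apply, Finsupp.mapDomain_apply Subtype.val_injective] at this
    exact this
  · intro h
    obtain ⟨x, hx, rfl⟩ := C.cls_surj h
    obtain ⟨c, y, hy⟩ := G.span i x hx
    refine ⟨_, (G.toH_eq i c).symm.trans ?_⟩
    refine C.cls_eq.2 ⟨- y, ?_⟩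
    rw [map_neg, hy, neg_sub]

/-- Homology from a basis, equivalence. -/
noncomputable def GB.hequiv (i : ℕ) : ({b // G.deg b = i} →₀ ℚ) ≃ₗ[ℚ] C.H i :=
  LinearEquiv.ofBijective (G.toH i) (G.toH_bij i)

lemma GB.coinv {L : Type} (s : L → Hom C C) (sw : L → ι → ι) (ε : L → ι → ℚ)
    (hs : ∀ l b m, (s l).app m (G.g b m) = ε l b • G.g (sw l b) m) (hdeg : ∀ l b, G.deg (sw l b) = G.deg b) (i : ℕ) :
    Nonempty ((C.H i ⧸ Submodule.span ℚ {x | ∃ l y, x = y - (s l).H i y}) ≃ₗ[ℚ]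
      (({b // G.deg b = i} →₀ ℚ) ⧸ Submodule.span ℚ {x | ∃ l b, x = Finsupp.single b (1 : ℚ) -
        ε l b.1 • Finsupp.single (⟨sw l b.1, (hdeg l b.1).trans b.2⟩ : {b // G.deg b = i}) (1 : ℚ)})) := by
  refine ⟨(Submodule.Quotient.equiv _ _ (G.hequiv i) ?_).symm⟩
  change Submodule.map (G.toH i) _ = _
  have key : ∀ l b, G.toH i (Finsupp.single b (1 : ℚ) -
        ε l b.1 • Finsupp.single (⟨sw l b.1, (hdeg l b.1).trans b.2⟩ : {b // G.deg b = i}) (1 : ℚ)) =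
      G.toH i (Finsupp.single b 1) - (s l).H i (G.toH i (Finsupp.single b 1)) := by
    intro l b
    rw [map_sub, map_smul, G.toH_single, G.toH_single, one_smul, one_smul, Hom.H_cls]
    congr 1
    rw [← cls_smul]
    refine C.cls_eq.2 ⟨0, ?_⟩
    rw [map_zero, hs, sub_self]
  rw [Submodule.map_span]
  apply le_antisymm
  · rw [Submodule.span_le]
    rintro _ ⟨_, ⟨l, b, rfl⟩, rfl⟩
    rw [key]
    exact Submodule.subset_span ⟨l, _, rfl⟩
  · rw [Submodule.span_le]
    rintro _ ⟨l, y, rfl⟩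
    obtain ⟨c, rfl⟩ := (G.toH_bij i).2 y
    induction c using Finsupp.induction_linear with
    | zero => rw [map_zero, map_zero, sub_zero]; exact Submodule.zero_mem _
    | add v w hv hw =>
      rw [map_add, map_add, add_sub_add_comm]
      exact Submodule.add_mem _ hv hw
    | single b a =>
      have : (Finsupp.single b a : {b // G.deg b = i} →₀ ℚ) = a • Finsupp.single b 1 := by simp
      rw [this, map_smul, map_smul, ← smul_sub, ← key]
      exact Submodule.smul_mem _ _ (Submodule.subset_span ⟨_, ⟨l, b, rfl⟩, rfl⟩)

end hequiv

section alg
variable {Λ : ℕ → Type}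

/-- Relations among all words. -/
noncomputable def RA (Λ : ℕ → Type) : Submodule ℚ (List (Σ n, Λ n) →₀ ℚ) :=
  Submodule.span ℚ {x | ∃ (u v : List (Σ n, Λ n)) (a b : Σ n, Λ n), x = Finsupp.single (u ++ a :: b :: v) (1 : ℚ) -
    ((-1 : ℚ) ^ (a.1 * b.1)) • Finsupp.single (u ++ b :: a :: v) (1 : ℚ)}

lemma RA_cons (a : Σ n, Λ n) : RA Λ ≤ (RA Λ).comap (Finsupp.lmapDomain ℚ ℚ (List.cons a)) := by
  unfold RA
  rw [Submodule.span_le]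
  rintro _ ⟨u, v, b, c, rfl⟩
  refine Submodule.subset_span ⟨a :: u, v, b, c, ?_⟩
  rw [map_sub, map_smul, Finsupp.lmapDomain_apply, Finsupp.lmapDomain_apply, Finsupp.mapDomain_single,
    Finsupp.mapDomain_single]
  rfl

/-- Left multiplication by a letter. -/
noncomputable def Lq (a : Σ n, Λ n) : Module.End ℚ ((List (Σ n, Λ n) →₀ ℚ) ⧸ RA Λ) :=
  (RA Λ).mapQ (RA Λ) (Finsupp.lmapDomain ℚ ℚ (List.cons a)) (RA_cons a)

/-- The class of a word. -/
noncomputable def wq (w : List (Σ n, Λ n)) : (List (Σ n, Λ n) →₀ ℚ) ⧸ RA Λ := (RA Λ).mkQ (Finsupp.single w 1)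

lemma Lq_wq (a : Σ n, Λ n) (w) : Lq a (wq w) = wq (a :: w) := by
  change (RA Λ).mkQ (Finsupp.lmapDomain ℚ ℚ (List.cons a) (Finsupp.single w 1)) = _
  rw [Finsupp.lmapDomain_apply, Finsupp.mapDomain_single]
  rfl

lemma wq_ext {V : Type} [AddCommGroup V] [Module ℚ V] {f g : ((List (Σ n, Λ n) →₀ ℚ) ⧸ RA Λ) →ₗ[ℚ] V}
    (h : ∀ w, f (wq w) = g (wq w)) : f = g := by
  refine Submodule.linearMap_qext _ (Finsupp.lhom_ext' fun w => LinearMap.ext_ring ?_)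
  exact h w

lemma Lq_comm (a b : Σ n, Λ n) : Lq a * Lq b = ((-1 : ℚ) ^ (a.1 * b.1)) • (Lq b * Lq a) := by
  refine wq_ext fun w => ?_
  rw [LinearMap.smul_apply, Module.End.mul_apply, Module.End.mul_apply]
  rw [Lq_wq, Lq_wq, Lq_wq, Lq_wq]
  refine (Submodule.Quotient.eq _).2 ?_
  exact Submodule.subset_span ⟨[], w, a, b, rfl⟩

variable {V : ℕ → Type} [∀ i, AddCommGroup (V i)] [∀ i, Module ℚ (V i)] (e : ∀ j, V j ≃ₗ[ℚ] (Λ j →₀ ℚ))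

/-- Action of homogeneous vectors. -/
noncomputable def actJ (j : ℕ) : V j →ₗ[ℚ] Module.End ℚ ((List (Σ n, Λ n) →₀ ℚ) ⧸ RA Λ) :=
  Finsupp.linearCombination ℚ (fun l => Lq ⟨j, l⟩) ∘ₗ (e j).toLinearMap

lemma actJ_comm (i j : ℕ) (v : V i) (w : V j) : actJ e i v * actJ e j w =
    ((-1 : ℚ) ^ (i * j)) • (actJ e j w * actJ e i v) := by
  obtain ⟨x, rfl⟩ := (e i).symm.surjective v
  obtain ⟨y, rfl⟩ := (e j).symm.surjective w
  simp only [actJ, LinearMap.comp_apply, LinearEquiv.coe_coe, LinearEquiv.apply_symm_apply]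
  induction x using Finsupp.induction_linear with
  | zero => simp
  | add v w hv hw => rw [map_add, add_mul, mul_add, smul_add, hv, hw]
  | single l a =>
    induction y using Finsupp.induction_linear with
    | zero => simp
    | add v w hv hw => rw [map_add, add_mul, mul_add, smul_add, hv, hw]
    | single l' a' =>
      rw [Finsupp.linearCombination_single, Finsupp.linearCombination_single, smul_mul_smul_comm, smul_mul_smul_comm,
        Lq_comm, smul_comm, mul_comm a a']

/-- The representation. -/
noncomputable def rep : FreeGCAlg V →ₐ[ℚ] Module.End ℚ ((List (Σ n, Λ n) →₀ ℚ) ⧸ RA Λ) :=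
  RingQuot.liftAlgHom ℚ ⟨TensorAlgebra.lift ℚ (DirectSum.toModule ℚ ℕ _ (actJ e)), by
    rintro _ _ ⟨i, j, a, b⟩
    simp only [map_mul, map_smul, TensorAlgebra.lift_ι_apply]
    erw [DirectSum.toModule_lof, DirectSum.toModule_lof]
    exact actJ_comm e i j a b⟩

lemma rep_gen (p : Σ j, V j) : rep e (FreeGCAlg.gen V p) = actJ e p.1 p.2 := by
  unfold rep FreeGCAlg.gen
  erw [RingQuot.liftAlgHom_mkAlgHom_apply]
  rw [TensorAlgebra.lift_ι_apply]
  erw [DirectSum.toModule_lof]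

/-- Letter generators. -/
noncomputable def lg (a : Σ n, Λ n) : FreeGCAlg V := FreeGCAlg.gen V ⟨a.1, (e a.1).symm (Finsupp.single a.2 1)⟩

lemma rep_lg (a : Σ n, Λ n) : rep e (lg e a) = Lq a := by
  unfold lg
  rw [rep_gen]
  simp [actJ]

lemma rep_word (w : List (Σ n, Λ n)) : rep e ((w.map (lg e)).prod) (wq []) = wq w := by
  induction w with
  | nil => simp
  | cons a w ih =>
    rw [List.map_cons, List.prod_cons, map_mul, rep_lg]
    change Lq a _ = _
    rw [ih, Lq_wq]

/-- Generators linear in the vector. -/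
noncomputable def genL (V : ℕ → Type) [∀ i, AddCommGroup (V i)] [∀ i, Module ℚ (V i)] (j : ℕ) :
    V j →ₗ[ℚ] FreeGCAlg V :=
  (RingQuot.mkAlgHom ℚ (GradedCommRel V)).toLinearMap ∘ₗ TensorAlgebra.ι ℚ ∘ₗ DirectSum.lof ℚ ℕ V j

lemma genL_apply (j : ℕ) (v : V j) : genL V j v = FreeGCAlg.gen V ⟨j, v⟩ := rfl

lemma toList_length {Λ : Type} {k : ℕ} (w : Wd Λ k) : (Wd.toList w).length = k := by
  induction k with
  | zero => rfl
  | succ k ih => exact congrArg Nat.succ (ih w.2)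

lemma toList_inj {Λ : Type} {k : ℕ} : Function.Injective (Wd.toList (Λ := Λ) (k := k)) := by
  induction k with
  | zero => intro a b _; rfl
  | succ k ih =>
    intro a b h
    have h' : a.1 :: Wd.toList a.2 = b.1 :: Wd.toList b.2 := h
    obtain ⟨h1, h2⟩ := List.cons.inj h'
    exact Prod.ext h1 (ih h2)

lemma toList_surj {Λ : Type} (l : List Λ) : ∃ w : Wd Λ l.length, Wd.toList w = l := by
  induction l with
  | nil => exact ⟨(), rfl⟩
  | cons a l ih =>
    obtain ⟨w, hw⟩ := ih
    exact ⟨(a, w), congrArg (List.cons a) hw⟩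

lemma sym_eq (k i : ℕ) : SymComponent V k i = Submodule.span ℚ { x | ∃ l : List (Σ j, Λ j), l.length = k ∧
    (l.map Sigma.fst).sum = i ∧ x = (l.map (lg e)).prod } := by
  apply le_antisymm
  · unfold SymComponent
    rw [Submodule.span_le]
    rintro _ ⟨l, hl, hi, rfl⟩
    induction l generalizing k i with
    | nil => exact Submodule.subset_span ⟨[], hl, hi, rfl⟩
    | cons p l ih =>
      subst hl hi
      have h := ih l.length _ rfl rfl
      rw [List.map_cons (f := FreeGCAlg.gen V), List.prod_cons]
      generalize (l.map (FreeGCAlg.gen V)).prod = y at h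
      obtain ⟨j, v⟩ := p
      obtain ⟨x, rfl⟩ := (e j).symm.surjective v
      rw [← genL_apply]
      induction x using Finsupp.induction_linear with
      | zero => rw [map_zero, map_zero, zero_mul]; exact Submodule.zero_mem _
      | add v w hv hw => rw [map_add, map_add, add_mul]; exact Submodule.add_mem _ hv hw
      | single b a =>
        have h3 : (Finsupp.single b a : Λ j →₀ ℚ) = a • Finsupp.single b 1 := by simp
        rw [h3, map_smul, map_smul, smul_mul_assoc]
        refine Submodule.smul_mem _ _ ?_
        induction h using Submodule.span_induction with
        | zero => rw [mul_zero]; exact Submodule.zero_mem _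
        | add v w _ _ hv hw => rw [mul_add]; exact Submodule.add_mem _ hv hw
        | smul r v _ hv => rw [mul_smul_comm]; exact Submodule.smul_mem _ _ hv
        | mem v hv =>
          obtain ⟨l', hl', hi', rfl⟩ := hv
          refine Submodule.subset_span ⟨⟨j, b⟩ :: l', ?_, ?_, rfl⟩
          · simp [hl']
          · simp [hi']
  · rw [Submodule.span_le]
    rintro _ ⟨l, hl, hi, rfl⟩
    refine Submodule.subset_span ⟨l.map (fun a => ⟨a.1, (e a.1).symm (Finsupp.single a.2 1)⟩), ?_, ?_, ?_⟩
    · simpa using hl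
    · rw [List.map_map]; exact hi
    · rw [List.map_map]; rfl

lemma lg_comm (a b : Σ n, Λ n) : lg e a * lg e b = ((-1 : ℚ) ^ (a.1 * b.1)) • (lg e b * lg e a) := by
  have h := RingQuot.mkAlgHom_rel ℚ (GradedCommRel.comm (V := V) a.1 b.1
    ((e a.1).symm (Finsupp.single a.2 1)) ((e b.1).symm (Finsupp.single b.2 1)))
  rw [map_mul, map_smul, map_mul] at h
  exact h

lemma sw_prod : ∀ (l k : ℕ) (w : Wd (Σ n, Λ n) k), ((Wd.toList w).map (lg e)).prod =
    Wd.sgn l k w • ((Wd.toList (Wd.sw l k w)).map (lg e)).prod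
  | 0, k + 2, w => by
    change (lg e w.1 * (lg e w.2.1 * ((Wd.toList w.2.2).map (lg e)).prod) : FreeGCAlg V) = ((-1 : ℚ) ^ (w.1.1 * w.2.1.1)) •
      (lg e w.2.1 * (lg e w.1 * ((Wd.toList w.2.2).map (lg e)).prod))
    rw [← mul_assoc, ← mul_assoc, lg_comm, smul_mul_assoc]
  | 0, 1, w => (one_smul _ _).symm
  | 0, 0, w => (one_smul _ _).symm
  | l + 1, k + 1, w => by
    change lg e w.1 * ((Wd.toList w.2).map (lg e)).prod = Wd.sgn l k w.2 •
      (lg e w.1 * ((Wd.toList (Wd.sw l k w.2)).map (lg e)).prod)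
    rw [sw_prod l k w.2, mul_smul_comm]
  | l + 1, 0, w => (one_smul _ _).symm

lemma sw_deg : ∀ (l k : ℕ) (w : Wd (Σ n, Λ n) k), ((Wd.toList (Wd.sw l k w)).map Sigma.fst).sum =
    ((Wd.toList w).map Sigma.fst).sum
  | 0, k + 2, w => by
    change w.2.1.1 + (w.1.1 + _) = w.1.1 + (w.2.1.1 + _)
    exact Nat.add_left_comm _ _ _
  | 0, 1, w => rfl
  | 0, 0, w => rfl
  | l + 1, k + 1, w => congrArg (w.1.1 + ·) (sw_deg l k w.2)
  | l + 1, 0, w => rfl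

lemma sw_list (a b : Σ n, Λ n) (v : List (Σ n, Λ n)) : ∀ (u : List (Σ n, Λ n)) (k : ℕ) (w : Wd (Σ n, Λ n) k),
    Wd.toList w = u ++ a :: b :: v → Wd.toList (Wd.sw u.length k w) = u ++ b :: a :: v ∧
      Wd.sgn u.length k w = (-1 : ℚ) ^ (a.1 * b.1)
  | [], 0, w, h => by simp [Wd.toList] at h
  | [], 1, w, h => by simp [Wd.toList] at h
  | [], k + 2, w, h => by
    have h' : w.1 :: w.2.1 :: Wd.toList w.2.2 = a :: b :: v := h
    simp only [List.cons.injEq] at h'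
    obtain ⟨h1, h2, h3⟩ := h'
    refine ⟨?_, ?_⟩
    · change w.2.1 :: w.1 :: Wd.toList w.2.2 = b :: a :: v
      rw [h1, h2, h3]
    · change (-1 : ℚ) ^ (w.1.1 * w.2.1.1) = _
      rw [h1, h2]
  | c :: u, 0, w, h => by simp [Wd.toList] at h
  | c :: u, k + 1, w, h => by
    have h' : w.1 :: Wd.toList w.2 = c :: (u ++ a :: b :: v) := h
    obtain ⟨h1, h2⟩ := List.cons.inj h'
    obtain ⟨h3, h4⟩ := sw_list a b v u k w.2 h2
    refine ⟨?_, h4⟩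
    change w.1 :: Wd.toList (Wd.sw u.length k w.2) = _
    rw [h1, h3]
    rfl

lemma toList_surj' {Λ : Type} {k : ℕ} (l : List Λ) (hl : l.length = k) : ∃ w : Wd Λ k, Wd.toList w = l := by
  subst hl
  exact toList_surj l

lemma sym_equiv (e : ∀ j, V j ≃ₗ[ℚ] (Λ j →₀ ℚ)) (k i : ℕ) (deg : Wd (Σ n, Λ n) k → ℕ) (hdeg : ∀ w, deg w = ((Wd.toList w).map Sigma.fst).sum)
    (hsw : ∀ l w, deg (Wd.sw l k w) = deg w) :
    Nonempty ((({w // deg w = i} →₀ ℚ) ⧸ Submodule.span ℚ {x | ∃ l b, x = Finsupp.single b (1 : ℚ) -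
        Wd.sgn l k b.1 • Finsupp.single (⟨Wd.sw l k b.1, (hsw l b.1).trans b.2⟩ : {w // deg w = i}) (1 : ℚ)}) ≃ₗ[ℚ]
      SymComponent V k i) := by
  classical
  let Ψ : ({w // deg w = i} →₀ ℚ) →ₗ[ℚ] FreeGCAlg V :=
    Finsupp.linearCombination ℚ (fun w => ((Wd.toList w.1).map (lg e)).prod)
  have hr : LinearMap.range Ψ = SymComponent V k i := by
    rw [sym_eq e, Finsupp.range_linearCombination]
    congr 1
    ext x
    constructor
    · rintro ⟨w, rfl⟩
      exact ⟨_, toList_length _, (hdeg w.1).symm.trans w.2, rfl⟩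
    · rintro ⟨l, hl, hi, rfl⟩
      obtain ⟨w, rfl⟩ := toList_surj' l hl
      exact ⟨⟨w, (hdeg w).trans hi⟩, rfl⟩
  have hk : LinearMap.ker Ψ = Submodule.span ℚ {x | ∃ l b, x = Finsupp.single b (1 : ℚ) -
        Wd.sgn l k b.1 • Finsupp.single (⟨Wd.sw l k b.1, (hsw l b.1).trans b.2⟩ : {w // deg w = i}) (1 : ℚ)} := by
    apply le_antisymm
    · intro c hc
      have hc : Ψ c = 0 := hc
      let j : {w // deg w = i} → List (Σ n, Λ n) := fun w => Wd.toList w.1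
      have hj : Function.Injective j := fun a b h => Subtype.ext (toList_inj h)
      have h1 : Finsupp.lmapDomain ℚ ℚ j c ∈ RA Λ := by
        have h2 : (RA Λ).mkQ (Finsupp.lmapDomain ℚ ℚ j c) = (rep e (Ψ c)) (wq []) := by
          refine LinearMap.congr_fun (f := (RA Λ).mkQ ∘ₗ Finsupp.lmapDomain ℚ ℚ j)
            (g := LinearMap.applyₗ (wq []) ∘ₗ (rep e).toLinearMap ∘ₗ Ψ) (Finsupp.lhom_ext' fun w => LinearMap.ext_ring ?_) c
          change (RA Λ).mkQ (Finsupp.lmapDomain ℚ ℚ j (Finsupp.single w 1)) = (rep e (Ψ (Finsupp.single w 1))) (wq [])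
          rw [Finsupp.lmapDomain_apply, Finsupp.mapDomain_single, Finsupp.linearCombination_single, one_smul, rep_word]
          rfl
        rw [hc, map_zero, LinearMap.zero_apply] at h2
        exact (Submodule.Quotient.mk_eq_zero _).1 h2
      let π : (List (Σ n, Λ n) →₀ ℚ) →ₗ[ℚ] ({w // deg w = i} →₀ ℚ) := Finsupp.lcomapDomain (R := ℚ) (M := ℚ) j hj
      have hπj : ∀ w, π (Finsupp.single (j w) 1) = Finsupp.single w 1 := by
        intro w
        ext b
        change Finsupp.single (j w) (1 : ℚ) (j b) = _
        rw [Finsupp.single_apply, Finsupp.single_apply]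
        exact if_congr hj.eq_iff rfl rfl
      have hπ0 : ∀ l, (¬ ∃ w, j w = l) → π (Finsupp.single l 1) = 0 := by
        intro l hl
        ext b
        change Finsupp.single l (1 : ℚ) (j b) = _
        rw [Finsupp.single_apply, if_neg]
        · rfl
        · exact fun h => hl ⟨b, h.symm⟩
      have h3 : RA Λ ≤ (Submodule.span ℚ {x | ∃ l b, x = Finsupp.single b (1 : ℚ) -
          Wd.sgn l k b.1 • Finsupp.single (⟨Wd.sw l k b.1, (hsw l b.1).trans b.2⟩ :
            {w // deg w = i}) (1 : ℚ)}).comap π := by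
        refine Submodule.span_le.2 ?_
        rintro _ ⟨u, v, a, b, rfl⟩
        rw [SetLike.mem_coe, Submodule.mem_comap, map_sub, map_smul]
        by_cases h : ∃ w, j w = u ++ a :: b :: v
        · obtain ⟨w, hw⟩ := h
          obtain ⟨h4, h5⟩ := sw_list a b v u k w.1 hw
          rw [← hw, ← h5]
          rw [← h4]
          refine Submodule.subset_span ⟨u.length, w, ?_⟩
          rw [hπj]
          congr 2
          exact hπj ⟨Wd.sw u.length k w.1, _⟩
        · rw [hπ0 _ h, hπ0, smul_zero, sub_zero]
          · exact Submodule.zero_mem _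
          · rintro ⟨w, hw⟩
            obtain ⟨h4, h5⟩ := sw_list b a v u k w.1 hw
            exact h ⟨⟨Wd.sw u.length k w.1, (hsw _ w.1).trans w.2⟩, h4⟩
      have h4 : π (Finsupp.lmapDomain ℚ ℚ j c) = c := by
        ext b
        change Finsupp.mapDomain j c (j b) = _
        exact Finsupp.mapDomain_apply hj _ _
      rw [← h4]
      exact h3 h1
    · rw [Submodule.span_le]
      rintro _ ⟨l, b, rfl⟩
      change Ψ _ = 0
      rw [map_sub, map_smul, Finsupp.linearCombination_single, Finsupp.linearCombination_single, one_smul, one_smul,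
        sw_prod e l k b.1, sub_self]
  exact ⟨((Submodule.quotEquivOfEq _ _ hk.symm).trans Ψ.quotKerEquivRange).trans (LinearEquiv.ofEq _ _ hr)⟩

end alg

/-- Coinvariants of tensor powers are symmetric powers. -/
theorem Tk_coinv (A : SMod) (V : ℕ → Type) [∀ i, AddCommGroup (V i)] [∀ i, Module ℚ (V i)]
    (hV : ∀ j, Nonempty (V j ≃ₗ[ℚ] A.H j)) (k i : ℕ) :
    Nonempty (((Tk A k).H i ⧸ Submodule.span ℚ {x | ∃ (l : ℕ) (y : (Tk A k).H i), x = y - (swp A l k).H i y}) ≃ₗ[ℚ]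
      SymComponent V k i) := by
  obtain ⟨hb⟩ := exists_HB A
  let e : ∀ j, V j ≃ₗ[ℚ] (hb.Λ j →₀ ℚ) := fun j => (hV j).some.trans (hb.homology j).some
  have hsw : ∀ l w, (GBk hb k).deg (Wd.sw l k w) = (GBk hb k).deg w := by
    intro l w
    rw [GBk_deg, GBk_deg, sw_deg]
  obtain ⟨f⟩ := (GBk hb k).coinv (fun l => swp A l k) (fun l => Wd.sw l k) (fun l => Wd.sgn l k)
    (fun l w m => swp_g hb l k w m) hsw i
  obtain ⟨g⟩ := sym_equiv e k i (GBk hb k).deg (GBk_deg hb k) hsw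
  exact ⟨f.trans g⟩

end SMod
end CS

open CategoryTheory
open scoped DirectSum TensorProduct

namespace CS
open SMod

variable {M : Type} [TopologicalSpace M]

/-- Tensor of simplices. -/
noncomputable def ts {n : ℕ} : ∀ (k : ℕ), (Fin k → C(Δ n, M)) → (Tk (Sing M) k).X n
  | 0, _ => (1 : ℚ)
  | k + 1, f => tm (sim (f 0)) (ts k fun i => f i.succ)

lemma ts_map {m n : ℕ} (φ : Fin (m + 1) →o Fin (n + 1)) : ∀ (k : ℕ) (f : Fin k → C(Δ n, M)),
    (Tk (Sing M) k).map φ (ts k f) = ts k (fun i => (f i).comp (smap φ))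
  | 0, _ => rfl
  | k + 1, f => by
    refine (tens_map φ (sim (f 0)) (ts k fun i => f i.succ)).trans ?_
    rw [ts_map φ k, Sing_map_sim]
    rfl

lemma ts_basis (n : ℕ) : ∀ (k : ℕ), ∃ b : Module.Basis (Fin k → C(Δ n, M)) ℚ ((Tk (Sing M) k).X n), ∀ f, b f = ts k f
  | 0 => by
    refine ⟨(Module.Basis.singleton (Fin 0 → C(Δ n, M)) ℚ : Module.Basis _ ℚ ℚ), fun f => ?_⟩
    exact Module.Basis.singleton_apply (Fin 0 → C(Δ n, M)) ℚ f
  | k + 1 => by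
    obtain ⟨b, hb⟩ := ts_basis n k
    let b0 : Module.Basis C(Δ n, M) ℚ ((Sing M).X n) := (Finsupp.basisSingleOne : Module.Basis _ ℚ (C(Δ n, M) →₀ ℚ))
    have hb0 : ∀ s, b0 s = sim s := fun s => by
      exact congrFun Finsupp.coe_basisSingleOne s
    let b1 : Module.Basis (C(Δ n, M) × (Fin k → C(Δ n, M))) ℚ (((Sing M).tens (Tk (Sing M) k)).X n) :=
      b0.tensorProduct b
    refine ⟨b1.reindex (Fin.consEquiv fun _ => C(Δ n, M)), fun f => ?_⟩
    rw [Module.Basis.reindex_apply]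
    refine (Module.Basis.tensorProduct_apply' b0 b _).trans ?_
    rw [hb, hb0]
    rfl

/-- Comparison of products and tensor powers. -/
noncomputable def pwc (M : Type) [TopologicalSpace M] (k : ℕ) : Hom (Sing (Fin k → M)) (Tk (Sing M) k) where
  app n := lin fun s => ts k fun i => (⟨fun f => f i, continuous_apply i⟩ : C(Fin k → M, M)).comp s
  comm {m n} φ x := by
    refine LinearMap.congr_fun (f := (lin fun s => ts k fun i => (⟨fun f => f i, continuous_apply i⟩ : C(Fin k → M, M)).comp s) ∘ₗ (Sing _).map φ)
      (g := (Tk (Sing M) k).map φ ∘ₗ (lin fun s => ts k fun i => (⟨fun f => f i, continuous_apply i⟩ : C(Fin k → M, M)).comp s)) (Sing_hom_ext fun s => ?_) x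
    simp only [LinearMap.comp_apply, Sing_map_sim, lin_sim, ts_map]
    rfl

lemma inc_sim {n k : ℕ} (s : C(Δ n, Fin k → M)) : (pwc M k).app n (sim s) =
    ts k fun i => (⟨fun f => f i, continuous_apply i⟩ : C(Fin k → M, M)).comp s := lin_sim _ _

lemma inc_bij (k n : ℕ) : Function.Bijective ((pwc M k).app n) := by
  obtain ⟨b, hb⟩ := ts_basis (M := M) n k
  let e : C(Δ n, Fin k → M) ≃ (Fin k → C(Δ n, M)) :=
    { toFun := fun s i => (⟨fun f => f i, continuous_apply i⟩ : C(Fin k → M, M)).comp s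
      invFun := fun f => ContinuousMap.pi f
      left_inv := fun s => rfl
      right_inv := fun s => rfl }
  let E : (Sing (Fin k → M)).X n ≃ₗ[ℚ] (Tk (Sing M) k).X n := (Finsupp.domLCongr (R := ℚ) (M := ℚ) e) ≪≫ₗ b.repr.symm
  have : (pwc M k).app n = E.toLinearMap := by
    refine Sing_hom_ext fun s => ?_
    rw [inc_sim]
    refine (hb _).symm.trans ?_
    refine Eq.trans ?_ (congrArg b.repr.symm (Finsupp.domLCongr_single e s (1 : ℚ))).symm
    rw [Module.Basis.repr_symm_single, one_smul]
    rfl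
  rw [this]
  exact E.bijective

/-- Permutation of coordinates. -/
def pm {k : ℕ} (g : Equiv.Perm (Fin k)) : C(Fin k → M, Fin k → M) :=
  ⟨fun f => f ∘ g, continuous_pi fun i => continuous_apply (g i)⟩

/-- Adjacent transpositions. -/
def tsw (l k : ℕ) : Equiv.Perm (Fin k) :=
  if h : l + 1 < k then Equiv.swap ⟨l, by omega⟩ ⟨l + 1, h⟩ else 1

lemma tsw_val (l k : ℕ) (i : Fin k) : (tsw l k i : ℕ) =
    if l + 1 < k then (if (i : ℕ) = l then l + 1 else if (i : ℕ) = l + 1 then l else i) else i := by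
  unfold tsw
  split_ifs with h h1 h2
  · rw [show i = ⟨l, by omega⟩ from Fin.ext h1, Equiv.swap_apply_left]
  · rw [show i = ⟨l + 1, h⟩ from Fin.ext h2, Equiv.swap_apply_right]
  · rw [Equiv.swap_apply_of_ne_of_ne]
    · exact fun h => h1 (congrArg Fin.val h)
    · exact fun h => h2 (congrArg Fin.val h)
  · rfl

lemma ts_swp {n : ℕ} : ∀ (l k : ℕ) (f : Fin k → C(Δ n, M)),
    (swp (Sing M) l k).app n (ts k f) = ts k (fun i => f (tsw l k i))
  | 0, k + 2, f => by
    refine (lc_tm (sim (f 0)) (sim (f (Fin.succ 0))) (ts k fun i => f i.succ.succ)).trans ?_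
    have h0 : tsw 0 (k + 2) 0 = Fin.succ 0 := Fin.ext (by simp [tsw_val])
    have h1 : tsw 0 (k + 2) (Fin.succ 0) = 0 := Fin.ext (by simp [tsw_val])
    have h2 : ∀ i : Fin k, tsw 0 (k + 2) i.succ.succ = i.succ.succ := fun i => Fin.ext (by simp [tsw_val])
    change _ = tm (sim (f (tsw 0 (k + 2) 0))) (tm (sim (f (tsw 0 (k + 2) (Fin.succ 0)))) (ts k fun i => f (tsw 0 (k + 2) i.succ.succ)))
    simp only [h0, h1, h2]
  | 0, 1, f => by
    have : ∀ i, tsw 0 1 i = i := fun i => Subsingleton.elim _ _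
    simp only [this]
    rfl
  | 0, 0, f => rfl
  | l + 1, k + 1, f => by
    refine (tmap_tm (Hom.id (Sing M)) (swp (Sing M) l k) (sim (f 0)) (ts k fun i => f i.succ)).trans ?_
    rw [ts_swp l k]
    have h0 : tsw (l + 1) (k + 1) 0 = 0 := Fin.ext (by simp [tsw_val])
    have h2 : ∀ i : Fin k, tsw (l + 1) (k + 1) i.succ = (tsw l k i).succ := fun i => Fin.ext (by
      simp only [tsw_val, Fin.val_succ]
      split_ifs <;> omega)
    change _ = tm (sim (f (tsw (l + 1) (k + 1) 0))) (ts k fun i => f (tsw (l + 1) (k + 1) i.succ))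
    simp only [h0, h2]
    rfl
  | _ + 1, 0, f => rfl

lemma inc_swp (l k : ℕ) {n : ℕ} (x : (Sing (Fin k → M)).X n) :
    (pwc M k).app n ((push (pm (tsw l k))).app n x) = (swp (Sing M) l k).app n ((pwc M k).app n x) := by
  refine LinearMap.congr_fun (f := (pwc M k).app n ∘ₗ (push (pm (tsw l k))).app n)
    (g := (swp (Sing M) l k).app n ∘ₗ (pwc M k).app n) (Sing_hom_ext fun s => ?_) x
  simp only [LinearMap.comp_apply, push_sim, inc_sim, ts_swp]
  rfl

/-- A degreewise bijective morphism is a homology isomorphism. -/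
lemma SMod.Hom.H_bij {A B : SMod} (f : Hom A B) (hf : ∀ n, Function.Bijective (f.app n)) (n : ℕ) :
    Function.Bijective (f.H n) := by
  constructor
  · rw [← LinearMap.ker_eq_bot, LinearMap.ker_eq_bot']
    intro x hx
    obtain ⟨x, hx', rfl⟩ := A.cls_surj x
    rw [Hom.H_cls, cls_eq_zero] at hx
    obtain ⟨y, hy⟩ := hx
    obtain ⟨y, rfl⟩ := (hf _).2 y
    rw [← f.d] at hy
    exact A.cls_eq_zero.2 ⟨y, (hf _).1 hy⟩
  · intro x
    obtain ⟨x, hx, rfl⟩ := B.cls_surj x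
    obtain ⟨x, rfl⟩ := (hf _).2 x
    refine ⟨A.cls x ((hf _).1 ?_), rfl⟩
    rw [f.dd, hx, map_zero]

lemma push_H_comp {X Y Z : Type} [TopologicalSpace X] [TopologicalSpace Y] [TopologicalSpace Z]
    (g : C(Y, Z)) (f : C(X, Y)) (n : ℕ) (x : (Sing X).H n) :
    (push (g.comp f)).H n x = (push g).H n ((push f).H n x) := by
  obtain ⟨x, hx, rfl⟩ := (Sing X).cls_surj x
  simp only [Hom.H_cls, push_comp]

/-- Coinvariants. -/
noncomputable def coi (M : Type) [TopologicalSpace M] (k i : ℕ) : Submodule ℚ ((Sing (Fin k → M)).H i) :=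
  Submodule.span ℚ {x | ∃ (g : Equiv.Perm (Fin k)) (y : (Sing (Fin k → M)).H i), x = y - (push (pm g)).H i y}

lemma coi_gen (k i : ℕ) : coi M k i =
    Submodule.span ℚ {x | ∃ (l : ℕ) (y : (Sing (Fin k → M)).H i), x = y - (push (pm (tsw l k))).H i y} := by
  apply le_antisymm
  · unfold coi
    rw [Submodule.span_le]
    rintro _ ⟨g, y, rfl⟩
    set S := Submodule.span ℚ {x | ∃ (l : ℕ) (y : (Sing (Fin k → M)).H i), x = y - (push (pm (tsw l k))).H i y}
    change y - (push (pm g)).H i y ∈ S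
    have h1 : ∀ y : (Sing (Fin k → M)).H i, y - (push (pm 1)).H i y ∈ S := by
      intro y
      obtain ⟨x, hx, rfl⟩ := (Sing _).cls_surj y
      have : (push (pm 1)).app i x = x := push_id x
      simp only [Hom.H_cls, this, sub_self]
      exact S.zero_mem
    cases k with
    | zero =>
      rw [Subsingleton.elim g 1]
      exact h1 y
    | succ k =>
      have hg : g ∈ Submonoid.closure (Set.range fun i : Fin k ↦ Equiv.swap i.castSucc i.succ) := by
        rw [Equiv.Perm.mclosure_swap_castSucc_succ]
        trivial
      revert y
      induction hg using Submonoid.closure_induction with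
      | mem g hg =>
        obtain ⟨j, rfl⟩ := hg
        intro y
        refine Submodule.subset_span ⟨j, y, ?_⟩
        have : tsw j (k + 1) = Equiv.swap j.castSucc j.succ := by
          unfold tsw
          rw [dif_pos (by omega)]
          rfl
        rw [this]
      | one => exact h1
      | mul g g' _ _ ih ih' =>
        intro y
        have h2 : (push (pm (g * g'))).H i y = (push (pm g')).H i ((push (pm g)).H i y) := by
          rw [← push_H_comp]
          rfl
        have := S.add_mem (ih y) (ih' ((push (pm g)).H i y))
        rw [h2]
        simpa using this
  · rw [Submodule.span_le]
    rintro _ ⟨l, y, rfl⟩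
    exact Submodule.subset_span ⟨_, y, rfl⟩

/-- Coinvariants of the homology of a power. -/
theorem pow_coinv (V : ℕ → Type) [∀ i, AddCommGroup (V i)] [∀ i, Module ℚ (V i)]
    (hV : ∀ j, Nonempty (V j ≃ₗ[ℚ] (Sing M).H j)) (k i : ℕ) :
    Nonempty (((Sing (Fin k → M)).H i ⧸ coi M k i) ≃ₗ[ℚ] SymComponent V k i) := by
  obtain ⟨e⟩ := Tk_coinv (Sing M) V hV k i
  let f := LinearEquiv.ofBijective ((pwc M k).H i) ((pwc M k).H_bij (inc_bij k) i)
  have hf : ∀ l x, f ((push (pm (tsw l k))).H i x) = (swp (Sing M) l k).H i (f x) := by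
    intro l x
    obtain ⟨x, hx, rfl⟩ := (Sing _).cls_surj x
    change (Tk (Sing M) k).cls _ _ = (Tk (Sing M) k).cls _ _
    congr 1
    exact inc_swp l k x
  refine ⟨(Submodule.Quotient.equiv _ _ f ?_).trans e⟩
  rw [coi_gen, Submodule.map_span]
  congr 1
  ext x
  constructor
  · rintro ⟨_, ⟨l, y, rfl⟩, rfl⟩
    exact ⟨l, f y, by rw [← hf, ← map_sub]; rfl⟩
  · rintro ⟨l, y, rfl⟩
    refine ⟨_, ⟨l, f.symm y, rfl⟩, ?_⟩
    change f _ = _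
    rw [map_sub, hf, f.apply_symm_apply]

end CS

open CategoryTheory
open scoped DirectSum TensorProduct

namespace CS
open SMod

/-- Tuples of points. -/
noncomputable def Tup (P : Type) : SMod where
  X m := (Fin (m + 1) → P) →₀ ℚ
  map f := Finsupp.lmapDomain ℚ ℚ (fun v => v ∘ f)
  map_id n x := Finsupp.mapDomain_id
  map_comp f g x := by
    simp only [Finsupp.lmapDomain_apply]
    rw [← Finsupp.mapDomain_comp]
    rfl

section Tup
variable {P Q : Type}

/-- Basis tuples. -/
noncomputable def tp {m : ℕ} (v : Fin (m + 1) → P) : (Tup P).X m := Finsupp.single v 1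

lemma Tup_map {m n : ℕ} (f : Fin (m + 1) →o Fin (n + 1)) (v : Fin (n + 1) → P) :
    (Tup P).map f (tp v) = tp (v ∘ f) := Finsupp.mapDomain_single

lemma Tup_ext {n : ℕ} {V : Type} [AddCommGroup V] [Module ℚ V] {f g : (Tup P).X n →ₗ[ℚ] V}
    (h : ∀ s, f (tp s) = g (tp s)) : f = g := by
  refine Finsupp.lhom_ext' fun s => LinearMap.ext_ring ?_
  exact h s

/-- Linear extension. -/
noncomputable def tlin {n : ℕ} {V : Type} [AddCommGroup V] [Module ℚ V] (f : (Fin (n + 1) → P) → V) :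
    (Tup P).X n →ₗ[ℚ] V := Finsupp.linearCombination ℚ f

@[simp] lemma tlin_tp {n : ℕ} {V : Type} [AddCommGroup V] [Module ℚ V] (f : (Fin (n + 1) → P) → V) (s : Fin (n + 1) → P) :
    tlin f (tp s) = f s := by
  exact (Finsupp.linearCombination_single ℚ 1 s).trans (one_smul _ _)

/-- Functoriality. -/
noncomputable def tpush (f : P → Q) : SMod.Hom (Tup P) (Tup Q) where
  app n := tlin fun s => tp (f ∘ s)
  comm g x := by
    refine LinearMap.congr_fun (f := (tlin fun s => tp (f ∘ s)) ∘ₗ (Tup P).map g)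
      (g := (Tup Q).map g ∘ₗ (tlin fun s => tp (f ∘ s))) (Tup_ext fun s => ?_) x
    simp only [LinearMap.comp_apply, Tup_map, tlin_tp]
    rfl

@[simp] lemma tpush_tp (f : P → Q) {n : ℕ} (s : Fin (n + 1) → P) : (tpush f).app n (tp s) = tp (f ∘ s) := tlin_tp _ _

/-- Cones. -/
noncomputable def cone (b : P) (m : ℕ) : (Tup P).X m →ₗ[ℚ] (Tup P).X (m + 1) :=
  tlin fun v => tp (Matrix.vecCons b v)

@[simp] lemma cone_tp (b : P) {m : ℕ} (v : Fin (m + 1) → P) : cone b m (tp v) = tp (Matrix.vecCons b v) := tlin_tp _ _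

lemma d_tp {m : ℕ} (v : Fin (m + 2) → P) :
    (Tup P).d m (tp v) = ∑ i : Fin (m + 2), ((-1 : ℚ) ^ (i : ℕ)) • tp (v ∘ i.succAbove) := by
  rw [d_apply]
  refine Finset.sum_congr rfl fun i _ => ?_
  rw [Tup_map]
  rfl

lemma vecCons_zero (b : P) {m : ℕ} (v : Fin (m + 1) → P) :
    (Matrix.vecCons b v) ∘ (Fin.succAbove 0) = v := by
  funext i
  simp

lemma d_cone (b : P) (m : ℕ) (x : (Tup P).X (m + 1)) :
    (Tup P).d (m + 1) (cone b (m + 1) x) = x - cone b m ((Tup P).d m x) := by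
  refine LinearMap.congr_fun (f := (Tup P).d (m + 1) ∘ₗ cone b (m + 1))
    (g := LinearMap.id - cone b m ∘ₗ (Tup P).d m) (Tup_ext fun v => ?_) x
  simp only [LinearMap.comp_apply, LinearMap.sub_apply, LinearMap.id_apply, cone_tp, d_tp, map_sum, map_smul]
  rw [Fin.sum_univ_succ, vecCons_zero, Fin.val_zero, pow_zero, one_smul, sub_eq_add_neg, ← Finset.sum_neg_distrib]
  congr 1
  refine Finset.sum_congr rfl fun i _ => ?_
  rw [Fin.val_succ, pow_succ, mul_neg_one, neg_smul]
  congr 3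
  funext j
  refine Fin.cases ?_ (fun j => ?_) j
  · simp
  · simp

/-- Augmentation. -/
noncomputable def taug (P : Type) : (Tup P).X 0 →ₗ[ℚ] ℚ := tlin fun _ => 1

lemma d_cone_zero (b : P) (x : (Tup P).X 0) :
    (Tup P).d 0 (cone b 0 x) = x - taug P x • tp (fun _ => b) := by
  refine LinearMap.congr_fun (f := (Tup P).d 0 ∘ₗ cone b 0)
    (g := LinearMap.id - (taug P).smulRight (tp fun _ => b)) (Tup_ext fun v => ?_) x
  simp only [LinearMap.comp_apply, LinearMap.sub_apply, LinearMap.id_apply, cone_tp, d_tp, LinearMap.smulRight_apply]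
  rw [Fin.sum_univ_two, vecCons_zero, taug, tlin_tp, Fin.val_zero, pow_zero, one_smul, sub_eq_add_neg, Fin.val_one, pow_one, one_smul, neg_smul, one_smul]
  congr 3
  funext j
  obtain rfl : j = 0 := Fin.ext (by omega)
  rfl

lemma taug_d (x : (Tup P).X 1) : taug P ((Tup P).d 0 x) = 0 := by
  refine LinearMap.congr_fun (f := taug P ∘ₗ (Tup P).d 0) (g := 0) (Tup_ext fun v => ?_) x
  simp [d_tp, taug]

variable (bary : ∀ m, (Fin (m + 1) → P) → P)

/-- Subdivision of tuples. -/
noncomputable def SD : ∀ m, (Tup P).X m →ₗ[ℚ] (Tup P).X m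
  | 0 => LinearMap.id
  | m + 1 => tlin fun v => cone (bary _ v) m (SD m ((Tup P).d m (tp v)))

lemma SD_succ {m : ℕ} (v : Fin (m + 2) → P) :
    SD bary (m + 1) (tp v) = cone (bary _ v) m (SD bary m ((Tup P).d m (tp v))) := tlin_tp _ _

/-- Homotopy for subdivision. -/
noncomputable def TT : ∀ m, (Tup P).X m →ₗ[ℚ] (Tup P).X (m + 1)
  | 0 => 0
  | m + 1 => tlin fun v => cone (bary _ v) (m + 1) (tp v - TT m ((Tup P).d m (tp v)))

lemma TT_succ {m : ℕ} (v : Fin (m + 2) → P) :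
    TT bary (m + 1) (tp v) = cone (bary _ v) (m + 1) (tp v - TT bary m ((Tup P).d m (tp v))) := tlin_tp _ _

lemma d_SD : ∀ (m : ℕ) (x : (Tup P).X (m + 1)), (Tup P).d m (SD bary (m + 1) x) = SD bary m ((Tup P).d m x)
  | 0, x => by
    refine LinearMap.congr_fun (f := (Tup P).d 0 ∘ₗ SD bary 1) (g := SD bary 0 ∘ₗ (Tup P).d 0) (Tup_ext fun v => ?_) x
    rw [LinearMap.comp_apply, SD_succ, d_cone_zero]
    change _ - taug P ((Tup P).d 0 (tp v)) • _ = _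
    rw [taug_d, zero_smul, sub_zero]
    rfl
  | m + 1, x => by
    refine LinearMap.congr_fun (f := (Tup P).d (m + 1) ∘ₗ SD bary (m + 2)) (g := SD bary (m + 1) ∘ₗ (Tup P).d (m + 1)) (Tup_ext fun v => ?_) x
    rw [LinearMap.comp_apply, SD_succ, d_cone, d_SD m, SMod.d_d, map_zero, map_zero, sub_zero]
    rfl

lemma d_TT : ∀ (m : ℕ) (x : (Tup P).X (m + 1)),
    (Tup P).d (m + 1) (TT bary (m + 1) x) + TT bary m ((Tup P).d m x) = x - SD bary (m + 1) x := by
  intro m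
  induction m with
  | zero =>
    intro x
    refine LinearMap.congr_fun (f := (Tup P).d 1 ∘ₗ TT bary 1 + TT bary 0 ∘ₗ (Tup P).d 0) (g := LinearMap.id - SD bary 1) (Tup_ext fun v => ?_) x
    simp only [LinearMap.comp_apply, LinearMap.add_apply, LinearMap.sub_apply, LinearMap.id_apply]
    rw [TT_succ, d_cone, map_sub, SD_succ]
    simp only [TT, SD, LinearMap.zero_apply, map_zero, sub_zero, add_zero, LinearMap.id_apply]
  | succ m ih =>
    intro x
    refine LinearMap.congr_fun (f := (Tup P).d (m + 2) ∘ₗ TT bary (m + 2) + TT bary (m + 1) ∘ₗ (Tup P).d (m + 1)) (g := LinearMap.id - SD bary (m + 2)) (Tup_ext fun v => ?_) x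
    simp only [LinearMap.comp_apply, LinearMap.add_apply, LinearMap.sub_apply, LinearMap.id_apply]
    have h := ih ((Tup P).d (m + 1) (tp v))
    rw [SMod.d_d, map_zero, add_zero] at h
    rw [TT_succ, d_cone, map_sub, SD_succ, h]
    abel_nf

lemma SD_nat {bary : ∀ m, (Fin (m + 1) → P) → P} {bary' : ∀ m, (Fin (m + 1) → Q) → Q} (f : P → Q) (hf : ∀ m v, f (bary m v) = bary' m (f ∘ v)) :
    ∀ (m : ℕ) (x : (Tup P).X m), (tpush f).app m (SD bary m x) = SD bary' m ((tpush f).app m x)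
  | 0, x => rfl
  | m + 1, x => by
    refine LinearMap.congr_fun (f := (tpush f).app (m + 1) ∘ₗ SD bary (m + 1)) (g := SD bary' (m + 1) ∘ₗ (tpush f).app (m + 1)) (Tup_ext fun v => ?_) x
    have hc : ∀ b y, (tpush f).app (m + 1) (cone b m y) = cone (f b) m ((tpush f).app m y) := by
      intro b y
      refine LinearMap.congr_fun (f := (tpush f).app (m + 1) ∘ₗ cone b m) (g := cone (f b) m ∘ₗ (tpush f).app m) (Tup_ext fun v => ?_) y
      simp only [LinearMap.comp_apply, cone_tp, tpush_tp]
      congr 1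
      funext j
      refine Fin.cases ?_ (fun j => ?_) j <;> rfl
    simp only [LinearMap.comp_apply, tpush_tp, SD_succ, hc, hf]
    rw [SD_nat f hf m, (tpush f).d, tpush_tp]

lemma TT_nat {bary : ∀ m, (Fin (m + 1) → P) → P} {bary' : ∀ m, (Fin (m + 1) → Q) → Q} (f : P → Q) (hf : ∀ m v, f (bary m v) = bary' m (f ∘ v)) :
    ∀ (m : ℕ) (x : (Tup P).X m), (tpush f).app (m + 1) (TT bary m x) = TT bary' m ((tpush f).app m x)
  | 0, x => by
    change (tpush f).app 1 0 = 0
    rw [map_zero]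
  | m + 1, x => by
    refine LinearMap.congr_fun (f := (tpush f).app (m + 2) ∘ₗ TT bary (m + 1)) (g := TT bary' (m + 1) ∘ₗ (tpush f).app (m + 1)) (Tup_ext fun v => ?_) x
    have hc : ∀ b y, (tpush f).app (m + 2) (cone b (m + 1) y) = cone (f b) (m + 1) ((tpush f).app (m + 1) y) := by
      intro b y
      refine LinearMap.congr_fun (f := (tpush f).app (m + 2) ∘ₗ cone b (m + 1)) (g := cone (f b) (m + 1) ∘ₗ (tpush f).app (m + 1)) (Tup_ext fun v => ?_) y
      simp only [LinearMap.comp_apply, cone_tp, tpush_tp]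
      congr 1
      funext j
      refine Fin.cases ?_ (fun j => ?_) j <;> rfl
    simp only [LinearMap.comp_apply, tpush_tp, TT_succ, hc, hf, map_sub]
    rw [TT_nat f hf m, (tpush f).d, tpush_tp]

end Tup

end CS

open CategoryTheory
open scoped DirectSum TensorProduct

namespace CS
open SMod

/-- Affine combination of points of a simplex. -/
noncomputable def cpt {m n : ℕ} (v : Fin (m + 1) → Δ n) (t : Δ m) : Δ n :=
  ⟨∑ i, t i • (v i : Fin (n + 1) → ℝ),
    (convex_stdSimplex ℝ (Fin (n + 1))).sum_mem (fun i _ => stdSimplex.zero_le t i) (stdSimplex.sum_eq_one t)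
      (fun i _ => (v i).2)⟩

lemma cpt_val {m n : ℕ} (v : Fin (m + 1) → Δ n) (t : Δ m) : (cpt v t).1 = ∑ i, t.1 i • (v i).1 := rfl

/-- Affine simplex. -/
noncomputable def comb {m n : ℕ} (v : Fin (m + 1) → Δ n) : C(Δ m, Δ n) where
  toFun := cpt v
  continuous_toFun := by
    refine Continuous.subtype_mk (continuous_finsetSum _ fun i _ => ?_) _
    exact ((continuous_apply i).comp continuous_subtype_val).smul continuous_const

lemma comb_smap {l m n : ℕ} (v : Fin (m + 1) → Δ n) (f : Fin (l + 1) →o Fin (m + 1)) :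
    (comb v).comp (smap f) = comb (v ∘ f) := by
  ext1 t
  apply Subtype.ext
  change ∑ i, (stdSimplex.map f t) i • (v i).1 = ∑ i, t.1 i • (v (f i)).1
  classical
  rw [← Finset.sum_fiberwise Finset.univ f]
  refine Finset.sum_congr rfl fun i _ => ?_
  rw [stdSimplex.map_coe, FunOnFinite.linearMap_apply_apply, Finset.sum_smul]
  refine Finset.sum_congr rfl fun j hj => ?_
  simp only [Finset.mem_filter] at hj
  rw [hj.2]
  rfl

lemma comb_comb {l m n : ℕ} (v : Fin (m + 1) → Δ n) (w : Fin (l + 1) → Δ m) :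
    (comb v).comp (comb w) = comb (comb v ∘ w) := by
  ext1 t
  apply Subtype.ext
  change ∑ i, (∑ j, t.1 j • (w j).1) i • (v i).1 = ∑ j, t.1 j • (∑ i, (w j).1 i • (v i).1)
  simp only [Finset.sum_apply, Finset.sum_smul, Finset.smul_sum, Pi.smul_apply, smul_smul, smul_eq_mul]
  rw [Finset.sum_comm]

/-- Barycentre of the simplex. -/
noncomputable def ctrd (m : ℕ) : Δ m := ⟨fun _ => ((m : ℝ) + 1)⁻¹, fun _ => by positivity, by
  simp only [Finset.sum_const, Finset.card_univ, Fintype.card_fin, nsmul_eq_mul]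
  push_cast
  exact mul_inv_cancel₀ (by positivity)⟩

/-- Barycentres. -/
noncomputable def bry (n m : ℕ) (v : Fin (m + 1) → Δ n) : Δ n := comb v (ctrd m)

lemma bry_nat {m n l : ℕ} (v : Fin (m + 1) → Δ n) (w : Fin (l + 1) → Δ m) :
    comb v (bry m l w) = bry n l (comb v ∘ w) := by
  change ((comb v).comp (comb w)) _ = _
  rw [comb_comb]
  rfl

/-- Vertices of the simplex. -/
noncomputable def vtx (n : ℕ) (i : Fin (n + 1)) : Δ n := stdSimplex.vertex i

lemma comb_vtx {n : ℕ} : comb (vtx n) = ContinuousMap.id _ := by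
  ext1 t
  apply Subtype.ext
  funext j
  change (∑ i, t.1 i • (Pi.single i 1 : Fin (n + 1) → ℝ)) j = t.1 j
  simp [Finset.sum_apply, Pi.single_apply]

lemma comb_comp_vtx {m n : ℕ} (v : Fin (m + 1) → Δ n) : comb v ∘ vtx m = v := by
  funext j
  apply Subtype.ext
  change (∑ i, (Pi.single j 1 : Fin (m + 1) → ℝ) i • (v i).1) = (v j).1
  simp [Pi.single_apply]

lemma smap_comp_vtx {m n : ℕ} (f : Fin (m + 1) →o Fin (n + 1)) : smap f ∘ vtx m = vtx n ∘ f := by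
  rw [← comb_comp_vtx (vtx n ∘ f), ← comb_smap, comb_vtx]
  rfl

/-- Realization. -/
noncomputable def rl (n : ℕ) : Hom (Tup (Δ n)) (Sing (Δ n)) where
  app m := tlin fun v => sim (comb v)
  comm g x := by
    refine LinearMap.congr_fun (f := (tlin fun v => sim (comb v)) ∘ₗ (Tup (Δ n)).map g)
      (g := (Sing (Δ n)).map g ∘ₗ (tlin fun v => sim (comb v))) (Tup_ext fun s => ?_) x
    simp only [LinearMap.comp_apply, Tup_map, tlin_tp, Sing_map_sim, comb_smap]

@[simp] lemma rl_tp {n m : ℕ} (v : Fin (m + 1) → Δ n) : (rl n).app m (tp v) = sim (comb v) := tlin_tp _ _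

lemma rl_nat {m n l : ℕ} (v : Fin (m + 1) → Δ n) (x : (Tup (Δ m)).X l) :
    (push (comb v)).app l ((rl m).app l x) = (rl n).app l ((tpush (comb v)).app l x) := by
  refine LinearMap.congr_fun (f := (push (comb v)).app l ∘ₗ (rl m).app l)
    (g := (rl n).app l ∘ₗ (tpush (comb v)).app l) (Tup_ext fun s => ?_) x
  simp only [LinearMap.comp_apply, rl_tp, push_sim, tpush_tp, comb_comb]

section ops
variable {X Y : Type} [TopologicalSpace X] [TopologicalSpace Y]

/-- Realization in a space. -/
noncomputable def rls {n : ℕ} (s : C(Δ n, X)) : Hom (Tup (Δ n)) (Sing X) := (push s).comp (rl n)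

lemma rls_tp {n m : ℕ} (s : C(Δ n, X)) (v : Fin (m + 1) → Δ n) : (rls s).app m (tp v) = sim (s.comp (comb v)) := by
  change (push s).app m ((rl n).app m (tp v)) = _
  rw [rl_tp, push_sim]

lemma rls_comb {n m l : ℕ} (s : C(Δ n, X)) (v : Fin (m + 1) → Δ n) (x : (Tup (Δ m)).X l) :
    (rls (s.comp (comb v))).app l x = (rls s).app l ((tpush (comb v)).app l x) := by
  change (push _).app l ((rl m).app l x) = (push _).app l ((rl n).app l _)
  rw [push_comp, rl_nat]

lemma rls_push {n l : ℕ} (f : C(X, Y)) (s : C(Δ n, X)) (x : (Tup (Δ n)).X l) :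
    (push f).app l ((rls s).app l x) = (rls (f.comp s)).app l x := by
  change (push f).app l ((push _).app l _) = (push _).app l _
  rw [push_comp]

/-- Subdivision. -/
noncomputable def sd (X : Type) [TopologicalSpace X] (n : ℕ) : (Sing X).X n →ₗ[ℚ] (Sing X).X n :=
  lin fun s => (rls s).app n (SD (bry n) n (tp (vtx n)))

/-- Homotopy. -/
noncomputable def sT (X : Type) [TopologicalSpace X] (n : ℕ) : (Sing X).X n →ₗ[ℚ] (Sing X).X (n + 1) :=
  lin fun s => (rls s).app (n + 1) (TT (bry n) n (tp (vtx n)))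

lemma sd_sim {n : ℕ} (s : C(Δ n, X)) : sd X n (sim s) = (rls s).app n (SD (bry n) n (tp (vtx n))) := lin_sim _ _
lemma sT_sim {n : ℕ} (s : C(Δ n, X)) : sT X n (sim s) = (rls s).app (n + 1) (TT (bry n) n (tp (vtx n))) := lin_sim _ _

lemma sd_rls {n m : ℕ} (s : C(Δ n, X)) (x : (Tup (Δ n)).X m) :
    sd X m ((rls s).app m x) = (rls s).app m (SD (bry n) m x) := by
  refine LinearMap.congr_fun (f := sd X m ∘ₗ (rls s).app m)
    (g := (rls s).app m ∘ₗ SD (bry n) m) (Tup_ext fun v => ?_) x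
  simp only [LinearMap.comp_apply, rls_tp, sd_sim, rls_comb]
  rw [SD_nat (bary' := bry n) (comb v) (fun _ w => bry_nat v w), tpush_tp, comb_comp_vtx]

lemma sT_rls {n m : ℕ} (s : C(Δ n, X)) (x : (Tup (Δ n)).X m) :
    sT X m ((rls s).app m x) = (rls s).app (m + 1) (TT (bry n) m x) := by
  refine LinearMap.congr_fun (f := sT X m ∘ₗ (rls s).app m)
    (g := (rls s).app (m + 1) ∘ₗ TT (bry n) m) (Tup_ext fun v => ?_) x
  simp only [LinearMap.comp_apply, rls_tp, sT_sim, rls_comb]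
  rw [TT_nat (bary' := bry n) (comb v) (fun _ w => bry_nat v w), tpush_tp, comb_comp_vtx]

lemma sim_eq_rls {n : ℕ} (s : C(Δ n, X)) : sim s = (rls s).app n (tp (vtx n)) := by
  rw [rls_tp, comb_vtx]
  rfl

lemma d_sd (n : ℕ) (x : (Sing X).X (n + 1)) : (Sing X).d n (sd X (n + 1) x) = sd X n ((Sing X).d n x) := by
  refine LinearMap.congr_fun (f := (Sing X).d n ∘ₗ sd X (n + 1)) (g := sd X n ∘ₗ (Sing X).d n) (Sing_hom_ext fun s => ?_) x
  simp only [LinearMap.comp_apply]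
  rw [sim_eq_rls, sd_rls, ← (rls s).d, ← (rls s).d, sd_rls, d_SD]

lemma d_sT (n : ℕ) (x : (Sing X).X (n + 1)) :
    (Sing X).d (n + 1) (sT X (n + 1) x) + sT X n ((Sing X).d n x) = x - sd X (n + 1) x := by
  refine LinearMap.congr_fun (f := (Sing X).d (n + 1) ∘ₗ sT X (n + 1) + sT X n ∘ₗ (Sing X).d n)
    (g := LinearMap.id - sd X (n + 1)) (Sing_hom_ext fun s => ?_) x
  simp only [LinearMap.comp_apply, LinearMap.add_apply, LinearMap.sub_apply, LinearMap.id_apply]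
  rw [sim_eq_rls, sd_rls, sT_rls, ← (rls s).d, ← (rls s).d, sT_rls, ← map_sub, ← map_add, d_TT]

lemma sd_zero (x : (Sing X).X 0) : sd X 0 x = x := by
  refine LinearMap.congr_fun (g := LinearMap.id) (Sing_hom_ext fun s => ?_) x
  rw [sim_eq_rls, sd_rls]
  rfl

lemma sd_push (f : C(X, Y)) {n : ℕ} (x : (Sing X).X n) : (push f).app n (sd X n x) = sd Y n ((push f).app n x) := by
  refine LinearMap.congr_fun (f := (push f).app n ∘ₗ sd X n) (g := sd Y n ∘ₗ (push f).app n) (Sing_hom_ext fun s => ?_) x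
  simp only [LinearMap.comp_apply, push_sim, sd_sim, rls_push]

/-- Chains in a subset. -/
noncomputable def sub (S : Set X) (n : ℕ) : Submodule ℚ ((Sing X).X n) :=
  (Finsupp.supported ℚ ℚ {s : C(Δ n, X) | Set.range s ⊆ S} : Submodule ℚ (C(Δ n, X) →₀ ℚ))

lemma sim_mem_sub {S : Set X} {n : ℕ} {s : C(Δ n, X)} (h : Set.range s ⊆ S) : sim s ∈ sub S n :=
  Finsupp.single_mem_supported ℚ _ h

lemma sub_eq_span (S : Set X) (n : ℕ) : sub S n = Submodule.span ℚ (sim '' {s : C(Δ n, X) | Set.range s ⊆ S}) :=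
  Finsupp.supported_eq_span_single ℚ _

lemma sub_le {S : Set X} {n : ℕ} {W : Type} [AddCommGroup W] [Module ℚ W] {f : (Sing X).X n →ₗ[ℚ] W} {p : Submodule ℚ W}
    (h : ∀ s : C(Δ n, X), Set.range s ⊆ S → f (sim s) ∈ p) {x : (Sing X).X n} (hx : x ∈ sub S n) : f x ∈ p := by
  have : sub S n ≤ p.comap f := by
    rw [sub_eq_span, Submodule.span_le]
    rintro _ ⟨s, hs, rfl⟩
    exact h s hs
  exact this hx

lemma sub_mono {S T : Set X} (h : S ⊆ T) {n : ℕ} : sub S n ≤ sub T n :=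
  Finsupp.supported_mono fun _ hs => hs.trans h

lemma sub_inter (S T : Set X) (n : ℕ) : sub (S ∩ T) n = sub S n ⊓ sub T n := by
  refine Eq.trans ?_ (Finsupp.supported_inter {s : C(Δ n, X) | Set.range s ⊆ S} {s : C(Δ n, X) | Set.range s ⊆ T})
  unfold sub
  congr 1
  ext s
  exact Set.subset_inter_iff

lemma mem_sub_inter {S T : Set X} {n : ℕ} {x : (Sing X).X n} (h1 : x ∈ sub S n) (h2 : x ∈ sub T n) : x ∈ sub (S ∩ T) n := by
  rw [sub_inter]
  exact ⟨h1, h2⟩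

lemma sub_univ {n : ℕ} (x : (Sing X).X n) : x ∈ sub (Set.univ : Set X) n := fun _ _ => Set.subset_univ _

lemma push_sub {f : C(X, Y)} {S : Set X} {T : Set Y} (h : ∀ x ∈ S, f x ∈ T) {n : ℕ} {x : (Sing X).X n} (hx : x ∈ sub S n) :
    (push f).app n x ∈ sub T n := by
  refine sub_le (fun s hs => ?_) hx
  rw [push_sim]
  refine sim_mem_sub ?_
  rintro _ ⟨p, rfl⟩
  exact h _ (hs ⟨p, rfl⟩)

lemma d_sub {S : Set X} {n : ℕ} {x : (Sing X).X (n + 1)} (hx : x ∈ sub S (n + 1)) : (Sing X).d n x ∈ sub S n := by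
  refine sub_le (fun s hs => ?_) hx
  rw [d_apply]
  refine Submodule.sum_mem _ fun i _ => Submodule.smul_mem _ _ ?_
  rw [Sing_map_sim]
  refine sim_mem_sub ?_
  rintro _ ⟨p, rfl⟩
  exact hs ⟨_, rfl⟩

lemma rls_sub {S : Set X} {n m : ℕ} {s : C(Δ n, X)} (hs : Set.range s ⊆ S) (x : (Tup (Δ n)).X m) :
    (rls s).app m x ∈ sub S m := by
  change (push s).app m ((rl n).app m x) ∈ _
  exact push_sub (S := Set.univ) (fun p _ => hs ⟨p, rfl⟩) (sub_univ _)

lemma sd_sub {S : Set X} {n : ℕ} {x : (Sing X).X n} (hx : x ∈ sub S n) : sd X n x ∈ sub S n := by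
  refine sub_le (fun s hs => ?_) hx
  rw [sd_sim]
  exact rls_sub hs _

lemma sT_sub {S : Set X} {n : ℕ} {x : (Sing X).X n} (hx : x ∈ sub S n) : sT X n x ∈ sub S (n + 1) := by
  refine sub_le (fun s hs => ?_) hx
  rw [sT_sim]
  exact rls_sub hs _

end ops

end CS

open CategoryTheory
open scoped DirectSum TensorProduct

namespace CS
open SMod

/-- Tuples with a property. -/
noncomputable def tsub {P : Type} {m : ℕ} (p : (Fin (m + 1) → P) → Prop) : Submodule ℚ ((Tup P).X m) :=
  (Finsupp.supported ℚ ℚ {v : Fin (m + 1) → P | p v} : Submodule ℚ ((Fin (m + 1) → P) →₀ ℚ))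

lemma tp_mem {P : Type} {m : ℕ} {p : (Fin (m + 1) → P) → Prop} {v : Fin (m + 1) → P} (h : p v) : tp v ∈ tsub p :=
  Finsupp.single_mem_supported ℚ _ h

lemma tsub_le {P : Type} {m : ℕ} {p : (Fin (m + 1) → P) → Prop} {W : Type} [AddCommGroup W] [Module ℚ W]
    {f : (Tup P).X m →ₗ[ℚ] W} {q : Submodule ℚ W}
    (h : ∀ v, p v → f (tp v) ∈ q) {x : (Tup P).X m} (hx : x ∈ tsub p) : f x ∈ q := by
  have e : tsub p = Submodule.span ℚ (tp '' {v | p v}) := Finsupp.supported_eq_span_single ℚ _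
  have : tsub p ≤ q.comap f := by
    rw [e, Submodule.span_le]
    rintro _ ⟨s, hs, rfl⟩
    exact h s hs
  exact this hx

lemma dist_comb_le {m n : ℕ} (v : Fin (m + 1) → Δ n) (b : Δ n) (D : ℝ) (h : ∀ j, dist (v j) b ≤ D) (t : Δ m) :
    dist (comb v t) b ≤ D := by
  have := (convex_closedBall (b : Fin (n + 1) → ℝ) D).sum_mem (t := Finset.univ) (fun i _ => stdSimplex.zero_le t i) (stdSimplex.sum_eq_one t)
      (z := fun i => (v i : Fin (n + 1) → ℝ)) (fun i _ => Metric.mem_closedBall.2 (h i))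
  exact Metric.mem_closedBall.1 this

lemma dist_bry_le {m n : ℕ} (v : Fin (m + 1) → Δ n) (D : ℝ) (h : ∀ i j, dist (v i) (v j) ≤ D) (j : Fin (m + 1)) :
    dist (v j) (bry n m v) ≤ m / (m + 1) * D := by
  have e : (v j).1 - (bry n m v).1 = ∑ i, ((m : ℝ) + 1)⁻¹ • ((v j).1 - (v i).1) := by
    change _ - ∑ i, ((m : ℝ) + 1)⁻¹ • (v i).1 = _
    simp only [smul_sub, Finset.sum_sub_distrib]
    congr 1
    rw [Finset.sum_const, Finset.card_univ, Fintype.card_fin, ← Nat.cast_smul_eq_nsmul ℝ, smul_smul]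
    push_cast
    rw [mul_inv_cancel₀ (by positivity), one_smul]
  have : dist (v j) (bry n m v) = ‖(v j).1 - (bry n m v).1‖ := by
    rw [Subtype.dist_eq, dist_eq_norm]
  rw [this, e]
  refine (norm_sum_le _ _).trans ?_
  rw [← Finset.add_sum_erase _ _ (Finset.mem_univ j)]
  simp only [sub_self, smul_zero, norm_zero, zero_add]
  refine (Finset.sum_le_card_nsmul _ _ (((m : ℝ) + 1)⁻¹ * D) fun i _ => ?_).trans ?_
  · rw [norm_smul, norm_inv, Real.norm_of_nonneg (by positivity)]
    have := h j i
    rw [Subtype.dist_eq, dist_eq_norm] at this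
    gcongr
  · rw [Finset.card_erase_of_mem (Finset.mem_univ j), Finset.card_univ, Fintype.card_fin]
    simp only [add_tsub_cancel_right, nsmul_eq_mul]
    apply le_of_eq
    field_simp

lemma SD_mesh (n : ℕ) : ∀ (m : ℕ) (v : Fin (m + 1) → Δ n) (D : ℝ), (∀ i j, dist (v i) (v j) ≤ D) →
    SD (bry n) m (tp v) ∈ tsub (fun w : Fin (m + 1) → Δ n =>
      (∀ i j, dist (w i) (w j) ≤ m / (m + 1) * D) ∧ ∀ j, w j ∈ Set.range (comb v))
  | 0, v, D, h => by
    refine tp_mem ⟨fun i j => ?_, fun j => ⟨vtx 0 j, congrFun (comb_comp_vtx v) j⟩⟩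
    obtain rfl : i = j := Fin.ext (by omega)
    simp
  | m + 1, v, D, h => by
    have hD : 0 ≤ D := dist_nonneg.trans (h 0 0)
    rw [SD_succ, d_tp, map_sum, map_sum]
    refine Submodule.sum_mem _ fun i _ => ?_
    rw [map_smul, map_smul]
    refine Submodule.smul_mem _ _ ?_
    refine tsub_le (fun w hw => ?_) (SD_mesh n m (v ∘ i.succAbove) D fun a b => h _ _)
    rw [cone_tp]
    have hr : ∀ j, w j ∈ Set.range (comb v) := by
      intro j
      obtain ⟨t, ht⟩ := hw.2 j
      refine ⟨smap (δ i) t, ?_⟩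
      rw [← ht]
      exact congrFun (congrArg DFunLike.coe (comb_smap v (δ i))) t
    have hb : ∀ j, dist (w j) (bry n (m + 1) v) ≤ ((m + 1 : ℕ) : ℝ) / ((m + 1 : ℕ) + 1) * D := by
      intro j
      obtain ⟨t, ht⟩ := hr j
      rw [← ht]
      exact dist_comb_le _ _ _ (dist_bry_le v D h) t
    refine tp_mem ⟨fun a b => ?_, fun a => ?_⟩
    · refine Fin.cases ?_ (fun a => ?_) a
      · refine Fin.cases ?_ (fun b => ?_) b
        · simp only [dist_self]
          positivity
        · rw [dist_comm]
          exact hb b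
      · refine Fin.cases ?_ (fun b => ?_) b
        · exact hb a
        · refine (hw.1 a b).trans ?_
          refine mul_le_mul_of_nonneg_right ?_ hD
          rw [div_le_div_iff₀ (by positivity) (by positivity)]
          push_cast
          nlinarith
    · refine Fin.cases ?_ (fun a => ?_) a
      · exact ⟨ctrd _, rfl⟩
      · exact hr a

lemma SD_mesh_iter (n : ℕ) (D : ℝ) (hD : ∀ i j, dist (vtx n i) (vtx n j) ≤ D) (r : ℕ) :
    (SD (bry n) n ^ r) (tp (vtx n)) ∈ tsub (fun w : Fin (n + 1) → Δ n =>
      (∀ i j, dist (w i) (w j) ≤ ((n : ℝ) / (n + 1)) ^ r * D)) := by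
  induction r with
  | zero =>
    refine tp_mem fun i j => ?_
    rw [pow_zero, one_mul]
    exact hD i j
  | succ r ih =>
    rw [pow_succ' (SD (bry n) n), Module.End.mul_apply]
    refine tsub_le (fun w hw => ?_) ih
    refine Finsupp.supported_mono (fun u hu => ?_) (SD_mesh n n w _ hw)
    intro i j
    rw [pow_succ', mul_assoc]
    exact hu.1 i j

section small
variable {X Y : Type} [TopologicalSpace X] [TopologicalSpace Y]

lemma sd_pow_rls {n : ℕ} (s : C(Δ n, X)) (r : ℕ) (x : (Tup (Δ n)).X n) :
    (sd X n ^ r) ((rls s).app n x) = (rls s).app n ((SD (bry n) n ^ r) x) := by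
  induction r with
  | zero => rfl
  | succ r ih => rw [pow_succ', pow_succ', Module.End.mul_apply, ih, sd_rls]; rfl

lemma small_sim {V W : Set X} (hV : IsOpen V) (hW : IsOpen W) {n : ℕ} {s : C(Δ n, X)} (hs : Set.range s ⊆ V ∪ W) :
    ∀ᶠ r in Filter.atTop, (sd X n ^ r) (sim s) ∈ sub V n ⊔ sub W n := by
  obtain ⟨δ, hδ, hl⟩ := lebesgue_number_lemma_of_metric (s := (Set.univ : Set (Δ n))) (c := fun b : Bool => s ⁻¹' (if b then V else W))
    isCompact_univ (fun b => by
      refine IsOpen.preimage s.continuous ?_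
      cases b
      · exact hW
      · exact hV) (by
      intro x _
      rcases hs ⟨x, rfl⟩ with h | h
      · exact Set.mem_iUnion.2 ⟨true, h⟩
      · exact Set.mem_iUnion.2 ⟨false, h⟩)
  obtain ⟨D, hD⟩ : ∃ D : ℝ, ∀ i j, dist (vtx n i) (vtx n j) ≤ D := by
    obtain ⟨D, hD⟩ := (Set.finite_range fun p : Fin (n + 1) × Fin (n + 1) => dist (vtx n p.1) (vtx n p.2)).bddAbove
    exact ⟨D, fun i j => hD ⟨(i, j), rfl⟩⟩
  have hlim : Filter.Tendsto (fun r : ℕ => ((n : ℝ) / (n + 1)) ^ r * D) Filter.atTop (nhds (0 * D)) := by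
    refine Filter.Tendsto.mul_const _ (tendsto_pow_atTop_nhds_zero_of_lt_one (by positivity) ?_)
    rw [div_lt_one (by positivity)]
    linarith
  rw [zero_mul] at hlim
  filter_upwards [hlim.eventually (gt_mem_nhds hδ)] with r hr
  rw [sim_eq_rls, sd_pow_rls]
  refine tsub_le (fun w hw => ?_) (SD_mesh_iter n D hD r)
  rw [rls_tp]
  obtain ⟨b, hb⟩ := hl (w 0) trivial
  have hsub : Set.range (s.comp (comb w)) ⊆ if b then V else W := by
    rintro _ ⟨t, rfl⟩
    exact hb (Metric.mem_ball.2 ((dist_comb_le w (w 0) _ (fun j => hw j 0) t).trans_lt hr))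
  cases b
  · exact Submodule.mem_sup_right (sim_mem_sub hsub)
  · exact Submodule.mem_sup_left (sim_mem_sub hsub)

lemma small {V W : Set X} (hV : IsOpen V) (hW : IsOpen W) {n : ℕ} {x : (Sing X).X n} (hx : x ∈ sub (V ∪ W) n) :
    ∀ᶠ r in Filter.atTop, (sd X n ^ r) x ∈ sub V n ⊔ sub W n := by
  rw [sub_eq_span] at hx
  induction hx using Submodule.span_induction with
  | mem x h =>
    obtain ⟨s, hs, rfl⟩ := h
    exact small_sim hV hW hs
  | zero => exact Filter.Eventually.of_forall fun r => by rw [map_zero]; exact Submodule.zero_mem _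
  | add x y _ _ hx hy =>
    filter_upwards [hx, hy] with r h1 h2
    rw [map_add]
    exact Submodule.add_mem _ h1 h2
  | smul a x _ hx =>
    filter_upwards [hx] with r h1
    rw [map_smul]
    exact Submodule.smul_mem _ _ h1

/-- Iterated homotopy. -/
noncomputable def sTr (X : Type) [TopologicalSpace X] : ∀ (_r n : ℕ), (Sing X).X n →ₗ[ℚ] (Sing X).X (n + 1)
  | 0, _ => 0
  | r + 1, n => sTr X r n + sT X n ∘ₗ (sd X n ^ r)

lemma d_sdr (r n : ℕ) (x : (Sing X).X (n + 1)) :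
    (Sing X).d n ((sd X (n + 1) ^ r) x) = (sd X n ^ r) ((Sing X).d n x) := by
  induction r with
  | zero => rfl
  | succ r ih => rw [pow_succ', pow_succ', Module.End.mul_apply, Module.End.mul_apply, d_sd, ih]

lemma sdr_zero (r : ℕ) (x : (Sing X).X 0) : (sd X 0 ^ r) x = x := by
  induction r with
  | zero => rfl
  | succ r ih => rw [pow_succ', Module.End.mul_apply, ih, sd_zero]

lemma sdr_push (f : C(X, Y)) (r : ℕ) {n : ℕ} (x : (Sing X).X n) :
    (push f).app n ((sd X n ^ r) x) = (sd Y n ^ r) ((push f).app n x) := by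
  induction r with
  | zero => rfl
  | succ r ih => rw [pow_succ', pow_succ', Module.End.mul_apply, Module.End.mul_apply, sd_push, ih]

lemma sdr_sub {S : Set X} (r : ℕ) {n : ℕ} {x : (Sing X).X n} (hx : x ∈ sub S n) : (sd X n ^ r) x ∈ sub S n := by
  induction r with
  | zero => exact hx
  | succ r ih =>
    rw [pow_succ', Module.End.mul_apply]
    exact sd_sub ih

lemma sTr_sub {S : Set X} (r : ℕ) {n : ℕ} {x : (Sing X).X n} (hx : x ∈ sub S n) : sTr X r n x ∈ sub S (n + 1) := by
  induction r with
  | zero => exact Submodule.zero_mem _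
  | succ r ih => exact Submodule.add_mem _ ih (sT_sub (sdr_sub r hx))

lemma d_sTr (r n : ℕ) (x : (Sing X).X (n + 1)) :
    (Sing X).d (n + 1) (sTr X r (n + 1) x) + sTr X r n ((Sing X).d n x) = x - (sd X (n + 1) ^ r) x := by
  induction r with
  | zero => simp [sTr]
  | succ r ih =>
    simp only [sTr, LinearMap.add_apply, LinearMap.comp_apply, map_add]
    have h := d_sT n ((sd X (n + 1) ^ r) x)
    rw [d_sdr] at h
    rw [pow_succ', Module.End.mul_apply]
    have e := congrArg₂ (fun a b => a + b) ih h
    simp only [sub_add_sub_cancel] at e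
    rw [← e]
    abel

end small

end CS

open CategoryTheory
open scoped DirectSum TensorProduct

namespace CS
open SMod

section hom
variable {X Y : Type} [TopologicalSpace X] [TopologicalSpace Y]

lemma hprism_sub (F : C(X × unitInterval, Y)) {S : Set X} {T : Set Y} (h : ∀ x ∈ S, ∀ t, F (x, t) ∈ T) {n : ℕ}
    {x : (Sing X).X n} (hx : x ∈ sub S n) : (hprism F).h n x ∈ sub T (n + 1) := by
  refine sub_le (fun s hs => ?_) hx
  rw [Prism.h_apply]
  refine Submodule.sum_mem _ fun i _ => Submodule.smul_mem _ _ ?_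
  rw [Sing_map_sim, hprism_K]
  refine sim_mem_sub ?_
  rintro _ ⟨p, rfl⟩
  exact h _ (hs ⟨_, rfl⟩) _

lemma homotopy_cycle (F : C(X × unitInterval, Y)) {S : Set X} {T : Set Y} (h : ∀ x ∈ S, ∀ t, F (x, t) ∈ T)
    (f0 f1 : C(X, Y)) (h0 : ∀ x, F (x, 0) = f0 x) (h1 : ∀ x, F (x, 1) = f1 x) {n : ℕ}
    {x : (Sing X).X n} (hx : x ∈ sub S n) (hd : (Sing X).dd n x = 0) :
    ∃ w ∈ sub T (n + 1), (Sing Y).d n w = (push f1).app n x - (push f0).app n x := by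
  refine ⟨_, hprism_sub F h hx, ?_⟩
  rw [Prism.ident_cycle _ hd, hprism_zero F f0 h0, hprism_one F f1 h1]

/-- Sum of coefficients. -/
noncomputable def aug (X : Type) [TopologicalSpace X] (n : ℕ) : (Sing X).X n →ₗ[ℚ] ℚ := lin fun _ => 1

lemma aug_sim {n : ℕ} (s : C(Δ n, X)) : aug X n (sim s) = 1 := lin_sim _ _

lemma aug_push (f : C(X, Y)) {n : ℕ} (x : (Sing X).X n) : aug Y n ((push f).app n x) = aug X n x := by
  refine LinearMap.congr_fun (f := aug Y n ∘ₗ (push f).app n) (g := aug X n) (Sing_hom_ext fun s => ?_) x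
  simp only [LinearMap.comp_apply, push_sim, aug_sim]

lemma push_const (b : Y) {n : ℕ} (x : (Sing X).X n) :
    (push (ContinuousMap.const X b)).app n x = aug X n x • sim (ContinuousMap.const _ b) := by
  refine LinearMap.congr_fun (g := (aug X n).smulRight (sim (ContinuousMap.const _ b))) (Sing_hom_ext fun s => ?_) x
  rw [push_sim, LinearMap.smulRight_apply, aug_sim, one_smul]
  rfl

lemma d_const (b : X) (n : ℕ) : (Sing X).d n (sim (ContinuousMap.const _ b)) =
    (if Even n then (0 : ℚ) else 1) • sim (ContinuousMap.const _ b) := by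
  rw [d_apply]
  have : ∀ i : Fin (n + 2), (Sing X).map (δ i) (sim (ContinuousMap.const _ b)) = sim (ContinuousMap.const _ b) := by
    intro i
    rw [Sing_map_sim]
    rfl
  simp only [this]
  rw [← Finset.sum_smul, Fin.sum_univ_eq_sum_range (fun i => (-1 : ℚ) ^ i), neg_one_geom_sum]
  congr 1
  simp only [Nat.even_add, even_two, iff_true]

lemma aug_d (x : (Sing X).X 1) : aug X 0 ((Sing X).d 0 x) = 0 := by
  refine LinearMap.congr_fun (f := aug X 0 ∘ₗ (Sing X).d 0) (g := 0) (Sing_hom_ext fun s => ?_) x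
  rw [LinearMap.comp_apply, d_apply, Fin.sum_univ_two]
  simp [Sing_map_sim, aug_sim]

/-- Reduced cycles. -/
def RC {n : ℕ} (x : (Sing X).X n) : Prop := (Sing X).dd n x = 0 ∧ (n = 0 → aug X n x = 0)

lemma RC.push {n : ℕ} {x : (Sing X).X n} (hx : RC x) (f : C(X, Y)) : RC ((push f).app n x) :=
  ⟨Hom.dd_app _ hx.1, fun h => by rw [aug_push]; exact hx.2 h⟩

lemma RC_of_pos {n : ℕ} {x : (Sing X).X (n + 1)} (hx : (Sing X).d n x = 0) : RC x := ⟨hx, fun h => by omega⟩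

lemma RC_d {n : ℕ} (x : (Sing X).X (n + 1)) : RC ((Sing X).d n x) := by
  refine ⟨SMod.dd_d _ _ _, fun h => ?_⟩
  subst h
  exact aug_d x

lemma RC.add {n : ℕ} {x y : (Sing X).X n} (hx : RC x) (hy : RC y) : RC (x + y) :=
  ⟨by rw [map_add, hx.1, hy.1, add_zero], fun h => by rw [map_add, hx.2 h, hy.2 h, add_zero]⟩

lemma RC.sub {n : ℕ} {x y : (Sing X).X n} (hx : RC x) (hy : RC y) : RC (x - y) :=
  ⟨by rw [map_sub, hx.1, hy.1, sub_zero], fun h => by rw [map_sub, hx.2 h, hy.2 h, sub_zero]⟩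

lemma RC_const {n : ℕ} {b : X} {c : ℚ} (hx : RC (c • sim (ContinuousMap.const (Δ n) b))) {S : Set X} (hb : b ∈ S) :
    ∃ w ∈ sub S (n + 1), (Sing X).d n w = c • sim (ContinuousMap.const _ b) := by
  have hm : ∀ m, sim (ContinuousMap.const (Δ m) b) ∈ sub S m := by
    intro m
    refine sim_mem_sub ?_
    rintro _ ⟨p, rfl⟩
    exact hb
  by_cases hn : Even n
  · have hc : c = 0 := by
      cases n with
      | zero =>
        have := hx.2 rfl
        rwa [map_smul, aug_sim, smul_eq_mul, mul_one] at this
      | succ n =>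
        have h := hx.1
        rw [dd_succ, map_smul, d_const, if_neg (by rwa [Nat.even_add_one] at hn), one_smul] at h
        have := congrArg (aug X n) h
        rwa [map_smul, aug_sim, smul_eq_mul, mul_one, map_zero] at this
    exact ⟨0, Submodule.zero_mem _, by rw [hc, zero_smul, map_zero]⟩
  · refine ⟨c • sim (ContinuousMap.const _ b), Submodule.smul_mem _ _ (hm _), ?_⟩
    rw [map_smul, d_const, if_neg hn, one_smul]

end hom

section conv
variable {W : Type} [NormedAddCommGroup W] [NormedSpace ℝ W]

/-- Straight line homotopy to a point. -/
noncomputable def slh (b : W) : C(W × unitInterval, W) where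
  toFun p := (1 - (p.2 : ℝ)) • b + (p.2 : ℝ) • p.1
  continuous_toFun := by fun_prop

lemma convex_acyc {S : Set W} (hS : Convex ℝ S) {b : W} (hb : b ∈ S) {n : ℕ} {x : (Sing W).X n} (hx : x ∈ sub S n)
    (hr : RC x) : ∃ w ∈ sub S (n + 1), (Sing W).d n w = x := by
  obtain ⟨w, hw, hdw⟩ := homotopy_cycle (slh b) (S := S) (T := S) (fun y hy t =>
      hS hb hy (sub_nonneg.2 t.2.2) t.2.1 (by ring)) (ContinuousMap.const W b) (ContinuousMap.id W)
      (fun y => by simp [slh]) (fun y => by simp [slh]) hx hr.1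
  have h2 := hr.push (ContinuousMap.const W b)
  rw [push_const] at h2 hdw
  obtain ⟨w', hw', hdw'⟩ := RC_const h2 hb
  refine ⟨w + w', Submodule.add_mem _ hw hw', ?_⟩
  rw [map_add, hdw, hdw', push_id, sub_add_cancel]

end conv

end CS

open CategoryTheory
open scoped DirectSum TensorProduct

namespace CS
open SMod

section refl
variable {W : Type} [NormedAddCommGroup W] [NormedSpace ℝ W]

/-- Open half neighbourhood. -/
def hA (L : Submodule ℝ W) (l : W →L[ℝ] ℝ) (v : W) : Set W := {x | 0 < l x ∨ x - (l x / 2) • v ∉ L}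

/-- Reflection. -/
noncomputable def rfn (l : W →L[ℝ] ℝ) (v : W) : C(W, W) := ⟨fun x => x - l x • v, by fun_prop⟩

lemma rfn_apply (l : W →L[ℝ] ℝ) (v x : W) : rfn l v x = x - l x • v := rfl

lemma hA_open {L : Submodule ℝ W} (hL : IsClosed (L : Set W)) (l : W →L[ℝ] ℝ) (v : W) : IsOpen (hA L l v) := by
  refine IsOpen.union (isOpen_lt continuous_const l.continuous) ?_
  exact hL.isOpen_compl.preimage (f := fun x => x - (l x / 2) • v) (by fun_prop)

lemma hA_acyc {L : Submodule ℝ W} {l : W →L[ℝ] ℝ} {v : W} (hv : l v = 2) {n : ℕ} {x : (Sing W).X n}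
    (hx : x ∈ sub (hA L l v) n) (hr : RC x) : ∃ w ∈ sub (hA L l v) (n + 1), (Sing W).d n w = x := by
  let F : C(W × unitInterval, W) := ⟨fun p => p.1 + ((p.2 : ℝ) * (1 - l p.1 / 2)) • v, by fun_prop⟩
  let f1 : C(W, W) := ⟨fun y => y + (1 - l y / 2) • v, by fun_prop⟩
  have hlF : ∀ y t, l (F (y, t)) = (1 - (t : ℝ)) * l y + 2 * t := by
    intro y t
    change l (y + ((t : ℝ) * (1 - l y / 2)) • v) = _
    rw [map_add, map_smul, hv, smul_eq_mul]
    ring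
  obtain ⟨w, hw, hdw⟩ := homotopy_cycle F (S := hA L l v) (T := hA L l v) (by
    intro y hy t
    rcases hy with hy | hy
    · left
      rw [hlF]
      have h0 := t.2.1
      have h1 := t.2.2
      rcases h0.eq_or_lt with h | h
      · rw [← h]; linarith
      · have : 0 ≤ (1 - (t : ℝ)) * l y := mul_nonneg (by linarith) hy.le
        linarith
    · right
      have : F (y, t) - (l (F (y, t)) / 2) • v = y - (l y / 2) • v := by
        rw [hlF]
        change y + ((t : ℝ) * (1 - l y / 2)) • v - _ = _
        module
      rwa [this]) (ContinuousMap.id W) f1 (fun y => by simp [F]) (fun y => by simp [F, f1]) hx hr.1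
  have hP : (push f1).app n x ∈ sub {y | 0 < l y} n := by
    refine push_sub (S := Set.univ) ?_ (sub_univ _)
    intro y _
    change 0 < l (y + (1 - l y / 2) • v)
    rw [map_add, map_smul, hv, smul_eq_mul]
    linarith
  obtain ⟨w', hw', hdw'⟩ := convex_acyc (convex_halfSpace_gt (f := l) ⟨map_add l, map_smul l⟩ 0) (b := v)
    (by change 0 < l v; rw [hv]; norm_num) hP (hr.push f1)
  refine ⟨w' - w, Submodule.sub_mem _ (sub_mono (fun y hy => Or.inl hy) hw') hw, ?_⟩
  rw [map_sub, hdw, hdw', push_id, sub_sub_cancel]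

lemma rfn_swap {L : Submodule ℝ W} {l : W →L[ℝ] ℝ} {v : W} (hv : l v = 2) {x : W} (hx : x ∈ hA L l v) :
    rfn l v x ∈ hA L (-l) (-v) := by
  have h1 : l (rfn l v x) = - l x := by
    rw [rfn_apply, map_sub, map_smul, hv, smul_eq_mul]; ring
  rcases hx with hx | hx
  · left
    rw [ContinuousLinearMap.neg_apply, h1, neg_neg]
    exact hx
  · right
    rw [ContinuousLinearMap.neg_apply, h1, rfn_apply]
    have : x - l x • v - (- - l x / 2) • (-v) = x - (l x / 2) • v := by module
    rwa [this]

lemma rfn_swap' {L : Submodule ℝ W} {l : W →L[ℝ] ℝ} {v : W} (hv : l v = 2) {x : W} (hx : x ∈ hA L (-l) (-v)) :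
    rfn l v x ∈ hA L l v := by
  have h := rfn_swap (L := L) (l := -l) (v := -v) (by simp [hv]) hx
  simp only [neg_neg] at h
  have e : rfn (-l) (-v) x = rfn l v x := by simp [rfn_apply]
  rwa [e] at h

lemma hA_union {L : Submodule ℝ W} {l : W →L[ℝ] ℝ} {v : W} (hl : ∀ x ∈ L, l x = 0) :
    hA L l v ∪ hA L (-l) (-v) = (L : Set W)ᶜ := by
  ext x
  simp only [hA, Set.mem_union, Set.mem_setOf_eq, ContinuousLinearMap.neg_apply, Set.mem_compl_iff, SetLike.mem_coe]
  have e : x - (-l x / 2) • (-v) = x - (l x / 2) • v := by module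
  rw [e]
  by_cases h0 : l x = 0
  · simp [h0]
  · have hx : x ∉ L := fun h => h0 (hl x h)
    refine iff_of_true ?_ hx
    rcases lt_or_gt_of_ne h0 with h | h
    · exact Or.inr (Or.inl (by linarith))
    · exact Or.inl (Or.inl h)

lemma hA_inter {L : Submodule ℝ W} {l : W →L[ℝ] ℝ} {v : W} :
    hA L l v ∩ hA L (-l) (-v) = {x | x - (l x / 2) • v ∉ L} := by
  ext x
  simp only [hA, Set.mem_inter_iff, Set.mem_setOf_eq, ContinuousLinearMap.neg_apply]
  have e : x - (-l x / 2) • (-v) = x - (l x / 2) • v := by module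
  rw [e]
  constructor
  · rintro ⟨h1 | h1, h2 | h2⟩
    · linarith
    all_goals assumption
  · exact fun h => ⟨Or.inr h, Or.inr h⟩

/-- A reflection acts by minus one on the reduced homology of the complement. -/
lemma refl_neg {L : Submodule ℝ W} (hL : IsClosed (L : Set W)) {l : W →L[ℝ] ℝ} {v : W} (hv : l v = 2)
    (hl : ∀ x ∈ L, l x = 0) {n : ℕ} {z : (Sing W).X n} (hz : z ∈ sub (L : Set W)ᶜ n) (hr : RC z) :
    ∃ w ∈ sub (L : Set W)ᶜ (n + 1), (Sing W).d n w = z + (push (rfn l v)).app n z := by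
  have hv' : (-l) (-v) = 2 := by simp [hv]
  have hU := hA_union (v := v) hl
  have hAU : hA L l v ⊆ (L : Set W)ᶜ := hU ▸ Set.subset_union_left
  have hBU : hA L (-l) (-v) ⊆ (L : Set W)ᶜ := hU ▸ Set.subset_union_right
  have hrU : ∀ x ∈ (L : Set W)ᶜ, rfn l v x ∈ (L : Set W)ᶜ := by
    intro x hx
    rw [← hU] at hx
    rcases hx with hx | hx
    · exact hBU (rfn_swap hv hx)
    · exact hAU (rfn_swap' hv hx)
  rw [← hU] at hz
  obtain ⟨r, hr2⟩ := (small (hA_open hL l v) (hA_open hL (-l) (-v)) hz).exists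
  rw [hU] at hz
  obtain ⟨p, hp, q, hq, hpq⟩ := Submodule.mem_sup.1 hr2
  have hrq : (push (rfn l v)).app n q ∈ sub (hA L l v) n := push_sub (fun x hx => rfn_swap' hv hx) hq
  have hrp : (push (rfn l v)).app n p ∈ sub (hA L (-l) (-v)) n := push_sub (fun x hx => rfn_swap hv hx) hp
  cases n with
  | zero =>
    rw [sdr_zero] at hpq
    have haug : aug W 0 p + aug W 0 q = 0 := by rw [← map_add, hpq]; exact hr.2 rfl
    obtain ⟨α, hα, hdα⟩ := hA_acyc hv (Submodule.add_mem _ hp hrq) ⟨dd_zero_apply _ _, fun _ => by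
      rw [map_add, aug_push, haug]⟩
    obtain ⟨β, hβ, hdβ⟩ := hA_acyc hv' (Submodule.add_mem _ hq hrp) ⟨dd_zero_apply _ _, fun _ => by
      rw [map_add, aug_push, add_comm, haug]⟩
    refine ⟨α + β, Submodule.add_mem _ (sub_mono hAU hα) (sub_mono hBU hβ), ?_⟩
    rw [map_add, hdα, hdβ, ← hpq, map_add]
    abel
  | succ n =>
    have hd0 : (Sing W).d n p + (Sing W).d n q = 0 := by
      rw [← map_add, hpq, d_sdr, show (Sing W).d n z = 0 from hr.1, map_zero]
    have hy : (Sing W).d n p ∈ sub (hA L l v ∩ hA L (-l) (-v)) n := by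
      refine mem_sub_inter (d_sub hp) ?_
      rw [eq_neg_of_add_eq_zero_left hd0]
      exact Submodule.neg_mem _ (d_sub hq)
    obtain ⟨h, hh, hdh⟩ := homotopy_cycle (⟨fun p => p.1 - ((p.2 : ℝ) * l p.1) • v, by fun_prop⟩ : C(W × unitInterval, W))
      (S := hA L l v ∩ hA L (-l) (-v)) (T := hA L l v ∩ hA L (-l) (-v)) (by
        rw [hA_inter]
        intro x hx t
        have : l (x - ((t : ℝ) * l x) • v) = l x - 2 * t * l x := by
          rw [map_sub, map_smul, hv, smul_eq_mul]; ring
        change (x - ((t : ℝ) * l x) • v) - (l (x - ((t : ℝ) * l x) • v) / 2) • v ∉ L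
        rw [this]
        have e : (x - ((t : ℝ) * l x) • v) - ((l x - 2 * t * l x) / 2) • v = x - (l x / 2) • v := by module
        rwa [e]) (ContinuousMap.id W) (rfn l v) (fun y => by simp) (fun y => by simp [rfn_apply]) hy (dd_d _ _ _)
    rw [push_id, Hom.d] at hdh
    rw [sub_inter] at hh
    obtain ⟨α, hα, hdα⟩ := hA_acyc hv (Submodule.add_mem _ (Submodule.add_mem _ hp hrq) hh.1) (RC_of_pos (by
      rw [map_add, map_add, hdh, ← Hom.d, ← Hom.d, eq_neg_of_add_eq_zero_right hd0, map_neg]; abel))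
    obtain ⟨β, hβ, hdβ⟩ := hA_acyc hv' (Submodule.sub_mem _ (Submodule.add_mem _ hq hrp) hh.2) (RC_of_pos (by
      rw [map_sub, map_add, hdh, ← Hom.d, eq_neg_of_add_eq_zero_right hd0]; abel))
    have hT := d_sTr r n z
    rw [show (Sing W).d n z = 0 from hr.1, map_zero, add_zero] at hT
    refine ⟨α + β + (sTr W r (n + 1) z + (push (rfn l v)).app _ (sTr W r (n + 1) z)),
      Submodule.add_mem _ (Submodule.add_mem _ (sub_mono hAU hα) (sub_mono hBU hβ))
        (Submodule.add_mem _ (sTr_sub r hz) (push_sub hrU (sTr_sub r hz))), ?_⟩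
    rw [map_add, map_add, map_add, hdα, hdβ, ← Hom.d, hT, ← hpq, map_sub, map_add]
    abel

end refl

end CS

open CategoryTheory
open scoped DirectSum TensorProduct

namespace CS
open SMod

section loc
variable {d k : ℕ}

/-- Model space. -/
abbrev EW (d k : ℕ) : Type := Fin k → EuclideanSpace ℝ (Fin d)

/-- Thin diagonal-type subspace attached to a labelling. -/
def LQ (d : ℕ) {k : ℕ} {J : Type} (q : Fin k → J) : Submodule ℝ (EW d k) where
  carrier := {y | ∀ i j, q i = q j → y i = y j}
  add_mem' := fun hx hy i j h => by rw [Pi.add_apply, Pi.add_apply, hx i j h, hy i j h]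
  zero_mem' := fun _ _ _ => rfl
  smul_mem' := fun c x hx i j h => by rw [Pi.smul_apply, Pi.smul_apply, hx i j h]

lemma mem_LQ {J : Type} {q : Fin k → J} {y : EW d k} : y ∈ LQ d q ↔ ∀ i j, q i = q j → y i = y j := Iff.rfl

lemma LQ_closed {J : Type} (q : Fin k → J) : IsClosed (LQ d q : Set (EW d k)) :=
  Submodule.closed_of_finiteDimensional _

/-- Coordinate difference. -/
noncomputable def lf (a b : Fin k) (e : Fin d) : EW d k →L[ℝ] ℝ :=
  (EuclideanSpace.proj e : EuclideanSpace ℝ (Fin d) →L[ℝ] ℝ).comp (ContinuousLinearMap.proj a) -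
    (EuclideanSpace.proj e : EuclideanSpace ℝ (Fin d) →L[ℝ] ℝ).comp (ContinuousLinearMap.proj b)

lemma lf_apply (a b : Fin k) (e : Fin d) (y : EW d k) : lf a b e y = y a e - y b e := rfl

/-- Dual vector. -/
noncomputable def vv (a b : Fin k) (e : Fin d) : EW d k :=
  Pi.single a (EuclideanSpace.single e 1) - Pi.single b (EuclideanSpace.single e 1)

lemma lf_vv {a b : Fin k} (hab : a ≠ b) (e e' : Fin d) : lf a b e (vv a b e') = if e = e' then 2 else 0 := by
  rw [lf_apply, vv]
  simp only [Pi.sub_apply, PiLp.sub_apply, Pi.single_eq_same, Pi.single_eq_of_ne hab, Pi.single_eq_of_ne hab.symm,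
    PiLp.zero_apply, PiLp.single_apply]
  split_ifs <;> norm_num

lemma lf_LQ {J : Type} {q : Fin k → J} {a b : Fin k} (h : q a = q b) (e : Fin d) {x : EW d k} (hx : x ∈ LQ d q) :
    lf a b e x = 0 := by
  rw [lf_apply, hx a b h, sub_self]

lemma rho_exists {J : Type} {q : Fin k → J} {a b : Fin k} (hab : a ≠ b) (hq : q a = q b) (s : Finset (Fin d)) :
    ∃ f : C(EW d k, EW d k), (∀ y, f y = y - ∑ e ∈ s, lf a b e y • vv a b e) ∧
      (∀ y, y ∈ (LQ d q : Set (EW d k))ᶜ → f y ∈ (LQ d q : Set (EW d k))ᶜ) ∧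
      ∀ (n : ℕ) (z : (Sing (EW d k)).X n), z ∈ sub (LQ d q : Set (EW d k))ᶜ n → RC z →
        ∃ w ∈ sub (LQ d q : Set (EW d k))ᶜ (n + 1), (Sing (EW d k)).d n w = z - (-1 : ℚ) ^ s.card • (push f).app n z := by
  classical
  induction s using Finset.induction_on with
  | empty =>
    refine ⟨ContinuousMap.id _, fun y => by simp, fun y hy => hy, fun n z _ _ => ⟨0, zero_mem _, ?_⟩⟩
    rw [map_zero, push_id]; simp
  | insert e s he ih =>
    obtain ⟨f, hf, hf1, hf2⟩ := ih
    have hv := (lf_vv hab e e).trans (if_pos rfl)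
    refine ⟨(rfn (lf a b e) (vv a b e)).comp f, ?_, ?_, ?_⟩
    · intro y
      have h1 : lf a b e (f y) = lf a b e y := by
        rw [hf, map_sub, map_sum, Finset.sum_eq_zero, sub_zero]
        intro e' he'
        rw [map_smul, lf_vv hab, if_neg (by rintro rfl; exact he he'), smul_zero]
      rw [ContinuousMap.comp_apply, rfn_apply, h1, hf, Finset.sum_insert he]
      abel
    · intro y hy hc
      refine hf1 y hy ?_
      rw [ContinuousMap.comp_apply] at hc
      have h0 := lf_LQ hq e hc
      rw [rfn_apply, map_sub, map_smul, hv, smul_eq_mul] at h0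
      have h1 : lf a b e (f y) = 0 := by linarith
      rw [rfn_apply, h1, zero_smul, sub_zero] at hc
      exact hc
    · intro n z hz hr
      obtain ⟨w, hw, hdw⟩ := hf2 n z hz hr
      obtain ⟨w', hw', hdw'⟩ := refl_neg (LQ_closed q) hv (fun x hx => lf_LQ hq e hx) (push_sub hf1 hz) (hr.push f)
      refine ⟨w + (-1 : ℚ) ^ s.card • w', Submodule.add_mem _ hw (Submodule.smul_mem _ _ hw'), ?_⟩
      rw [map_add, map_smul, hdw, hdw', push_comp, Finset.card_insert_of_notMem he, pow_succ]
      module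

lemma rho_univ {a b : Fin k} (hab : a ≠ b) (y : EW d k) : y - ∑ e, lf a b e y • vv a b e = pm (Equiv.swap a b) y := by
  funext i
  ext e
  change y i e - _ = y (Equiv.swap a b i) e
  simp only [Finset.sum_apply, Pi.smul_apply, vv, lf_apply, Pi.sub_apply]
  rcases eq_or_ne i a with rfl | ha
  · rw [Equiv.swap_apply_left]
    simp [Pi.single_eq_of_ne hab, Pi.single_apply]
  · rcases eq_or_ne i b with rfl | hb
    · rw [Equiv.swap_apply_right]
      simp [Pi.single_eq_of_ne hab.symm, Pi.single_apply]
    · rw [Equiv.swap_apply_of_ne_of_ne ha hb]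
      simp [Pi.single_eq_of_ne ha, Pi.single_eq_of_ne hb]

lemma tau_neg (hd : Odd d) {J : Type} {q : Fin k → J} {a b : Fin k} (hab : a ≠ b) (hq : q a = q b) {n : ℕ}
    {z : (Sing (EW d k)).X n} (hz : z ∈ sub (LQ d q : Set (EW d k))ᶜ n) (hr : RC z) :
    ∃ w ∈ sub (LQ d q : Set (EW d k))ᶜ (n + 1), (Sing (EW d k)).d n w = z + (push (pm (Equiv.swap a b))).app n z := by
  obtain ⟨f, hf, -, h⟩ := rho_exists (d := d) hab hq Finset.univ
  obtain ⟨w, hw, hdw⟩ := h n z hz hr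
  refine ⟨w, hw, ?_⟩
  have : f = pm (Equiv.swap a b) := by
    ext1 y
    rw [hf, rho_univ hab]
  rw [hdw, this, Finset.card_univ, Fintype.card_fin, hd.neg_one_pow]
  module

end loc

section shrink
variable {W : Type} [NormedAddCommGroup W] [NormedSpace ℝ W]

/-- Shrinking a homotopy. -/
lemma shrink {K : Set W} (hK : Convex ℝ K) {L : Submodule ℝ W} {b : W} (hb : b ∈ interior K) (hbL : b ∈ L) :
    ∃ f : C(W, W), (∀ y, f y ∈ K) ∧ (∀ y, y ∉ L → f y ∉ L) ∧
      ∀ (n : ℕ) (z : (Sing W).X n), z ∈ sub (K \ L) n → (Sing W).dd n z = 0 →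
        ∃ w ∈ sub (K \ L) (n + 1), (Sing W).d n w = (push f).app n z - z := by
  obtain ⟨ε, hε, hball⟩ := Metric.mem_nhds_iff.1 (mem_interior_iff_mem_nhds.1 hb)
  have hbK : b ∈ K := interior_subset hb
  have hpos : ∀ y : W, 0 < 1 + ‖y - b‖ := fun y => by positivity
  let g : W → W := fun y => b + (ε / (1 + ‖y - b‖)) • (y - b)
  have hg : Continuous g := by
    refine continuous_const.add (Continuous.smul (Continuous.div continuous_const (by fun_prop) fun y => (hpos y).ne') (by fun_prop))
  have hgK : ∀ y, g y ∈ K := by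
    intro y
    apply hball
    rw [Metric.mem_ball, dist_eq_norm]
    change ‖b + (ε / (1 + ‖y - b‖)) • (y - b) - b‖ < ε
    rw [add_sub_cancel_left, norm_smul, Real.norm_of_nonneg (by positivity), div_mul_eq_mul_div, div_lt_iff₀ (hpos y)]
    nlinarith [norm_nonneg (y - b)]
  have hsc : ∀ (y : W) (c : ℝ), c ≠ 0 → y ∉ L → b + c • (y - b) ∉ L := by
    intro y c hc hy h
    apply hy
    have h1 : c • (y - b) ∈ L := by simpa using L.sub_mem h hbL
    have h2 := (L.smul_mem_iff hc).1 h1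
    simpa using L.add_mem h2 hbL
  have hc0 : ∀ y, 0 < ε / (1 + ‖y - b‖) := fun y => by positivity
  refine ⟨⟨g, hg⟩, hgK, fun y hy => hsc y _ (hc0 y).ne' hy, fun n z hz hdz => ?_⟩
  let F : C(W × unitInterval, W) := ⟨fun p => (1 - (p.2 : ℝ)) • p.1 + (p.2 : ℝ) • g p.1, by fun_prop⟩
  have hF : ∀ y t, F (y, t) = (1 - (t : ℝ)) • y + (t : ℝ) • g y := fun _ _ => rfl
  obtain ⟨w, hw, hdw⟩ := homotopy_cycle F (S := K \ L) (T := K \ L) (by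
    rintro y ⟨hyK, hyL⟩ t
    have h0 := t.2.1
    have h1 := t.2.2
    refine ⟨?_, ?_⟩
    · rw [hF]
      exact hK hyK (hgK y) (by linarith) h0 (by ring)
    · have e : F (y, t) = b + ((1 - (t : ℝ)) + t * (ε / (1 + ‖y - b‖))) • (y - b) := by
        rw [hF]; simp only [g]; module
      rw [SetLike.mem_coe, e]
      refine hsc y _ ?_ hyL
      have := hc0 y
      rcases h0.eq_or_lt with h | h
      · rw [← h]; norm_num
      · have := mul_pos h this
        have : 0 < (1 - (t : ℝ)) + t * (ε / (1 + ‖y - b‖)) := by linarith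
        exact this.ne') (ContinuousMap.id W) ⟨g, hg⟩ (fun y => by rw [hF]; simp) (fun y => by rw [hF]; simp) hz hdz
  exact ⟨w, hw, by rw [hdw, push_id]⟩

end shrink

section loc2
variable {d k : ℕ}

lemma local_tau (hd : Odd d) {J : Type} {q : Fin k → J} {a b : Fin k} (hab : a ≠ b) (hq : q a = q b)
    {K : Set (EW d k)} (hK : Convex ℝ K) (hτ : ∀ y ∈ K, pm (Equiv.swap a b) y ∈ K) {p : EW d k} (hp : p ∈ interior K)
    (hpL : p ∈ LQ d q) {y0 : EW d k} (hy0 : y0 ∈ K \ LQ d q) {n : ℕ} {c : (Sing (EW d k)).X n} (hc : c ∈ sub K n)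
    (hdc : (Sing (EW d k)).dd n c ∈ sub (K \ LQ d q) (n - 1)) :
    ∃ e ∈ sub K (n + 1), ∃ u ∈ sub (K \ LQ d q) n,
      c + (push (pm (Equiv.swap a b))).app n c = (Sing (EW d k)).d n e + u := by
  have hpK := interior_subset hp
  set τ : C(EW d k, EW d k) := pm (Equiv.swap a b)
  have hcτ : c + (push τ).app n c ∈ sub K n := Submodule.add_mem _ hc (push_sub hτ hc)
  cases n with
  | zero =>
    set s0 := sim (ContinuousMap.const (Δ 0) y0) with hs0
    have hu : s0 ∈ sub (K \ LQ d q) 0 := sim_mem_sub (by rintro _ ⟨t, rfl⟩; exact hy0)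
    obtain ⟨e, he, hde⟩ := convex_acyc hK hpK (x := c + (push τ).app 0 c - (2 * aug _ 0 c) • s0)
      (Submodule.sub_mem _ hcτ (Submodule.smul_mem _ _ (sub_mono Set.sdiff_subset hu)))
      ⟨SMod.dd_zero_apply _ _, fun _ => by
        rw [map_sub, map_add, aug_push, map_smul, hs0, aug_sim, smul_eq_mul]; ring⟩
    exact ⟨e, he, _, Submodule.smul_mem _ (2 * aug _ 0 c) hu, by rw [hde, sub_add_cancel]⟩
  | succ m =>
    have hz : (Sing (EW d k)).d m c ∈ sub (K \ LQ d q) m := hdc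
    obtain ⟨f, hfK, hfL, hf⟩ := shrink hK hp hpL
    have hrz := RC_d (X := EW d k) c
    obtain ⟨w, hw, hdw⟩ := tau_neg hd hab hq (sub_mono (fun y hy => hy.2) hz) hrz
    obtain ⟨w', hw', hdw'⟩ := hf m _ (Submodule.add_mem _ hz (push_sub (f := τ) (T := K \ LQ d q) (by
      rintro y ⟨h1, h2⟩
      refine ⟨hτ y h1, fun h => h2 ?_⟩
      intro i j hij
      have hs : ∀ i, q (Equiv.swap a b i) = q i := by
        intro i
        rcases eq_or_ne i a with rfl | ha
        · rw [Equiv.swap_apply_left, hq]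
        · rcases eq_or_ne i b with rfl | hb
          · rw [Equiv.swap_apply_right, hq]
          · rw [Equiv.swap_apply_of_ne_of_ne ha hb]
      have := h (Equiv.swap a b i) (Equiv.swap a b j) (by rw [hs, hs, hij])
      change y (Equiv.swap a b (Equiv.swap a b i)) = y (Equiv.swap a b (Equiv.swap a b j)) at this
      rwa [Equiv.swap_apply_self, Equiv.swap_apply_self] at this) hz)) (hrz.add (hrz.push τ)).1
    have hu : (push f).app (m + 1) w - w' ∈ sub (K \ LQ d q) (m + 1) :=
      Submodule.sub_mem _ (push_sub (T := K \ LQ d q) (fun y hy => ⟨hfK y, hfL y hy⟩) hw) hw'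
    have hdu : (Sing (EW d k)).d m ((push f).app (m + 1) w - w') = (Sing (EW d k)).d m (c + (push τ).app (m + 1) c) := by
      have e1 : (push τ).app m ((Sing (EW d k)).d m c) = (Sing (EW d k)).d m ((push τ).app (m + 1) c) := Hom.d _ _ _
      rw [map_sub, ← Hom.d, hdw, hdw', map_add ((Sing (EW d k)).d m), ← e1]
      abel
    obtain ⟨e, he, hde⟩ := convex_acyc hK hpK (Submodule.sub_mem _ hcτ (sub_mono Set.sdiff_subset hu))
      (RC_of_pos (by rw [map_sub, hdu, sub_self]))
    exact ⟨e, he, _, hu, by rw [hde, sub_add_cancel]⟩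

end loc2
end CS

open CategoryTheory
open scoped DirectSum TensorProduct

namespace CS
open SMod

section pushOn
variable {X Y : Type} [TopologicalSpace X] [TopologicalSpace Y]

lemma sub_eqOn {S : Set X} {n : ℕ} {V : Type} [AddCommGroup V] [Module ℚ V] {f g : (Sing X).X n →ₗ[ℚ] V}
    (h : ∀ s : C(Δ n, X), Set.range s ⊆ S → f (sim s) = g (sim s)) {x : (Sing X).X n} (hx : x ∈ sub S n) : f x = g x := by
  have := sub_le (f := f - g) (p := ⊥) (fun s hs => by
    rw [Submodule.mem_bot, LinearMap.sub_apply, h s hs, sub_self]) hx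
  rw [Submodule.mem_bot, LinearMap.sub_apply] at this
  exact sub_eq_zero.1 this

open Classical in
/-- Pushforward along a partially continuous map. -/
noncomputable def pushOn {S : Set X} {f : X → Y} (hf : ContinuousOn f S) (n : ℕ) : (Sing X).X n →ₗ[ℚ] (Sing Y).X n :=
  lin fun s => if h : Set.range s ⊆ S then sim ⟨fun t => f (s t), hf.comp_continuous s.continuous fun t => h ⟨t, rfl⟩⟩ else 0

lemma pushOn_sim {S : Set X} {f : X → Y} (hf : ContinuousOn f S) {n : ℕ} {s : C(Δ n, X)} (h : Set.range s ⊆ S) :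
    pushOn hf n (sim s) = sim ⟨fun t => f (s t), hf.comp_continuous s.continuous fun t => h ⟨t, rfl⟩⟩ := by
  rw [pushOn, lin_sim, dif_pos h]

lemma pushOn_sub {S : Set X} {f : X → Y} (hf : ContinuousOn f S) {n : ℕ} {S' : Set X} {T : Set Y} (hS : S' ⊆ S)
    (h : ∀ x ∈ S', f x ∈ T) {x : (Sing X).X n} (hx : x ∈ sub S' n) : pushOn hf n x ∈ sub T n := by
  refine sub_le (fun s hs => ?_) hx
  rw [pushOn_sim hf (hs.trans hS)]
  refine sim_mem_sub ?_
  rintro _ ⟨t, rfl⟩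
  exact h _ (hs ⟨t, rfl⟩)

lemma pushOn_d {S : Set X} {f : X → Y} (hf : ContinuousOn f S) {n : ℕ} {x : (Sing X).X (n + 1)} (hx : x ∈ sub S (n + 1)) :
    pushOn hf n ((Sing X).d n x) = (Sing Y).d n (pushOn hf (n + 1) x) := by
  refine sub_eqOn (f := pushOn hf n ∘ₗ (Sing X).d n) (g := (Sing Y).d n ∘ₗ pushOn hf (n + 1)) (fun s hs => ?_) hx
  rw [LinearMap.comp_apply, LinearMap.comp_apply, d_apply, d_apply, map_sum]
  refine Finset.sum_congr rfl fun i _ => ?_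
  rw [map_smul, Sing_map_sim, pushOn_sim hf hs, Sing_map_sim, pushOn_sim hf]
  · rfl
  · rintro _ ⟨t, rfl⟩
    exact hs ⟨_, rfl⟩

lemma pushOn_dd {S : Set X} {f : X → Y} (hf : ContinuousOn f S) {n : ℕ} {x : (Sing X).X n} (hx : x ∈ sub S n) :
    pushOn hf (n - 1) ((Sing X).dd n x) = (Sing Y).dd n (pushOn hf n x) := by
  cases n with
  | zero => rw [dd_zero_apply, dd_zero_apply, map_zero]
  | succ n => exact pushOn_d hf hx

lemma pushOn_push {S : Set X} {f : X → Y} (hf : ContinuousOn f S) {σ : C(X, X)} {τ : C(Y, Y)} (hσ : ∀ x ∈ S, σ x ∈ S)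
    (h : ∀ x ∈ S, f (σ x) = τ (f x)) {n : ℕ} {x : (Sing X).X n} (hx : x ∈ sub S n) :
    pushOn hf n ((push σ).app n x) = (push τ).app n (pushOn hf n x) := by
  refine sub_eqOn (f := pushOn hf n ∘ₗ (push σ).app n) (g := (push τ).app n ∘ₗ pushOn hf n) (fun s hs => ?_) hx
  rw [LinearMap.comp_apply, LinearMap.comp_apply, push_sim, pushOn_sim hf hs, push_sim, pushOn_sim hf]
  · congr 1
    ext1 t
    exact h _ (hs ⟨t, rfl⟩)
  · rintro _ ⟨t, rfl⟩
    exact hσ _ (hs ⟨t, rfl⟩)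

lemma pushOn_inv {S : Set X} {f : X → Y} (hf : ContinuousOn f S) {T : Set Y} {g : Y → X} (hg : ContinuousOn g T)
    (hS : ∀ x ∈ S, f x ∈ T) (h : ∀ x ∈ S, g (f x) = x) {n : ℕ} {x : (Sing X).X n} (hx : x ∈ sub S n) :
    pushOn hg n (pushOn hf n x) = x := by
  refine sub_eqOn (f := pushOn hg n ∘ₗ pushOn hf n) (g := LinearMap.id) (fun s hs => ?_) hx
  rw [LinearMap.comp_apply, LinearMap.id_apply, pushOn_sim hf hs, pushOn_sim hg]
  · congr 1
    ext1 t
    exact h _ (hs ⟨t, rfl⟩)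
  · rintro _ ⟨t, rfl⟩
    exact hS _ (hs ⟨t, rfl⟩)

end pushOn

section cell
variable {d k : ℕ} {M : Type} [TopologicalSpace M] {J : Type}

/-- Product cell. -/
def VQ (D : J → Set M) (q : Fin k → J) : Set (Fin k → M) := {x | ∀ i, x i ∈ D (q i)}

/-- Complement of the thin diagonal. -/
def NL (M : Type) (q : Fin k → J) : Set (Fin k → M) := {x | ∃ i j, q i = q j ∧ x i ≠ x j}

lemma swap_label {q : Fin k → J} {a b : Fin k} (hq : q a = q b) (i : Fin k) : q (Equiv.swap a b i) = q i := by
  rcases eq_or_ne i a with rfl | ha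
  · rw [Equiv.swap_apply_left, hq]
  · rcases eq_or_ne i b with rfl | hb
    · rw [Equiv.swap_apply_right, hq]
    · rw [Equiv.swap_apply_of_ne_of_ne ha hb]

lemma cell_tau (hd : Odd d) {q : Fin k → J} {a b : Fin k} (hab : a ≠ b) (hq : q a = q b) {D : J → Set M}
    (ψ : J → M → EuclideanSpace ℝ (Fin d)) (χ : J → EuclideanSpace ℝ (Fin d) → M)
    (hψ : ∀ j, ContinuousOn (ψ j) (D j)) (hχ : ∀ j, ContinuousOn (χ j) (ψ j '' D j))
    (hinv : ∀ j, ∀ x ∈ D j, χ j (ψ j x) = x) (hconv : ∀ j, Convex ℝ (ψ j '' D j))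
    (hitr : ∀ j, (interior (ψ j '' D j)).Nonempty) {n : ℕ} {c : (Sing (Fin k → M)).X n} (hc : c ∈ sub (VQ D q) n)
    (hdc : (Sing (Fin k → M)).dd n c ∈ sub (VQ D q ∩ NL M q) (n - 1)) :
    ∃ e ∈ sub (VQ D q) (n + 1), ∃ u ∈ sub (VQ D q ∩ NL M q) n,
      c + (push (pm (Equiv.swap a b))).app n c = (Sing (Fin k → M)).d n e + u := by
  let K : Set (EW d k) := {y | ∀ i, y i ∈ ψ (q i) '' D (q i)}
  let Ψ : (Fin k → M) → EW d k := fun x i => ψ (q i) (x i)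
  let Χ : EW d k → (Fin k → M) := fun y i => χ (q i) (y i)
  have hΨ : ContinuousOn Ψ (VQ D q) := continuousOn_pi.2 fun i =>
    (hψ (q i)).comp (continuous_apply i).continuousOn fun x hx => hx i
  have hΧ : ContinuousOn Χ K := continuousOn_pi.2 fun i =>
    (hχ (q i)).comp (continuous_apply i).continuousOn fun x hx => hx i
  have hΨK : ∀ x ∈ VQ D q, Ψ x ∈ K := fun x hx i => ⟨x i, hx i, rfl⟩
  have hΧV : ∀ y ∈ K, Χ y ∈ VQ D q := by
    intro y hy i
    obtain ⟨x, hx, he⟩ := hy i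
    change χ (q i) (y i) ∈ _
    rw [← he, hinv _ _ hx]
    exact hx
  have hinvV : ∀ x ∈ VQ D q, Χ (Ψ x) = x := fun x hx => funext fun i => hinv _ _ (hx i)
  have hinvK : ∀ y ∈ K, Ψ (Χ y) = y := by
    intro y hy
    funext i
    obtain ⟨x, hx, he⟩ := hy i
    change ψ (q i) (χ (q i) (y i)) = _
    rw [← he, hinv _ _ hx]
  have hΨL : ∀ x ∈ VQ D q ∩ NL M q, Ψ x ∈ K \ LQ d q := by
    rintro x ⟨hx, i, j, hij, hne⟩
    refine ⟨hΨK x hx, fun h => hne ?_⟩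
    have h1 : ψ (q i) (x i) = ψ (q j) (x j) := h i j hij
    rw [← hinv _ _ (hx i), ← hinv _ _ (hx j), h1, hij]
  have hΧL : ∀ y ∈ K \ LQ d q, Χ y ∈ VQ D q ∩ NL M q := by
    rintro y ⟨hy, hL⟩
    refine ⟨hΧV y hy, ?_⟩
    by_contra hn
    refine hL fun i j hij => ?_
    have h1 : χ (q i) (y i) = χ (q j) (y j) := by
      by_contra hne
      exact hn ⟨i, j, hij, hne⟩
    have h2 : ψ (q i) (χ (q i) (y i)) = y i := congrFun (hinvK y hy) i
    have h3 : ψ (q j) (χ (q j) (y j)) = y j := congrFun (hinvK y hy) j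
    rw [← h2, ← h3, h1, hij]
  have hK : Convex ℝ K := by
    intro x hx y hy s t hs ht hst i
    exact hconv _ (hx i) (hy i) hs ht hst
  have hτK : ∀ y ∈ K, pm (Equiv.swap a b) y ∈ K := by
    intro y hy i
    have := hy (Equiv.swap a b i)
    rw [swap_label hq] at this
    exact this
  have hτV : ∀ x ∈ VQ D q, pm (Equiv.swap a b) x ∈ VQ D q := by
    intro y hy i
    have := hy (Equiv.swap a b i)
    rw [swap_label hq] at this
    exact this
  choose p hp using hitr
  have hKi : (fun i => p (q i)) ∈ interior K := by
    have : K = Set.pi Set.univ fun i => ψ (q i) '' D (q i) := by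
      ext y; simp [K]
    rw [this, interior_pi_set Set.finite_univ]
    exact fun i _ => hp _
  have hy0 : ∃ y0, y0 ∈ K \ LQ d q := by
    by_contra hn
    push Not at hn
    have hsub : K ⊆ LQ d q := by
      intro y hy
      by_contra h
      exact hn y ⟨hy, h⟩
    have htop := Submodule.eq_top_of_nonempty_interior' (LQ d q) ⟨_, interior_mono hsub hKi⟩
    obtain ⟨m, hm⟩ := hd
    have hv : vv a b (⟨0, by omega⟩ : Fin d) ∈ LQ d q := htop ▸ Submodule.mem_top
    have := lf_LQ hq ⟨0, by omega⟩ hv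
    rw [lf_vv hab, if_pos rfl] at this
    norm_num at this
  obtain ⟨y0, hy0⟩ := hy0
  obtain ⟨e, he, u, hu, heq⟩ := local_tau hd hab hq hK hτK hKi (fun i j h => by simp only [h]) hy0
    (pushOn_sub hΨ subset_rfl hΨK hc) (by
      rw [← pushOn_dd hΨ hc]
      exact pushOn_sub hΨ Set.inter_subset_left hΨL hdc)
  refine ⟨pushOn hΧ _ e, pushOn_sub hΧ subset_rfl hΧV he, pushOn hΧ _ u, pushOn_sub hΧ Set.sdiff_subset hΧL hu, ?_⟩
  have h1 := congrArg (pushOn hΧ n) heq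
  rw [map_add, map_add, pushOn_d hΧ he, pushOn_inv hΨ hΧ hΨK hinvV hc, ← pushOn_push hΨ (σ := pm (Equiv.swap a b)) hτV ?_ hc,
    pushOn_inv hΨ hΧ hΨK hinvV (push_sub hτV hc)] at h1
  · exact h1
  · intro x hx
    funext i
    change ψ (q i) (x (Equiv.swap a b i)) = ψ (q (Equiv.swap a b i)) (x (Equiv.swap a b i))
    rw [swap_label hq]

end cell
end CS

open CategoryTheory
open scoped DirectSum TensorProduct

namespace CS
open SMod

section good
variable {k : ℕ} {M : Type} [TopologicalSpace M]

/-- Norm operator of the symmetric group. -/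
noncomputable def avg (k : ℕ) (M : Type) [TopologicalSpace M] : Hom (Sing (Fin k → M)) (Sing (Fin k → M)) where
  app n := ∑ g : Equiv.Perm (Fin k), (push (pm g)).app n
  comm f x := by
    rw [LinearMap.sum_apply, LinearMap.sum_apply, map_sum]
    exact Finset.sum_congr rfl fun g _ => (push (pm g)).comm f x

lemma avg_apply {n : ℕ} (x : (Sing (Fin k → M)).X n) :
    (avg k M).app n x = ∑ g : Equiv.Perm (Fin k), (push (pm g)).app n x := LinearMap.sum_apply _ _ _

lemma pm_comp (g h : Equiv.Perm (Fin k)) : (pm g : C(Fin k → M, Fin k → M)).comp (pm h) = pm (h * g) := rfl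

lemma pm_one : (pm (1 : Equiv.Perm (Fin k)) : C(Fin k → M, Fin k → M)) = ContinuousMap.id _ := rfl

lemma avg_pm (g : Equiv.Perm (Fin k)) {n : ℕ} (x : (Sing (Fin k → M)).X n) :
    (avg k M).app n ((push (pm g)).app n x) = (avg k M).app n x := by
  rw [avg_apply, avg_apply]
  simp only [← push_comp, pm_comp]
  exact Fintype.sum_equiv (Equiv.mulLeft g) _ _ fun h => rfl

lemma pm_avg (g : Equiv.Perm (Fin k)) {n : ℕ} (x : (Sing (Fin k → M)).X n) :
    (push (pm g)).app n ((avg k M).app n x) = (avg k M).app n x := by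
  rw [avg_apply, map_sum]
  simp only [← push_comp, pm_comp]
  exact Fintype.sum_equiv (Equiv.mulRight g) _ _ fun h => rfl

lemma avg_of_inv {n : ℕ} {x : (Sing (Fin k → M)).X n} (h : ∀ g, (push (pm g)).app n x = x) :
    (avg k M).app n x = (k.factorial : ℚ) • x := by
  rw [avg_apply, Finset.sum_congr rfl fun g _ => h g, Finset.sum_const, Finset.card_univ, Fintype.card_perm, Fintype.card_fin,
    Nat.cast_smul_eq_nsmul]

lemma avg_avg {n : ℕ} (x : (Sing (Fin k → M)).X n) :
    (avg k M).app n ((avg k M).app n x) = (k.factorial : ℚ) • (avg k M).app n x :=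
  avg_of_inv fun g => pm_avg g x

/-- Invariant subsets. -/
def Inv (V : Set (Fin k → M)) : Prop := ∀ (g : Equiv.Perm (Fin k)), ∀ x ∈ V, pm g x ∈ V

lemma Inv.inter {V W : Set (Fin k → M)} (hV : Inv V) (hW : Inv W) : Inv (V ∩ W) :=
  fun g x hx => ⟨hV g x hx.1, hW g x hx.2⟩

lemma Inv.union {V W : Set (Fin k → M)} (hV : Inv V) (hW : Inv W) : Inv (V ∪ W) :=
  fun g x hx => hx.imp (hV g x) (hW g x)

lemma avg_sub {V : Set (Fin k → M)} (hV : Inv V) {n : ℕ} {x : (Sing (Fin k → M)).X n} (hx : x ∈ sub V n) :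
    (avg k M).app n x ∈ sub V n := by
  rw [avg_apply]
  exact Submodule.sum_mem _ fun g _ => push_sub (hV g) hx

lemma dd_sub {X : Type} [TopologicalSpace X] {S : Set X} {n : ℕ} {x : (Sing X).X n} (hx : x ∈ sub S n) :
    (Sing X).dd n x ∈ sub S (n - 1) := by
  cases n with
  | zero => rw [dd_zero_apply]; exact Submodule.zero_mem _
  | succ n => exact d_sub hx

/-- Relative chains are killed by averaging. -/
def Good (U V : Set (Fin k → M)) : Prop := ∀ (m : ℕ) (c : (Sing (Fin k → M)).X m), c ∈ sub V m →
  (Sing (Fin k → M)).dd m c ∈ sub (V ∩ U) (m - 1) →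
  ∃ b ∈ sub V (m + 1), (avg k M).app m c - (Sing (Fin k → M)).d m b ∈ sub (V ∩ U) m

lemma Good_of_subset {U V : Set (Fin k → M)} (hV : Inv V) (h : V ⊆ U) : Good U V := by
  intro m c hc _
  refine ⟨0, Submodule.zero_mem _, ?_⟩
  rw [map_zero, sub_zero, Set.inter_eq_left.2 h]
  exact avg_sub hV hc

lemma Good.union {U V W : Set (Fin k → M)} (hU : IsOpen U) (iU : Inv U) (hV : IsOpen V) (iV : Inv V) (hW : IsOpen W) (iW : Inv W)
    (gV : Good U V) (gW : Good U W) (gVW : Good U (V ∩ W)) : Good U (V ∪ W) := by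
  intro m c hc hdc
  have hVs : V ∩ U ⊆ (V ∪ W) ∩ U := Set.inter_subset_inter_left _ Set.subset_union_left
  have hWs : W ∩ U ⊆ (V ∪ W) ∩ U := Set.inter_subset_inter_left _ Set.subset_union_right
  cases m with
  | zero =>
    obtain ⟨r, hr⟩ := (small hV hW hc).exists
    rw [sdr_zero] at hr
    obtain ⟨v, hv, w, hw, rfl⟩ := Submodule.mem_sup.1 hr
    obtain ⟨b1, hb1, h1⟩ := gV 0 v hv (by rw [dd_zero_apply]; exact Submodule.zero_mem _)
    obtain ⟨b2, hb2, h2⟩ := gW 0 w hw (by rw [dd_zero_apply]; exact Submodule.zero_mem _)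
    refine ⟨b1 + b2, Submodule.add_mem _ (sub_mono Set.subset_union_left hb1) (sub_mono Set.subset_union_right hb2), ?_⟩
    rw [map_add, map_add, add_sub_add_comm]
    exact Submodule.add_mem _ (sub_mono hVs h1) (sub_mono hWs h2)
  | succ m =>
    have hdc' : (Sing (Fin k → M)).d m c ∈ sub ((V ∪ W) ∩ U) m := hdc
    have hdc2 := hdc'
    rw [Set.union_inter_distrib_right] at hdc2
    obtain ⟨r, hr1, hr2⟩ := ((small hV hW hc).and (small (hV.inter hU) (hW.inter hU) hdc2)).exists
    obtain ⟨v, hv, w, hw, hvw⟩ := Submodule.mem_sup.1 hr1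
    obtain ⟨p, hp, q, hq, hpq⟩ := Submodule.mem_sup.1 hr2
    rw [← d_sdr, ← hvw, map_add] at hpq
    set D := (Sing (Fin k → M)).d m with hD
    have he : D v - p = q - D w := by
      rw [sub_eq_sub_iff_add_eq_add, ← hpq, add_comm]
    have heV : D v - p ∈ sub V m := Submodule.sub_mem _ (d_sub hv) (sub_mono Set.inter_subset_left hp)
    have heW : D v - p ∈ sub W m := by
      rw [he]
      exact Submodule.sub_mem _ (sub_mono Set.inter_subset_left hq) (d_sub hw)
    have hdd1 : (Sing (Fin k → M)).dd m (D v - p) ∈ sub (V ∩ U) (m - 1) := by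
      rw [map_sub, hD, dd_d, zero_sub]
      exact Submodule.neg_mem _ (dd_sub hp)
    have hdd2 : (Sing (Fin k → M)).dd m (D v - p) ∈ sub (W ∩ U) (m - 1) := by
      rw [he, map_sub, hD, dd_d, sub_zero]
      exact dd_sub hq
    obtain ⟨b, hb, hf⟩ := gVW m _ (mem_sub_inter heV heW)
      (sub_mono (show (V ∩ U) ∩ (W ∩ U) ⊆ V ∩ W ∩ U from fun x hx => ⟨⟨hx.1.1, hx.2.1⟩, hx.1.2⟩) (mem_sub_inter hdd1 hdd2))
    set N := avg k M with hN
    set f := N.app m (D v - p) - D b with hfdef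
    have hfV : f ∈ sub (V ∩ U) m := sub_mono (show V ∩ W ∩ U ⊆ V ∩ U from fun x hx => ⟨hx.1.1, hx.2⟩) hf
    have hfW : f ∈ sub (W ∩ U) m := sub_mono (show V ∩ W ∩ U ⊆ W ∩ U from fun x hx => ⟨hx.1.2, hx.2⟩) hf
    obtain ⟨b1, hb1, h1⟩ := gV (m + 1) (N.app (m + 1) v - b)
      (Submodule.sub_mem _ (avg_sub iV hv) (sub_mono Set.inter_subset_left hb)) (by
        have e : D (N.app (m + 1) v - b) = f + N.app m p := by
          rw [map_sub, hD, ← N.d, hfdef, map_sub]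
          abel
        change D (N.app (m + 1) v - b) ∈ _
        rw [e]
        exact Submodule.add_mem _ hfV (avg_sub (iV.inter iU) hp))
    obtain ⟨b2, hb2, h2⟩ := gW (m + 1) (N.app (m + 1) w + b)
      (Submodule.add_mem _ (avg_sub iW hw) (sub_mono Set.inter_subset_right hb)) (by
        have e : D (N.app (m + 1) w + b) = N.app m q - f := by
          rw [map_add, hD, ← N.d, hfdef, he, map_sub]
          abel
        change D (N.app (m + 1) w + b) ∈ _
        rw [e]
        exact Submodule.sub_mem _ (avg_sub (iW.inter iU) hq) hfW)
    have hk : (k.factorial : ℚ) ≠ 0 := by exact_mod_cast k.factorial_ne_zero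
    have iVW := iV.union iW
    have hT := sTr_sub r hc
    have hT' := sTr_sub r hdc'
    refine ⟨(k.factorial : ℚ)⁻¹ • (b1 + b2) + N.app (m + 2) (sTr _ r (m + 1) c), Submodule.add_mem _
      (Submodule.smul_mem _ _ (Submodule.add_mem _ (sub_mono Set.subset_union_left hb1) (sub_mono Set.subset_union_right hb2)))
      (avg_sub iVW hT), ?_⟩
    have hX := congrArg (N.app (m + 1)) (d_sTr r m c)
    rw [map_add, map_sub, ← hvw, map_add, N.d] at hX
    have hY : (k.factorial : ℚ)⁻¹ • (N.app (m + 1) (N.app (m + 1) v - b) + N.app (m + 1) (N.app (m + 1) w + b)) =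
        N.app (m + 1) v + N.app (m + 1) w := by
      rw [map_sub, map_add, hN, avg_avg, avg_avg, ← hN, sub_add_add_cancel, ← smul_add, inv_smul_smul₀ hk]
    have key : N.app (m + 1) c - (Sing (Fin k → M)).d (m + 1) ((k.factorial : ℚ)⁻¹ • (b1 + b2) + N.app (m + 2) (sTr _ r (m + 1) c)) =
        (k.factorial : ℚ)⁻¹ • ((N.app (m + 1) (N.app (m + 1) v - b) - (Sing (Fin k → M)).d (m + 1) b1) +
          (N.app (m + 1) (N.app (m + 1) w + b) - (Sing (Fin k → M)).d (m + 1) b2)) +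
        N.app (m + 1) (sTr _ r m (D c)) := by
      have hZ : ∀ A B C E : (Sing (Fin k → M)).X (m + 1), (A - C) + (B - E) = (A + B) - (C + E) := fun A B C E => by abel
      rw [hZ, smul_sub, hY, map_add, map_smul, map_add, eq_add_of_sub_eq hX.symm]
      abel
    rw [key]
    exact Submodule.add_mem _ (Submodule.smul_mem _ _ (Submodule.add_mem _ (sub_mono hVs h1) (sub_mono hWs h2)))
      (avg_sub (iVW.inter iU) hT')

end good
end CS

open CategoryTheory
open scoped DirectSum TensorProduct

namespace CS
open SMod

section unions
variable {k : ℕ} {M : Type} [TopologicalSpace M]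

/-- Union of a list of sets. -/
def lU {X : Type} (l : List (Set X)) : Set X := {x | ∃ V ∈ l, x ∈ V}

lemma lU_open {X : Type} [TopologicalSpace X] {l : List (Set X)} (h : ∀ V ∈ l, IsOpen V) : IsOpen (lU l) := by
  have : lU l = ⋃ V ∈ l, V := by ext x; simp [lU]
  rw [this]
  exact isOpen_biUnion h

lemma lU_inv {l : List (Set (Fin k → M))} (h : ∀ V ∈ l, Inv V) : Inv (lU l) := by
  rintro g x ⟨V, hV, hx⟩
  exact ⟨V, hV, h V hV g x hx⟩

lemma lU_mono {X : Type} {l l' : List (Set X)} (h : ∀ V ∈ l, V ∈ l') : lU l ⊆ lU l' := by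
  rintro x ⟨V, hV, hx⟩
  exact ⟨V, h V hV, hx⟩

lemma Good_list {U : Set (Fin k → M)} (hU : IsOpen U) (iU : Inv U) {B : Set (Set (Fin k → M))} (hB : ∀ V ∈ B, IsOpen V)
    (iB : ∀ V ∈ B, Inv V) (gB : ∀ V ∈ B, Good U V) (hi : ∀ V ∈ B, ∀ W ∈ B, V ∩ W ∈ B) :
    ∀ (n : ℕ) (l : List (Set (Fin k → M))), l.length = n → (∀ V ∈ l, V ∈ B) → Good U (lU l) := by
  intro n
  induction n with
  | zero =>
    intro l hl _
    rw [List.length_eq_zero_iff] at hl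
    subst hl
    refine Good_of_subset (lU_inv (by simp)) ?_
    rintro x ⟨V, hV, -⟩
    simp at hV
  | succ n ih =>
    intro l hl hlB
    match l, hl with
    | V :: l, hl =>
      have hl' : l.length = n := by simpa using hl
      have hV := hlB V (by simp)
      have hr : ∀ W ∈ l, W ∈ B := fun W hW => hlB W (by simp [hW])
      have e1 : lU (V :: l) = V ∪ lU l := by
        ext x; simp [lU]
      have e2 : V ∩ lU l = lU (l.map fun W => V ∩ W) := by
        ext x
        simp only [lU, Set.mem_inter_iff, List.mem_map]
        constructor
        · rintro ⟨hx, W, hW, hxW⟩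
          exact ⟨_, ⟨W, hW, rfl⟩, hx, hxW⟩
        · rintro ⟨_, ⟨W, hW, rfl⟩, hx, hxW⟩
          exact ⟨hx, W, hW, hxW⟩
      rw [e1]
      refine Good.union hU iU (hB V hV) (iB V hV) (lU_open fun W hW => hB W (hr W hW)) (lU_inv fun W hW => iB W (hr W hW))
        (gB V hV) (ih l hl' hr) ?_
      rw [e2]
      refine ih _ (by simpa using hl') ?_
      intro W' hW'
      obtain ⟨W, hW, rfl⟩ := List.mem_map.1 hW'
      exact hi V hV W (hr W hW)

lemma sub_sUnion {X : Type} [TopologicalSpace X] {B : Set (Set X)} (hB : ∀ V ∈ B, IsOpen V) {n : ℕ} {x : (Sing X).X n}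
    (hx : x ∈ sub (⋃₀ B) n) : ∃ l : List (Set X), (∀ V ∈ l, V ∈ B) ∧ x ∈ sub (lU l) n := by
  rw [sub_eq_span] at hx
  induction hx using Submodule.span_induction with
  | mem x h =>
    obtain ⟨s, hs, rfl⟩ := h
    have hs' : Set.range s ⊆ ⋃ V : B, (V : Set X) := by rwa [← Set.sUnion_eq_iUnion]
    obtain ⟨t, ht⟩ := (isCompact_range s.continuous).elim_finite_subcover (fun V : B => (V : Set X)) (fun V => hB V V.2) hs'
    refine ⟨t.toList.map Subtype.val, ?_, sim_mem_sub (ht.trans ?_)⟩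
    · intro V hV
      obtain ⟨W, -, rfl⟩ := List.mem_map.1 hV
      exact W.2
    · intro y hy
      simp only [Set.mem_iUnion] at hy
      obtain ⟨V, hV, hy⟩ := hy
      exact ⟨V, List.mem_map.2 ⟨V, Finset.mem_toList.2 hV, rfl⟩, hy⟩
  | zero => exact ⟨[], by simp, Submodule.zero_mem _⟩
  | add x y _ _ hx hy =>
    obtain ⟨l, hl, h⟩ := hx
    obtain ⟨l', hl', h'⟩ := hy
    refine ⟨l ++ l', fun V hV => (List.mem_append.1 hV).elim (hl V) (hl' V), Submodule.add_mem _ ?_ ?_⟩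
    · exact sub_mono (lU_mono fun V hV => List.mem_append_left _ hV) h
    · exact sub_mono (lU_mono fun V hV => List.mem_append_right _ hV) h'
  | smul a x _ hx =>
    obtain ⟨l, hl, h⟩ := hx
    exact ⟨l, hl, Submodule.smul_mem _ _ h⟩

lemma Good_sUnion {U : Set (Fin k → M)} (hU : IsOpen U) (iU : Inv U) {B : Set (Set (Fin k → M))} (hB : ∀ V ∈ B, IsOpen V)
    (iB : ∀ V ∈ B, Inv V) (gB : ∀ V ∈ B, Good U V) (hi : ∀ V ∈ B, ∀ W ∈ B, V ∩ W ∈ B) {S : Set (Set (Fin k → M))} (hS : S ⊆ B) :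
    Good U (⋃₀ S) := by
  intro m c hc hdc
  obtain ⟨l, hl, h⟩ := sub_sUnion (fun V hV => hB V (hS hV)) hc
  obtain ⟨b, hb, h'⟩ := Good_list hU iU hB iB gB hi _ l rfl (fun V hV => hS (hl V hV)) m c h
    (mem_sub_inter (dd_sub h) (sub_mono Set.inter_subset_right hdc))
  have hsub : lU l ⊆ ⋃₀ S := by
    rintro x ⟨V, hV, hx⟩
    exact ⟨V, hl V hV, hx⟩
  exact ⟨b, sub_mono hsub hb, sub_mono (Set.inter_subset_inter_left _ hsub) h'⟩

/-- Hereditary local-to-global principle. -/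
lemma Good_local {U : Set (Fin k → M)} (hU : IsOpen U) (iU : Inv U) {V : Set (Fin k → M)}
    (h : ∀ x ∈ V, ∃ W, x ∈ W ∧ W ⊆ V ∧ IsOpen W ∧ Inv W ∧ ∀ W' ⊆ W, IsOpen W' → Inv W' → Good U W') : Good U V := by
  let B : Set (Set (Fin k → M)) := {W | IsOpen W ∧ Inv W ∧ ∀ W' ⊆ W, IsOpen W' → Inv W' → Good U W'}
  have e : V = ⋃₀ {W | W ∈ B ∧ W ⊆ V} := by
    ext x
    constructor
    · intro hx
      obtain ⟨W, hxW, hWV, h1, h2, h3⟩ := h x hx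
      exact ⟨W, ⟨⟨h1, h2, h3⟩, hWV⟩, hxW⟩
    · rintro ⟨W, ⟨-, hW⟩, hx⟩
      exact hW hx
  rw [e]
  refine Good_sUnion hU iU (B := B) (fun W hW => hW.1) (fun W hW => hW.2.1) (fun W hW => hW.2.2 W subset_rfl hW.1 hW.2.1) ?_
    (fun W hW => hW.1)
  rintro W ⟨h1, h2, h3⟩ W' ⟨h1', h2', h3'⟩
  exact ⟨h1.inter h1', h2.inter h2', fun W'' hW'' => h3 W'' (hW''.trans Set.inter_subset_left)⟩

end unions

section strata
variable {k : ℕ} {M : Type} [TopologicalSpace M]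

/-- Tuples with at least `n` distinct entries. -/
def XN (k : ℕ) (M : Type) (n : ℕ) : Set (Fin k → M) := {x | ∃ f : Fin n → Fin k, Function.Injective (x ∘ f)}

lemma XN_zero : XN k M 0 = Set.univ := by
  ext x
  simp only [Set.mem_univ, iff_true]
  exact ⟨Fin.elim0, fun i => i.elim0⟩

lemma XN_succ (n : ℕ) : XN k M (n + 1) ⊆ XN k M n := by
  rintro x ⟨f, hf⟩
  exact ⟨f ∘ Fin.castSucc, hf.comp (Fin.castSucc_injective n)⟩

lemma XN_self : XN k M k = {x | Function.Injective x} := by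
  ext x
  constructor
  · rintro ⟨f, hf⟩
    have hfi : Function.Injective f := hf.of_comp
    have hfb := Finite.injective_iff_bijective.1 hfi
    intro i j hij
    obtain ⟨i, rfl⟩ := hfb.2 i
    obtain ⟨j, rfl⟩ := hfb.2 j
    rw [hf hij]
  · intro h
    exact ⟨id, h⟩

lemma XN_open [T2Space M] (n : ℕ) : IsOpen (XN k M n) := by
  have : XN k M n = ⋃ f : Fin n → Fin k, ⋂ i : Fin n, ⋂ j : Fin n, {x | i ≠ j → x (f i) ≠ x (f j)} := by
    ext x
    simp only [XN, Set.mem_setOf_eq, Set.mem_iUnion, Set.mem_iInter]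
    refine exists_congr fun f => ?_
    constructor
    · intro h i j hij he
      exact hij (h he)
    · intro h i j he
      by_contra hij
      exact h i j hij he
  rw [this]
  refine isOpen_iUnion fun f => isOpen_iInter_of_finite fun i => isOpen_iInter_of_finite fun j => ?_
  by_cases hij : i = j
  · simp [hij]
  · simp only [ne_eq, hij, not_false_eq_true, forall_true_left]
    exact isOpen_ne_fun (continuous_apply _) (continuous_apply _)

lemma XN_inv (n : ℕ) : Inv (XN k M n) := by
  rintro g x ⟨f, hf⟩
  refine ⟨g.symm ∘ f, ?_⟩
  have : pm g x ∘ (g.symm ∘ f) = x ∘ f := by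
    funext i
    change x (g (g.symm (f i))) = x (f i)
    rw [Equiv.apply_symm_apply]
  rwa [this]

lemma XN_label {n : ℕ} {x : Fin k → M} (hx : x ∈ XN k M n) (hx' : x ∉ XN k M (n + 1)) :
    ∃ (y : Fin n → M) (q : Fin k → Fin n), Function.Injective y ∧ Function.Surjective q ∧ ∀ i, x i = y (q i) := by
  obtain ⟨f, hf⟩ := hx
  have h : ∀ i, ∃ j, x i = x (f j) := by
    intro i
    by_contra hn
    push Not at hn
    refine hx' ⟨Fin.cons i f, ?_⟩
    rw [Fin.comp_cons, Fin.cons_injective_iff]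
    refine ⟨?_, hf⟩
    rintro ⟨j, hj⟩
    exact hn j hj.symm
  choose q hq using h
  refine ⟨x ∘ f, q, hf, fun j => ⟨f j, ?_⟩, hq⟩
  exact (hf (hq (f j))).symm

lemma VQ_inter_XN {n : ℕ} {D : Fin n → Set M} (hD : Pairwise (Function.onFun Disjoint D)) {q : Fin k → Fin n}
    (hq : Function.Surjective q) : VQ D q ∩ XN k M (n + 1) = VQ D q ∩ NL M q := by
  ext x
  refine and_congr_right fun hx => ?_
  have hdis : ∀ i j, x i = x j → q i = q j := by
    intro i j hij
    by_contra hne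
    have := hx j
    rw [← hij] at this
    exact Set.disjoint_left.1 (hD hne) (hx i) this
  constructor
  · rintro ⟨f, hf⟩
    obtain ⟨l, l', hne, heq⟩ := Fintype.exists_ne_map_eq_of_card_lt (q ∘ f) (by simp)
    exact ⟨f l, f l', heq, fun h => hne (hf h)⟩
  · rintro ⟨i, j, hij, hne⟩
    obtain ⟨f, hf⟩ := hq.hasRightInverse
    have hfi : Function.Injective (x ∘ f) := by
      intro l l' h
      have := hdis _ _ h
      rwa [hf, hf] at this
    have key : ∀ i', q i' = q i → x i' ≠ x (f (q i)) → x ∈ XN k M (n + 1) := by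
      intro i' h1 h2
      refine ⟨Fin.cons i' f, ?_⟩
      rw [Fin.comp_cons, Fin.cons_injective_iff]
      refine ⟨?_, hfi⟩
      rintro ⟨l, hl⟩
      have h3 := hdis _ _ hl
      rw [hf, h1] at h3
      rw [h3] at hl
      exact h2 hl.symm
    by_cases h : x i = x (f (q i))
    · exact key j hij.symm fun h' => hne (h.trans h'.symm)
    · exact key i rfl h

end strata
end CS

open CategoryTheory
open scoped DirectSum TensorProduct

namespace CS
open SMod

section gv
variable {d k n : ℕ} {M : Type} [TopologicalSpace M]

/-- Symmetrised product cell. -/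
def GV (D : Fin n → Set M) (p : Fin k → Fin n) : Set (Fin k → M) := {x | ∃ g : Equiv.Perm (Fin k), x ∈ VQ D (p ∘ g)}

lemma GV_inv (D : Fin n → Set M) (p : Fin k → Fin n) : Inv (GV D p) := by
  rintro h x ⟨g, hx⟩
  exact ⟨g * h, fun i => hx (h i)⟩

lemma VQ_open {D : Fin n → Set M} (hD : ∀ j, IsOpen (D j)) (q : Fin k → Fin n) : IsOpen (VQ D q) := by
  have : VQ D q = ⋂ i, (fun x : Fin k → M => x i) ⁻¹' D (q i) := by
    ext x; simp [VQ]
  rw [this]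
  exact isOpen_iInter_of_finite fun i => (hD _).preimage (continuous_apply i)

lemma GV_open {D : Fin n → Set M} (hD : ∀ j, IsOpen (D j)) (p : Fin k → Fin n) : IsOpen (GV D p) := by
  have : GV D p = ⋃ g : Equiv.Perm (Fin k), VQ D (p ∘ g) := by
    ext x; simp [GV]
  rw [this]
  exact isOpen_iUnion fun g => VQ_open hD _

lemma VQ_unique {D : Fin n → Set M} (hD : Pairwise (Function.onFun Disjoint D)) {q q' : Fin k → Fin n} {x : Fin k → M}
    (h : x ∈ VQ D q) (h' : x ∈ VQ D q') : q = q' := by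
  funext i
  by_contra hne
  exact Set.disjoint_left.1 (hD hne) (h i) (h' i)

lemma GV_simplex {D : Fin n → Set M} (hD : Pairwise (Function.onFun Disjoint D)) (oD : ∀ j, IsOpen (D j)) {p : Fin k → Fin n}
    {m : ℕ} {s : C(Δ m, Fin k → M)} (hs : Set.range s ⊆ GV D p) : ∃ g : Equiv.Perm (Fin k), Set.range s ⊆ VQ D (p ∘ g) := by
  have t0 : Δ m := vtx m 0
  obtain ⟨g, hg⟩ := hs ⟨t0, rfl⟩
  refine ⟨g, ?_⟩
  have hpc : _root_.IsPreconnected (Set.range s) := isPreconnected_range s.continuous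
  refine hpc.subset_left_of_subset_union (VQ_open oD _)
    (v := ⋃ q ∈ {q : Fin k → Fin n | q ≠ p ∘ g}, VQ D q) (isOpen_biUnion fun q _ => VQ_open oD q) ?_ ?_ ⟨_, ⟨t0, rfl⟩, hg⟩
  · rw [Set.disjoint_left]
    intro x hx hx'
    simp only [Set.mem_iUnion] at hx'
    obtain ⟨q, hq, hx'⟩ := hx'
    exact hq (VQ_unique hD hx' hx)
  · intro x hx
    obtain ⟨g', hg'⟩ := hs hx
    by_cases h : p ∘ g' = p ∘ g
    · left; rwa [← h]
    · right
      simp only [Set.mem_iUnion]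
      exact ⟨_, h, hg'⟩

/-- Projection to chains in a product cell. -/
noncomputable def prq (D : Fin n → Set M) (q : Fin k → Fin n) (m : ℕ) : (Sing (Fin k → M)).X m →ₗ[ℚ] (Sing (Fin k → M)).X m :=
  pushOn (continuousOn_id (s := VQ D q)) m

lemma prq_pos {D : Fin n → Set M} {q : Fin k → Fin n} {m : ℕ} {s : C(Δ m, Fin k → M)} (h : Set.range s ⊆ VQ D q) :
    prq D q m (sim s) = sim s := pushOn_sim _ h

lemma prq_neg {D : Fin n → Set M} {q : Fin k → Fin n} {m : ℕ} {s : C(Δ m, Fin k → M)} (h : ¬ Set.range s ⊆ VQ D q) :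
    prq D q m (sim s) = 0 := by
  rw [prq, pushOn, lin_sim, dif_neg h]

lemma prq_sub {D : Fin n → Set M} {q : Fin k → Fin n} {m : ℕ} {S : Set (Fin k → M)} {x : (Sing (Fin k → M)).X m}
    (hx : x ∈ sub S m) : prq D q m x ∈ sub (VQ D q ∩ S) m := by
  refine sub_le (fun s hs => ?_) hx
  by_cases h : Set.range s ⊆ VQ D q
  · rw [prq_pos h]
    exact sim_mem_sub (Set.subset_inter h hs)
  · rw [prq_neg h]
    exact Submodule.zero_mem _

lemma prq_ne {D : Fin n → Set M} (hD : Pairwise (Function.onFun Disjoint D)) {q q' : Fin k → Fin n} (hq : q' ≠ q)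
    {m : ℕ} {s : C(Δ m, Fin k → M)} (h : Set.range s ⊆ VQ D q') : prq D q m (sim s) = 0 :=
  prq_neg fun h' => hq (VQ_unique hD (h ⟨vtx m 0, rfl⟩) (h' ⟨vtx m 0, rfl⟩))

lemma prq_d {D : Fin n → Set M} (hD : Pairwise (Function.onFun Disjoint D)) (oD : ∀ j, IsOpen (D j)) {p : Fin k → Fin n}
    (q : Fin k → Fin n) {m : ℕ} {x : (Sing (Fin k → M)).X (m + 1)} (hx : x ∈ sub (GV D p) (m + 1)) :
    prq D q m ((Sing (Fin k → M)).d m x) = (Sing (Fin k → M)).d m (prq D q (m + 1) x) := by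
  refine sub_eqOn (f := prq D q m ∘ₗ (Sing (Fin k → M)).d m) (g := (Sing (Fin k → M)).d m ∘ₗ prq D q (m + 1)) (fun s hs => ?_) hx
  obtain ⟨g, hg⟩ := GV_simplex hD oD hs
  have hr : ∀ i : Fin (m + 2), Set.range (s.comp (smap (δ i))) ⊆ VQ D (p ∘ g) := by
    rintro i _ ⟨t, rfl⟩
    exact hg ⟨_, rfl⟩
  rw [LinearMap.comp_apply, LinearMap.comp_apply]
  by_cases h : p ∘ g = q
  · subst h
    rw [prq_pos hg, d_apply, map_sum]
    refine Finset.sum_congr rfl fun i _ => ?_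
    rw [map_smul, Sing_map_sim, prq_pos (hr i)]
  · rw [prq_ne hD h hg, d_apply, map_sum, map_zero]
    refine Finset.sum_eq_zero fun i _ => ?_
    rw [map_smul, Sing_map_sim, prq_ne hD h (hr i), smul_zero]

lemma prq_dd {D : Fin n → Set M} (hD : Pairwise (Function.onFun Disjoint D)) (oD : ∀ j, IsOpen (D j)) {p : Fin k → Fin n}
    (q : Fin k → Fin n) {m : ℕ} {x : (Sing (Fin k → M)).X m} (hx : x ∈ sub (GV D p) m) :
    prq D q (m - 1) ((Sing (Fin k → M)).dd m x) = (Sing (Fin k → M)).dd m (prq D q m x) := by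
  cases m with
  | zero => rw [dd_zero_apply, dd_zero_apply, map_zero]
  | succ m => exact prq_d hD oD q hx

open Classical in
/-- Label orbit. -/
noncomputable def Qs (p : Fin k → Fin n) : Finset (Fin k → Fin n) := Finset.univ.image fun g : Equiv.Perm (Fin k) => p ∘ g

lemma prq_sum {D : Fin n → Set M} (hD : Pairwise (Function.onFun Disjoint D)) (oD : ∀ j, IsOpen (D j)) {p : Fin k → Fin n}
    {m : ℕ} {x : (Sing (Fin k → M)).X m} (hx : x ∈ sub (GV D p) m) : x = ∑ q ∈ Qs p, prq D q m x := by
  rw [← LinearMap.sum_apply]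
  refine sub_eqOn (f := LinearMap.id) (fun s hs => ?_) hx
  obtain ⟨g, hg⟩ := GV_simplex hD oD hs
  rw [LinearMap.id_apply, LinearMap.sum_apply, Finset.sum_eq_single (p ∘ g)]
  · rw [prq_pos hg]
  · intro q _ hq
    exact prq_ne hD hq.symm hg
  · intro h
    exact absurd (Finset.mem_image.2 ⟨g, Finset.mem_univ _, rfl⟩) h

lemma GV_good (hd : Odd d) (hnk : n < k) {p : Fin k → Fin n} (hp : Function.Surjective p) {D : Fin n → Set M}
    (hD : Pairwise (Function.onFun Disjoint D)) (oD : ∀ j, IsOpen (D j))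
    (ψ : Fin n → M → EuclideanSpace ℝ (Fin d)) (χ : Fin n → EuclideanSpace ℝ (Fin d) → M)
    (hψ : ∀ j, ContinuousOn (ψ j) (D j)) (hχ : ∀ j, ContinuousOn (χ j) (ψ j '' D j))
    (hinv : ∀ j, ∀ x ∈ D j, χ j (ψ j x) = x) (hconv : ∀ j, Convex ℝ (ψ j '' D j))
    (hitr : ∀ j, (interior (ψ j '' D j)).Nonempty) : Good (XN k M (n + 1)) (GV D p) := by
  intro m c hc hdc
  have key : ∀ q ∈ Qs p, ∃ b ∈ sub (GV D p) (m + 1),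
      (avg k M).app m (prq D q m c) - (Sing (Fin k → M)).d m b ∈ sub (GV D p ∩ XN k M (n + 1)) m := by
    intro q hq
    obtain ⟨g, -, rfl⟩ := Finset.mem_image.1 hq
    have hsur : Function.Surjective (p ∘ g) := hp.comp g.surjective
    have hsub : VQ D (p ∘ g) ⊆ GV D p := fun x hx => ⟨g, hx⟩
    obtain ⟨a, b, hab, hqab⟩ := Fintype.exists_ne_map_eq_of_card_lt (p ∘ g) (by simpa using hnk)
    obtain ⟨e, he, u, hu, heq⟩ := cell_tau hd hab hqab ψ χ hψ hχ hinv hconv hitr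
      (sub_mono Set.inter_subset_left (prq_sub (D := D) (q := p ∘ g) hc)) (by
        rw [← prq_dd hD oD _ hc, ← VQ_inter_XN hD hsur]
        exact prq_sub (sub_mono Set.inter_subset_right hdc))
    rw [← VQ_inter_XN hD hsur] at hu
    refine ⟨(1 / 2 : ℚ) • (avg k M).app _ e, Submodule.smul_mem _ _ (avg_sub (GV_inv D p) (sub_mono hsub he)), ?_⟩
    have h2 := congrArg ((avg k M).app m) heq
    rw [map_add, map_add, avg_pm, Hom.d] at h2
    have h3 : (avg k M).app m (prq D (p ∘ g) m c) - (Sing (Fin k → M)).d m ((1 / 2 : ℚ) • (avg k M).app _ e) =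
        (1 / 2 : ℚ) • (avg k M).app m u := by
      rw [map_smul, sub_eq_iff_eq_add, ← smul_add, add_comm ((avg k M).app m u), ← h2]
      module
    rw [h3]
    exact Submodule.smul_mem _ _ (avg_sub ((GV_inv D p).inter (XN_inv _)) (sub_mono (Set.inter_subset_inter_left _ hsub) hu))
  choose! b hb h using key
  refine ⟨∑ q ∈ Qs p, b q, Submodule.sum_mem _ hb, ?_⟩
  have e : (avg k M).app m c - (Sing (Fin k → M)).d m (∑ q ∈ Qs p, b q) =
      ∑ q ∈ Qs p, ((avg k M).app m (prq D q m c) - (Sing (Fin k → M)).d m (b q)) := by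
    rw [Finset.sum_sub_distrib, ← map_sum, ← map_sum, ← prq_sum hD oD hc]
  rw [e]
  exact Submodule.sum_mem _ h

end gv
end CS

open CategoryTheory
open scoped DirectSum TensorProduct

namespace CS
open SMod

section charts
variable {d k n : ℕ} {H' : Type} [TopologicalSpace H'] (I : ModelWithCorners ℝ (EuclideanSpace ℝ (Fin d)) H')
  {M : Type} [TopologicalSpace M]

lemma chart_image_mem [ChartedSpace H' M] {y x : M} {O : Set M} (hO : IsOpen O) (hx : x ∈ O) (hs : O ⊆ (extChartAt I y).source) :
    ∃ r > 0, Metric.ball (extChartAt I y x) r ∩ Set.range I ⊆ extChartAt I y '' O := by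
  have h : extChartAt I y '' O ∈ nhdsWithin (extChartAt I y x) (Set.range I) := by
    rw [← map_extChartAt_nhds' (hs hx)]
    exact Filter.image_mem_map (hO.mem_nhds hx)
  exact Metric.mem_nhdsWithin_iff.1 h

lemma chart_mem_range [ChartedSpace H' M] {y x : M} : extChartAt I y x ∈ Set.range I := ⟨chartAt H' y x, rfl⟩

lemma chart_interior [ChartedSpace H' M] {y : M} {D : Set M} (hD : IsOpen D) (hne : D.Nonempty) (hs : D ⊆ (extChartAt I y).source) :
    (interior (extChartAt I y '' D)).Nonempty := by
  obtain ⟨x, hx⟩ := hne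
  obtain ⟨r, hr, h⟩ := chart_image_mem I hD hx hs
  have hc := I.range_subset_closure_interior (chart_mem_range I (y := y) (x := x))
  rw [mem_closure_iff] at hc
  obtain ⟨z, hz1, hz2⟩ := hc _ Metric.isOpen_ball (Metric.mem_ball_self hr)
  refine ⟨z, mem_interior.2 ⟨_, ?_, Metric.isOpen_ball.inter isOpen_interior, hz1, hz2⟩⟩
  exact (Set.inter_subset_inter_right _ interior_subset).trans h

lemma chart_convex [ChartedSpace H' M] {y x : M} {O : Set M} (hO : IsOpen O) (hx : x ∈ O) (hs : O ⊆ (extChartAt I y).source) :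
    ∃ D ⊆ O, IsOpen D ∧ x ∈ D ∧ Convex ℝ (extChartAt I y '' D) := by
  obtain ⟨r, hr, h⟩ := chart_image_mem I hO hx hs
  refine ⟨O ∩ extChartAt I y ⁻¹' Metric.ball (extChartAt I y x) r, Set.inter_subset_left,
    ((continuousOn_extChartAt y).mono hs).isOpen_inter_preimage hO Metric.isOpen_ball, ⟨hx, Metric.mem_ball_self hr⟩, ?_⟩
  have e : extChartAt I y '' (O ∩ extChartAt I y ⁻¹' Metric.ball (extChartAt I y x) r) =
      Metric.ball (extChartAt I y x) r ∩ Set.range I := by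
    ext z
    constructor
    · rintro ⟨w, ⟨-, hw⟩, rfl⟩
      exact ⟨hw, chart_mem_range I⟩
    · intro hz
      obtain ⟨w, hw, rfl⟩ := h hz
      exact ⟨w, ⟨hw, hz.1⟩, rfl⟩
  rw [e]
  exact (convex_ball _ _).inter I.convex_range

lemma GV_inter {E D D' : Fin n → Set M} (hE : Pairwise (Function.onFun Disjoint E)) (hD : ∀ j, D j ⊆ E j) (hD' : ∀ j, D' j ⊆ E j)
    (q : Fin k → Fin n) : GV D q ∩ GV D' q = GV (fun j => D j ∩ D' j) q := by
  ext x
  constructor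
  · rintro ⟨⟨g, hg⟩, ⟨g', hg'⟩⟩
    have e : q ∘ g = q ∘ g' := VQ_unique hE (fun i => hD _ (hg i)) (fun i => hD' _ (hg' i))
    refine ⟨g, fun i => ⟨hg i, ?_⟩⟩
    rw [e]
    exact hg' i
  · rintro ⟨g, hg⟩
    exact ⟨⟨g, fun i => (hg i).1⟩, ⟨g, fun i => (hg i).2⟩⟩

lemma GV_le {D : Fin n → Set M} {q : Fin k → Fin n} {W : Set (Fin k → M)} (iW : Inv W) (g : Equiv.Perm (Fin k))
    (h : VQ D (q ∘ g) ⊆ W) : GV D q ⊆ W := by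
  rintro z ⟨p, hz⟩
  have h1 : pm (p⁻¹ * g) z ∈ W := by
    refine h fun i => ?_
    have := hz (p.symm (g i))
    simp only [Function.comp_apply, Equiv.apply_symm_apply] at this
    exact this
  have h2 := iW (g⁻¹ * p) _ h1
  have e : pm (g⁻¹ * p) (pm (p⁻¹ * g) z) = z := by
    funext i
    change z (p⁻¹ (g (g⁻¹ (p i)))) = z i
    simp
  rwa [e] at h2

lemma local_good [ChartedSpace H' M] [T2Space M] (hd : Odd d) (hnk : n < k) {q : Fin k → Fin n} (hq : Function.Surjective q) {E : Fin n → Set M}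
    (hE : Pairwise (Function.onFun Disjoint E)) (oE : ∀ j, IsOpen (E j)) (y : Fin n → M)
    (hs : ∀ j, E j ⊆ (extChartAt I (y j)).source) {W : Set (Fin k → M)} (hW : W ⊆ GV E q) (oW : IsOpen W) (iW : Inv W) :
    Good (XN k M (n + 1)) W := by
  have oU : IsOpen (XN k M (n + 1)) := XN_open _
  have iU : Inv (XN k M (n + 1)) := XN_inv _
  let B : Set (Set (Fin k → M)) := {V | IsOpen V ∧ Inv V ∧ (V ⊆ XN k M (n + 1) ∨ ∃ D : Fin n → Set M,
    V = GV D q ∧ ∀ j, D j ⊆ E j ∧ IsOpen (D j) ∧ (D j).Nonempty ∧ Convex ℝ (extChartAt I (y j) '' D j))}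
  have e : W = ⋃₀ {V | V ∈ B ∧ V ⊆ W} := by
    ext x
    constructor
    · intro hx
      by_cases hxU : x ∈ XN k M (n + 1)
      · exact ⟨W ∩ XN k M (n + 1), ⟨⟨oW.inter oU, iW.inter iU, Or.inl Set.inter_subset_right⟩, Set.inter_subset_left⟩, hx, hxU⟩
      · obtain ⟨g, hg⟩ := hW hx
        have hqg : Function.Surjective (q ∘ g) := hq.comp g.surjective
        have hnl : ∀ i j, q (g i) = q (g j) → x i = x j := by
          intro i j hij
          by_contra hne
          have : x ∈ VQ E (q ∘ g) ∩ NL M (q ∘ g) := ⟨hg, i, j, hij, hne⟩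
          rw [← VQ_inter_XN hE hqg] at this
          exact hxU this.2
        obtain ⟨u, hu, huW⟩ := isOpen_pi_iff'.1 oW x hx
        obtain ⟨f, hf⟩ := hqg.hasRightInverse
        have key : ∀ j, ∃ D ⊆ (E j ∩ ⋂ i : {i // q (g i) = j}, u i), IsOpen D ∧ x (f j) ∈ D ∧
            Convex ℝ (extChartAt I (y j) '' D) := by
          intro j
          refine chart_convex I ((oE j).inter (isOpen_iInter_of_finite fun i => (hu i).1)) ⟨?_, ?_⟩
            (Set.inter_subset_left.trans (hs j))
          · have := hg (f j)
            rwa [hf] at this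
          · rw [Set.mem_iInter]
            rintro ⟨i, hi⟩
            have : x (f j) = x i := hnl _ _ ((hf j).trans hi.symm)
            rw [this]
            exact (hu i).2
        choose D hD1 hD2 hD3 hD4 using key
        refine ⟨GV D q, ⟨⟨GV_open hD2 q, GV_inv _ _, Or.inr ⟨D, rfl, fun j => ⟨(hD1 j).trans Set.inter_subset_left, hD2 j,
          ⟨_, hD3 j⟩, hD4 j⟩⟩⟩, GV_le iW g ?_⟩, ⟨g, fun i => ?_⟩⟩
        · intro z hz
          refine huW fun i _ => ?_
          have := (hD1 _ (hz i)).2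
          rw [Set.mem_iInter] at this
          exact this ⟨i, rfl⟩
        · have : x i = x (f (q (g i))) := hnl _ _ (hf _).symm
          rw [this]
          exact hD3 _
    · rintro ⟨V, ⟨-, hV⟩, hx⟩
      exact hV hx
  rw [e]
  refine Good_sUnion oU iU (B := B) (fun V hV => hV.1) (fun V hV => hV.2.1) ?_ ?_ (fun V hV => hV.1)
  · rintro V ⟨-, iV, hV | ⟨D, rfl, hD⟩⟩
    · exact Good_of_subset iV hV
    · have hDs : ∀ j, D j ⊆ (extChartAt I (y j)).source := fun j => (hD j).1.trans (hs j)
      refine GV_good hd hnk hq (fun i j hij => (hE hij).mono (hD i).1 (hD j).1) (fun j => (hD j).2.1)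
        (fun j => extChartAt I (y j)) (fun j => (extChartAt I (y j)).symm) (fun j => (continuousOn_extChartAt _).mono (hDs j))
        (fun j => (continuousOn_extChartAt_symm _).mono ?_) (fun j x hx => (extChartAt I (y j)).left_inv (hDs j hx))
        (fun j => (hD j).2.2.2) (fun j => chart_interior I (hD j).2.1 (hD j).2.2.1 (hDs j))
      rintro _ ⟨x, hx, rfl⟩
      exact (extChartAt I (y j)).map_source (hDs j hx)
  · rintro V ⟨oV, iV, hV⟩ V' ⟨oV', iV', hV'⟩
    refine ⟨oV.inter oV', iV.inter iV', ?_⟩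
    rcases hV with hV | ⟨D, rfl, hD⟩
    · exact Or.inl (Set.inter_subset_left.trans hV)
    rcases hV' with hV' | ⟨D', rfl, hD'⟩
    · exact Or.inl (Set.inter_subset_right.trans hV')
    rw [GV_inter hE (fun j => (hD j).1) (fun j => (hD' j).1)]
    by_cases hne : ∀ j, (D j ∩ D' j).Nonempty
    · refine Or.inr ⟨_, rfl, fun j => ⟨Set.inter_subset_left.trans (hD j).1, (hD j).2.1.inter (hD' j).2.1, hne j, ?_⟩⟩
      rw [((extChartAt I (y j)).injOn).image_inter ((hD j).1.trans (hs j)) ((hD' j).1.trans (hs j))]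
      exact (hD j).2.2.2.inter (hD' j).2.2.2
    · left
      push Not at hne
      obtain ⟨j, hj⟩ := hne
      rintro z ⟨g, hz⟩
      obtain ⟨i, hi⟩ := hq j
      have := hz (g.symm i)
      simp only [Function.comp_apply, Equiv.apply_symm_apply, hi] at this
      rw [hj] at this
      exact this.elim

lemma XN_good (I : ModelWithCorners ℝ (EuclideanSpace ℝ (Fin d)) H') [ChartedSpace H' M] [T2Space M] (hd : Odd d) (hnk : n < k) : Good (XN k M (n + 1)) (XN k M n) := by
  have oU : IsOpen (XN k M (n + 1)) := XN_open _
  have iU : Inv (XN k M (n + 1)) := XN_inv _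
  refine Good_local oU iU fun x hx => ?_
  by_cases hxU : x ∈ XN k M (n + 1)
  · exact ⟨XN k M (n + 1), hxU, XN_succ n, oU, iU, fun W' hW' _ iW' => Good_of_subset iW' hW'⟩
  obtain ⟨y, q, hy, hq, hxy⟩ := XN_label hx hxU
  obtain ⟨O, hO, hdis⟩ := (Set.finite_range y).t2_separation
  let E : Fin n → Set M := fun j => O (y j) ∩ (extChartAt I (y j)).source
  have oE : ∀ j, IsOpen (E j) := fun j => (hO _).2.inter (isOpen_extChartAt_source _)
  have hE : Pairwise (Function.onFun Disjoint E) := fun i j hij =>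
    (hdis ⟨i, rfl⟩ ⟨j, rfl⟩ (hy.ne hij)).mono Set.inter_subset_left Set.inter_subset_left
  refine ⟨GV E q ∩ XN k M n, ⟨⟨1, fun i => ?_⟩, hx⟩, Set.inter_subset_right, (GV_open oE q).inter (XN_open _),
    (GV_inv _ _).inter (XN_inv _), fun W' hW' oW' iW' => local_good I hd hnk hq hE oE y (fun j => Set.inter_subset_right)
      (hW'.trans Set.inter_subset_left) oW' iW'⟩
  rw [hxy i]
  exact ⟨(hO _).1, mem_extChartAt_source _⟩

lemma XN_iter (I : ModelWithCorners ℝ (EuclideanSpace ℝ (Fin d)) H') [ChartedSpace H' M] [T2Space M] (hd : Odd d) (n : ℕ) : n ≤ k → ∀ (m : ℕ) (c : (Sing (Fin k → M)).X m),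
    (Sing (Fin k → M)).dd m c ∈ sub (XN k M n) (m - 1) →
    ∃ (b : (Sing (Fin k → M)).X (m + 1)) (a : ℚ), a ≠ 0 ∧ a • (avg k M).app m c - (Sing (Fin k → M)).d m b ∈ sub (XN k M n) m := by
  induction n with
  | zero =>
    intro _ m c _
    refine ⟨0, 1, one_ne_zero, ?_⟩
    rw [XN_zero]
    exact sub_univ _
  | succ n ih =>
    intro hn m c hc
    obtain ⟨b, a, ha, h⟩ := ih (by omega) m c (sub_mono (XN_succ n) hc)
    have hdc : (Sing (Fin k → M)).dd m (a • (avg k M).app m c - (Sing (Fin k → M)).d m b) ∈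
        sub (XN k M n ∩ XN k M (n + 1)) (m - 1) := by
      rw [Set.inter_eq_right.2 (XN_succ n), map_sub, map_smul, dd_d, sub_zero, ← Hom.dd]
      exact Submodule.smul_mem _ _ (avg_sub (XN_inv _) hc)
    obtain ⟨b', -, h'⟩ := XN_good I hd (by omega : n < k) m _ h hdc
    refine ⟨(avg k M).app (m + 1) b + b', a * (k.factorial : ℚ), mul_ne_zero ha (by exact_mod_cast k.factorial_ne_zero), ?_⟩
    have := sub_mono Set.inter_subset_right h'
    rw [map_sub, map_smul, avg_avg, Hom.d, smul_smul] at this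
    rw [map_add, ← sub_sub]
    exact this

end charts
end CS

open CategoryTheory
open scoped DirectSum TensorProduct

namespace CS
open SMod

section cover
variable {k : ℕ} {M : Type} [TopologicalSpace M]

/-- Ordered configurations. -/
abbrev FF (k : ℕ) (M : Type) : Type := {f : Fin k → M // Function.Injective f}

/-- Inclusion of ordered configurations into the power. -/
def cinc (k : ℕ) (M : Type) [TopologicalSpace M] : C(FF k M, Fin k → M) := ⟨Subtype.val, continuous_subtype_val⟩

/-- Projection to unordered configurations. -/
def pr (k : ℕ) (M : Type) [TopologicalSpace M] : C(FF k M, UnordConfigSpace M k) :=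
  ⟨fun x => Quotient.mk (configSetoid M k) x, continuous_quotient_mk'⟩

/-- Permutation action on ordered configurations. -/
def pF (g : Equiv.Perm (Fin k)) : C(FF k M, FF k M) :=
  ⟨fun x => ⟨x.1 ∘ g, x.2.comp g.injective⟩, Continuous.subtype_mk ((pm g).continuous.comp continuous_subtype_val) _⟩

lemma inc_pF (g : Equiv.Perm (Fin k)) : (cinc k M).comp (pF g) = (pm g).comp (cinc k M) := rfl

lemma pr_eq {x y : FF k M} : pr k M x = pr k M y ↔ ∃ g, pF g x = y := by
  have : pr k M x = pr k M y ↔ (configSetoid M k) x y := Quotient.eq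
  rw [this]
  exact exists_congr fun g => ⟨fun h => Subtype.ext h, fun h => congrArg Subtype.val h⟩

lemma pr_pF (g : Equiv.Perm (Fin k)) : (pr k M).comp (pF g) = pr k M := by
  ext x
  exact (pr_eq.2 ⟨g, rfl⟩).symm

instance FFact : MulAction (Equiv.Perm (Fin k)) (FF k M) where
  smul g x := pF g⁻¹ x
  one_smul x := rfl
  mul_smul g h x := Subtype.ext (by
    change x.1 ∘ ⇑(g * h)⁻¹ = (x.1 ∘ ⇑h⁻¹) ∘ ⇑g⁻¹
    rw [mul_inv_rev]
    rfl)

lemma pr_cover [T2Space M] : IsQuotientCoveringMap (pr k M) (Equiv.Perm (Fin k)) where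
  surjective := Quotient.mk_surjective
  eq_coinduced := rfl
  continuous_const_smul g := (pF g⁻¹).continuous
  apply_eq_iff_mem_orbit {x y} := by
    rw [eq_comm, pr_eq]
    constructor
    · rintro ⟨g, hg⟩
      refine ⟨g⁻¹, ?_⟩
      change pF g⁻¹⁻¹ y = x
      rw [inv_inv, hg]
    · rintro ⟨g, hg⟩
      exact ⟨g⁻¹, hg⟩
  disjoint e := by
    obtain ⟨O, hO, hdis⟩ := (Set.finite_range e.1).t2_separation
    refine ⟨{f : FF k M | ∀ i, f.1 i ∈ O (e.1 i)}, ?_, ?_⟩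
    · refine IsOpen.mem_nhds ?_ fun i => (hO _).1
      have : {f : FF k M | ∀ i, f.1 i ∈ O (e.1 i)} = ⋂ i, (fun f : FF k M => f.1 i) ⁻¹' O (e.1 i) := by
        ext f; simp
      rw [this]
      exact isOpen_iInter_of_finite fun i => (hO _).2.preimage ((continuous_apply i).comp continuous_subtype_val)
    · rintro g ⟨_, ⟨f, hf, rfl⟩, hf'⟩
      have key : ∀ i, g⁻¹ i = i := by
        intro i
        by_contra hne
        refine Set.disjoint_left.1 (hdis ⟨g⁻¹ i, rfl⟩ ⟨i, rfl⟩ (e.2.ne hne)) (hf _) (hf' i)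
      have : g⁻¹ = 1 := Equiv.ext key
      rwa [inv_eq_one] at this

lemma Δ_convex (n : ℕ) : Convex ℝ (stdSimplex ℝ (Fin (n + 1))) := convex_stdSimplex ℝ _

lemma lift_unique [T2Space M] {n : ℕ} (s : C(Δ n, UnordConfigSpace M k)) (e : FF k M) (he : pr k M e = s (vtx n 0)) :
    ∃! t : C(Δ n, FF k M), t (vtx n 0) = e ∧ pr k M ∘ t = s := by
  have : ContractibleSpace (Δ n) := (Δ_convex n).contractibleSpace ⟨_, (vtx n 0).2⟩
  have : LocallyPathConnectedSpace (Δ n) := (Δ_convex n).locallyPathConnectedSpace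
  exact pr_cover.isCoveringMap.existsUnique_continuousMap_lifts s (vtx n 0) e he

lemma lift_exists [T2Space M] {n : ℕ} (s : C(Δ n, UnordConfigSpace M k)) : ∃ t : C(Δ n, FF k M), (pr k M).comp t = s := by
  obtain ⟨e, he⟩ := (pr_cover (k := k) (M := M)).surjective (s (vtx n 0))
  obtain ⟨t, ⟨-, ht⟩, -⟩ := lift_unique s e he
  exact ⟨t, ContinuousMap.ext fun x => congrFun ht x⟩

lemma lift_torsor [T2Space M] {n : ℕ} {t t' : C(Δ n, FF k M)} (h : (pr k M).comp t = (pr k M).comp t') :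
    ∃ g, (pF g).comp t = t' := by
  have h0 : pr k M (t (vtx n 0)) = pr k M (t' (vtx n 0)) := congrArg (fun f => f (vtx n 0)) h
  obtain ⟨g, hg⟩ := pr_eq.1 h0
  refine ⟨g, (lift_unique ((pr k M).comp t') (t' (vtx n 0)) rfl).unique ⟨hg, ?_⟩ ⟨rfl, rfl⟩⟩
  have : (pr k M).comp ((pF g).comp t) = (pr k M).comp t' := by
    rw [← ContinuousMap.comp_assoc, pr_pF, h]
  exact congrArg DFunLike.coe this

/-- A chosen lift. -/
noncomputable def Lf [T2Space M] {n : ℕ} (s : C(Δ n, UnordConfigSpace M k)) : C(Δ n, FF k M) := (lift_exists s).choose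

lemma Lf_spec [T2Space M] {n : ℕ} (s : C(Δ n, UnordConfigSpace M k)) : (pr k M).comp (Lf s) = s := (lift_exists s).choose_spec

lemma avg_lift [T2Space M] {n : ℕ} {t t' : C(Δ n, FF k M)} (h : (pr k M).comp t = (pr k M).comp t') :
    (avg k M).app n (sim ((cinc k M).comp t)) = (avg k M).app n (sim ((cinc k M).comp t')) := by
  obtain ⟨g, rfl⟩ := lift_torsor h
  rw [← ContinuousMap.comp_assoc, inc_pF, ContinuousMap.comp_assoc]
  exact ((congrArg _ (push_sim (pm g) _)).symm.trans (avg_pm g _)).symm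

/-- Transfer followed by the inclusion into the power. -/
noncomputable def TrM (k : ℕ) (M : Type) [TopologicalSpace M] [T2Space M] : Hom (Sing (UnordConfigSpace M k)) (Sing (Fin k → M)) where
  app n := lin fun s => (avg k M).app n (sim ((cinc k M).comp (Lf s)))
  comm {m n} f x := by
    refine LinearMap.congr_fun (f := (lin fun s => (avg k M).app _ (sim ((cinc k M).comp (Lf s)))) ∘ₗ (Sing _).map f)
      (g := (Sing _).map f ∘ₗ (lin fun s => (avg k M).app _ (sim ((cinc k M).comp (Lf s)))))
      (Sing_hom_ext fun s => ?_) x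
    rw [LinearMap.comp_apply, LinearMap.comp_apply, Sing_map_sim, lin_sim, lin_sim, ← (avg k M).comm, Sing_map_sim]
    refine avg_lift (t' := (Lf s).comp (smap f)) ?_
    rw [Lf_spec, ← ContinuousMap.comp_assoc, Lf_spec]

lemma TT_pr [T2Space M] {n : ℕ} (z : (Sing (FF k M)).X n) :
    (TrM k M).app n ((push (pr k M)).app n z) = (avg k M).app n ((push (cinc k M)).app n z) := by
  refine LinearMap.congr_fun (f := (TrM k M).app n ∘ₗ (push (pr k M)).app n)
    (g := (avg k M).app n ∘ₗ (push (cinc k M)).app n) (Sing_hom_ext fun s => ?_) z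
  rw [LinearMap.comp_apply, LinearMap.comp_apply, push_sim, push_sim]
  refine (lin_sim _ _).trans (avg_lift ?_)
  rw [Lf_spec]

lemma pr_surj [T2Space M] {n : ℕ} (x : (Sing (UnordConfigSpace M k)).X n) : ∃ z, (push (pr k M)).app n z = x := by
  refine Sing_induction (P := fun x => ∃ z, (push (pr k M)).app n z = x) x ⟨0, map_zero _⟩ ?_ ?_
  · rintro x y ⟨z, rfl⟩ ⟨w, rfl⟩
    exact ⟨z + w, map_add _ _ _⟩
  · intro c s
    refine ⟨c • sim (Lf s), ?_⟩
    rw [map_smul, push_sim, Lf_spec]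

lemma inc_lift {n : ℕ} {c : (Sing (Fin k → M)).X n} (hc : c ∈ sub (XN k M k) n) : ∃ w, (push (cinc k M)).app n w = c := by
  refine sub_le (f := LinearMap.id) (p := LinearMap.range ((push (cinc k M)).app n)) (fun s hs => ?_) hc
  rw [XN_self] at hs
  refine ⟨sim ⟨fun t => ⟨s t, hs ⟨t, rfl⟩⟩, Continuous.subtype_mk s.continuous _⟩, ?_⟩
  rw [push_sim]
  rfl

lemma inc_inj {n : ℕ} : Function.Injective ((push (cinc k M)).app n) := by
  classical
  let r : (Sing (Fin k → M)).X n →ₗ[ℚ] (Sing (FF k M)).X n := lin fun s =>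
    if h : ∀ t, Function.Injective (s t) then sim ⟨fun t => ⟨s t, h t⟩, Continuous.subtype_mk s.continuous _⟩ else 0
  have h : ∀ x, r ((push (cinc k M)).app n x) = x := by
    intro x
    refine LinearMap.congr_fun (f := r ∘ₗ (push (cinc k M)).app n) (g := LinearMap.id) (Sing_hom_ext fun s => ?_) x
    rw [LinearMap.comp_apply, push_sim]
    refine (lin_sim _ _).trans ?_
    exact (dif_pos (fun t => (s t).2)).trans rfl
  exact Function.LeftInverse.injective h

/-- Norm on ordered configurations. -/
noncomputable def avF {n : ℕ} (z : (Sing (FF k M)).X n) : (Sing (FF k M)).X n :=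
  ∑ g : Equiv.Perm (Fin k), (push (pF g)).app n z

lemma inc_avF {n : ℕ} (z : (Sing (FF k M)).X n) :
    (push (cinc k M)).app n (avF z) = (avg k M).app n ((push (cinc k M)).app n z) := by
  rw [avg_apply, avF, map_sum]
  refine Finset.sum_congr rfl fun g _ => ?_
  rw [← push_comp, ← push_comp, inc_pF]

lemma pr_avF {n : ℕ} (z : (Sing (FF k M)).X n) :
    (push (pr k M)).app n (avF z) = (k.factorial : ℚ) • (push (pr k M)).app n z := by
  rw [avF, map_sum, Finset.sum_congr rfl fun g _ => by rw [← push_comp, pr_pF]]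
  rw [Finset.sum_const, Finset.card_univ, Fintype.card_perm, Fintype.card_fin, Nat.cast_smul_eq_nsmul]

variable {d : ℕ} {H' : Type} [TopologicalSpace H']

lemma TT_inj (I : ModelWithCorners ℝ (EuclideanSpace ℝ (Fin d)) H') [ChartedSpace H' M] [T2Space M] (hd : Odd d) (i : ℕ) :
    Function.Injective ((TrM k M).H i) := by
  rw [injective_iff_map_eq_zero]
  intro x hx
  obtain ⟨x, hx0, rfl⟩ := cls_surj _ x
  rw [Hom.H_cls, cls_eq_zero] at hx
  obtain ⟨y, hy⟩ := hx
  obtain ⟨z, rfl⟩ := pr_surj x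
  rw [TT_pr] at hy
  have hz : (push (cinc k M)).app i z ∈ sub (XN k M k) i := by
    have := push_sub (f := cinc k M) (S := Set.univ) (T := XN k M k) (fun x _ => by rw [XN_self]; exact x.2) (sub_univ z)
    exact this
  obtain ⟨b, a, ha, h⟩ := XN_iter I hd k le_rfl (i + 1) y (by
    change (Sing (Fin k → M)).d i y ∈ sub (XN k M k) i
    rw [hy]
    exact avg_sub (XN_inv _) hz)
  obtain ⟨w, hw⟩ := inc_lift h
  have h1 : (Sing (FF k M)).d i w = (a * (k.factorial : ℚ)) • avF z := by
    apply inc_inj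
    rw [Hom.d, hw, map_sub, map_smul, d_d, sub_zero, ← Hom.d, hy, avg_avg, map_smul, inc_avF, smul_smul]
  rw [cls_eq_zero]
  have hk : (k.factorial : ℚ) ≠ 0 := by exact_mod_cast k.factorial_ne_zero
  refine ⟨(a * (k.factorial : ℚ) * (k.factorial : ℚ))⁻¹ • (push (pr k M)).app (i + 1) w, ?_⟩
  rw [map_smul, ← Hom.d, h1, map_smul, pr_avF, smul_smul, smul_smul, ← mul_assoc, mul_assoc _ _ (k.factorial : ℚ), ]
  rw [mul_assoc, mul_assoc, ← mul_assoc a, inv_mul_cancel₀ (mul_ne_zero (mul_ne_zero ha hk) hk), one_smul]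

lemma TT_range (I : ModelWithCorners ℝ (EuclideanSpace ℝ (Fin d)) H') [ChartedSpace H' M] [T2Space M] (hd : Odd d) (i : ℕ) :
    LinearMap.range ((TrM k M).H i) = LinearMap.range ((avg k M).H i) := by
  have hk : (k.factorial : ℚ) ≠ 0 := by exact_mod_cast k.factorial_ne_zero
  apply le_antisymm
  · rintro _ ⟨x, rfl⟩
    obtain ⟨x, hx, rfl⟩ := cls_surj _ x
    refine ⟨(k.factorial : ℚ)⁻¹ • (TrM k M).H i (cls _ x hx), ?_⟩
    rw [map_smul, Hom.H_cls, Hom.H_cls, ← cls_smul]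
    obtain ⟨z, rfl⟩ := pr_surj x
    rw [cls_eq]
    refine ⟨0, ?_⟩
    rw [TT_pr, avg_avg, smul_smul, inv_mul_cancel₀ hk, one_smul, sub_self, map_zero]
  · rintro _ ⟨x, rfl⟩
    obtain ⟨x, hx, rfl⟩ := cls_surj _ x
    obtain ⟨b, a, ha, h⟩ := XN_iter I hd k le_rfl i x (by rw [hx]; exact Submodule.zero_mem _)
    obtain ⟨w, hw⟩ := inc_lift h
    have hw0 : (Sing (FF k M)).dd i w = 0 := by
      apply inc_inj
      rw [Hom.dd, hw, map_sub, map_smul, dd_d, (avg k M).dd_app hx, map_zero, smul_zero, sub_zero]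
    refine ⟨(a * (k.factorial : ℚ))⁻¹ • cls _ _ ((push (pr k M)).dd_app hw0), ?_⟩
    rw [map_smul, Hom.H_cls, Hom.H_cls, ← cls_smul, cls_eq]
    refine ⟨-((a * (k.factorial : ℚ))⁻¹ • (avg k M).app (i + 1) b), ?_⟩
    rw [TT_pr, hw, map_sub, map_smul, avg_avg, map_neg, map_smul, Hom.d, smul_sub, smul_smul, smul_smul, mul_assoc,
      inv_mul_cancel₀ (mul_ne_zero ha hk), one_smul]
    abel

lemma avg_ker (i : ℕ) : LinearMap.ker ((avg k M).H i) = coi M k i := by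
  have hk : (k.factorial : ℚ) ≠ 0 := by exact_mod_cast k.factorial_ne_zero
  have hsum : ∀ y, (avg k M).H i y = ∑ g : Equiv.Perm (Fin k), (push (pm g)).H i y := by
    intro y
    obtain ⟨x, hx, rfl⟩ := cls_surj _ y
    have e : ∀ s : Finset (Equiv.Perm (Fin k)), ∃ h, ∑ g ∈ s, (push (pm g)).H i (cls _ x hx) =
        cls (Sing (Fin k → M)) (∑ g ∈ s, (push (pm g)).app i x) h := by
      intro s
      refine ⟨by rw [map_sum]; exact Finset.sum_eq_zero fun g _ => (push (pm g)).dd_app hx, ?_⟩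
      classical
      induction s using Finset.induction_on with
      | empty => rw [Finset.sum_empty]; rfl
      | insert g s hg ih =>
        rw [Finset.sum_insert hg, ih, Hom.H_cls, ← cls_add]
        simp only [Finset.sum_insert hg]
    obtain ⟨h, e⟩ := e Finset.univ
    rw [e, Hom.H_cls]
    simp only [avg_apply]
  apply le_antisymm
  · intro y hy
    have hy' : (avg k M).H i y = 0 := hy
    have h1 : ∑ g : Equiv.Perm (Fin k), (y - (push (pm g)).H i y) = (k.factorial : ℚ) • y := by
      rw [Finset.sum_sub_distrib, ← hsum, hy', sub_zero, Finset.sum_const, Finset.card_univ, Fintype.card_perm,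
        Fintype.card_fin, Nat.cast_smul_eq_nsmul]
    have h2 : (k.factorial : ℚ) • y ∈ coi M k i := by
      rw [← h1]
      exact Submodule.sum_mem _ fun g _ => Submodule.subset_span ⟨g, y, rfl⟩
    exact (Submodule.smul_mem_iff _ hk).1 h2
  · rw [coi, Submodule.span_le]
    rintro _ ⟨g, y, rfl⟩
    change (avg k M).H i _ = 0
    rw [map_sub, sub_eq_zero]
    obtain ⟨x, hx, rfl⟩ := cls_surj _ y
    rw [Hom.H_cls, Hom.H_cls, Hom.H_cls]
    simp only [avg_pm]

theorem config_main (I : ModelWithCorners ℝ (EuclideanSpace ℝ (Fin d)) H') [ChartedSpace H' M] [T2Space M] (hd : Odd d) (k i : ℕ) :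
    Nonempty ((SingularHomology ℚ i (UnordConfigSpace M k)) ≃ₗ[ℚ] (SymComponent (fun j => SingularHomology ℚ j M) k i)) := by
  obtain ⟨e0⟩ := bridge (UnordConfigSpace M k) i
  obtain ⟨e4⟩ := pow_coinv (M := M) (fun j => SingularHomology ℚ j M) (fun j => bridge M j) k i
  let e1 := LinearEquiv.ofInjective ((TrM k M).H i) (TT_inj I hd i)
  let e2 := LinearEquiv.ofEq _ _ (TT_range (k := k) (M := M) I hd i)
  let e3 := ((avg k M).H i).quotKerEquivRange.symm
  let e3' := Submodule.quotEquivOfEq _ _ (avg_ker (k := k) (M := M) i)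
  exact ⟨e0 ≪≫ₗ e1 ≪≫ₗ e2 ≪≫ₗ e3 ≪≫ₗ e3' ≪≫ₗ e4⟩

end cover
end CS

/-- **Bödigheimer–Cohen–Taylor.** Let `M` be a connected manifold of finite type of odd
dimension `d`. Then for every `k` there is an isomorphism of graded `ℚ`-vector spaces
`H_*(C_k(M); ℚ) ≅ Sym^k(H_*(M; ℚ))`, i.e. in each degree `i` the `i`-th homology of
`C_k(M)` is isomorphic to the internal-degree-`i` component of `Sym^k` of the graded
vector space `H_*(M; ℚ)`. -/
theorem homology_of_configuration_spaces_odd_dim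
    (d : ℕ) (hd : Odd d) {H' : Type} [TopologicalSpace H']
    (I : ModelWithCorners ℝ (EuclideanSpace ℝ (Fin d)) H')
    (M : Type) [TopologicalSpace M] [ChartedSpace H' M]
    [T2Space M] [SecondCountableTopology M] [ConnectedSpace M]
    (hfin : ∀ i : ℕ, Module.Finite ℚ (SingularHomology ℚ i M))
    (k : ℕ) :
    ∀ i : ℕ, Nonempty
      ((SingularHomology ℚ i (UnordConfigSpace M k)) ≃ₗ[ℚ]
        (SymComponent (fun j => SingularHomology ℚ j M) k i)) := by
  exact fun i => CS.config_main I hd k i
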